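/- arXiv:2302.01655 — 3 statements merged into one kernel-verified Lean document; each statement's English description precedes it below -/
import Mathlib

section
/- There is an absolute constant C > 0 with the following property. Let q0 be a prime power and F a finite field with q0² elements with involution x ↦ x^{q0}. Let n ≥ 1, let a ∈ U, and let m be an integer with 0 ≤ m ≤ n^{1/2}. Then the number of †-symmetric monic polynomials f of degree n over F with constant coefficient a that can be written as f = g·g†·h with g, h monic polynomials over F, g(0) ≠ 0, and deg h ≤ m, is at most C·q0^{n−1}·(m+1)/n^{1/2}. -/
open Polynomial

/-- `f` is †-symmetric with respect to the involution `σ`. -/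
def IsDaggerSymm {F : Type} [Field F] (σ : F →+* F) (f : F[X]) : Prop :=
  f.coeff 0 ≠ 0 ∧ (f.map σ).reverse = Polynomial.C (σ (f.coeff 0)) * f

/-- The conjugate-reciprocal `g†(X) = X^{deg g} ḡ(1/X)/ḡ(0)` of a polynomial with `g(0) ≠ 0`,
where `ḡ` applies the involution `σ` to the coefficients of `g`. -/
noncomputable def daggerRev {F : Type} [Field F] (σ : F →+* F) (g : F[X]) : F[X] :=
  Polynomial.C (σ (g.coeff 0))⁻¹ * (g.map σ).reverse

section Dagger

variable {F : Type} [Field F] {σ : F →+* F}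

lemma daggerRev_mul (f g : F[X]) : daggerRev σ (f * g) = daggerRev σ f * daggerRev σ g := by
  simp only [daggerRev, Polynomial.map_mul, reverse_mul_of_domain, mul_coeff_zero, map_mul,
    mul_inv]
  ring

lemma daggerRev_one : daggerRev σ (1 : F[X]) = 1 := by
  rw [daggerRev, Polynomial.map_one, ← C_1, reverse_C, coeff_C_zero]; simp

lemma natDegree_daggerRev {f : F[X]} (h : f.coeff 0 ≠ 0) :
    (daggerRev σ f).natDegree = f.natDegree := by
  have h0 : (f.map σ).coeff 0 ≠ 0 := by simpa using h
  rw [daggerRev, natDegree_C_mul (by simpa using h), reverse_natDegree,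
    natTrailingDegree_eq_zero.2 (Or.inr h0), natDegree_map, Nat.sub_zero]

lemma coeff_daggerRev (f : F[X]) {i : ℕ} (hi : i ≤ f.natDegree) :
    (daggerRev σ f).coeff i = (σ (f.coeff 0))⁻¹ * σ (f.coeff (f.natDegree - i)) := by
  rw [daggerRev, coeff_C_mul, coeff_reverse, natDegree_map, revAt_le hi, coeff_map]

lemma monic_daggerRev {f : F[X]} (h : f.coeff 0 ≠ 0) : (daggerRev σ f).Monic := by
  rw [Monic, leadingCoeff, natDegree_daggerRev h, coeff_daggerRev f le_rfl, Nat.sub_self]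
  exact inv_mul_cancel₀ (by simpa using h)

lemma coeff_zero_daggerRev {f : F[X]} (hf : f.Monic) :
    (daggerRev σ f).coeff 0 = (σ (f.coeff 0))⁻¹ := by
  rw [coeff_daggerRev f (Nat.zero_le _), Nat.sub_zero, hf.coeff_natDegree, map_one, mul_one]

lemma coeff_zero_daggerRev_ne_zero {f : F[X]} (hf : f.Monic) (h : f.coeff 0 ≠ 0) :
    (daggerRev σ f).coeff 0 ≠ 0 := by
  rw [coeff_zero_daggerRev hf]
  exact inv_ne_zero (by simpa using h)

lemma daggerRev_daggerRev (hσ : ∀ x, σ (σ x) = x) {f : F[X]} (hf : f.Monic)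
    (h : f.coeff 0 ≠ 0) : daggerRev σ (daggerRev σ f) = f := by
  have hd : (daggerRev σ f).natDegree = f.natDegree := natDegree_daggerRev h
  have hm := monic_daggerRev (σ := σ) h
  have h0 := coeff_zero_daggerRev_ne_zero (σ := σ) hf h
  ext i
  by_cases hi : i ≤ f.natDegree
  · rw [coeff_daggerRev _ (hd ▸ hi), coeff_zero_daggerRev hf, hd,
      coeff_daggerRev _ (Nat.sub_le _ _), Nat.sub_sub_self hi, map_mul, map_inv₀, hσ, hσ,
      inv_inv, mul_inv_cancel_left₀ h]
  · push Not at hi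
    rw [coeff_eq_zero_of_natDegree_lt hi, coeff_eq_zero_of_natDegree_lt]
    rwa [natDegree_daggerRev h0, hd]

lemma isDaggerSymm_iff {f : F[X]} :
    IsDaggerSymm σ f ↔ f.coeff 0 ≠ 0 ∧ daggerRev σ f = f := by
  refine and_congr_right fun h => ?_
  have hs : σ (f.coeff 0) ≠ 0 := by simpa using h
  have hC : (C (σ (f.coeff 0))⁻¹ : F[X]) * C (σ (f.coeff 0)) = 1 := by
    rw [← C_mul, inv_mul_cancel₀ hs, C_1]
  rw [daggerRev]
  refine ⟨fun e => by rw [e, ← mul_assoc, hC, one_mul], fun e => ?_⟩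
  calc (f.map σ).reverse = C (σ (f.coeff 0)) * (C (σ (f.coeff 0))⁻¹ * (f.map σ).reverse) := by
        rw [← mul_assoc, mul_comm (C _), hC, one_mul]
    _ = _ := by rw [e]

lemma irreducible_daggerRev (hσ : ∀ x, σ (σ x) = x) {p : F[X]} (hp : Irreducible p)
    (hm : p.Monic) (h : p.coeff 0 ≠ 0) : Irreducible (daggerRev σ p) := by
  have h0 := coeff_zero_daggerRev_ne_zero (σ := σ) hm h
  rw [(monic_daggerRev h).irreducible_iff_natDegree]
  obtain ⟨h1, h2⟩ := hm.irreducible_iff_natDegree.1 hp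
  refine ⟨fun e => h1 ?_, fun f g hf hg e => ?_⟩
  · rw [← daggerRev_daggerRev hσ hm h, e, daggerRev_one]
  · rw [← e, mul_coeff_zero] at h0
    have hf0 := left_ne_zero_of_mul h0
    have hg0 := right_ne_zero_of_mul h0
    have := h2 _ _ (monic_daggerRev (σ := σ) hf0) (monic_daggerRev (σ := σ) hg0)
      (by rw [← daggerRev_mul, e, daggerRev_daggerRev hσ hm h])
    rwa [natDegree_daggerRev hf0, natDegree_daggerRev hg0] at this

lemma daggerRev_mul_self_symm (hσ : ∀ x, σ (σ x) = x) {g : F[X]} (hm : g.Monic)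
    (h : g.coeff 0 ≠ 0) : daggerRev σ (g * daggerRev σ g) = g * daggerRev σ g := by
  rw [daggerRev_mul, daggerRev_daggerRev hσ hm h, mul_comm]

lemma monic_coeff_zero_induction {P : F[X] → Prop} (one : P 1)
    (mul : ∀ p g : F[X], Irreducible p → p.Monic → p.coeff 0 ≠ 0 → g.Monic → g.coeff 0 ≠ 0 →
      P g → P (p * g)) (f : F[X]) (hf : f.Monic) (h : f.coeff 0 ≠ 0) : P f := by
  induction hn : f.natDegree using Nat.strong_induction_on generalizing f with
  | _ n ih =>
    by_cases hu : IsUnit f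
    · rw [hf.isUnit_iff.1 hu]; exact one
    · obtain ⟨p, hpm, hp, g, rfl⟩ := exists_monic_irreducible_factor f hu
      have hg : g.Monic := hpm.of_mul_monic_left hf
      rw [mul_coeff_zero] at h
      refine mul p g hp hpm (left_ne_zero_of_mul h) hg (right_ne_zero_of_mul h)
        (ih _ ?_ g hg (right_ne_zero_of_mul h) rfl)
      rw [← hn, hpm.natDegree_mul hg]
      have := hp.natDegree_pos
      omega

/-- Monic polynomials with nonzero constant term all of whose monic irreducible factors
satisfy `T`. -/
def FactorsIn (T : F[X] → Prop) (r : F[X]) : Prop :=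
  r.Monic ∧ r.coeff 0 ≠ 0 ∧ ∀ p : F[X], Irreducible p → p.Monic → p ∣ r → T p

lemma FactorsIn.one (T : F[X] → Prop) : FactorsIn T (1 : F[X]) :=
  ⟨monic_one, by simp, fun _ hp _ hd => absurd (isUnit_of_dvd_one hd) hp.not_isUnit⟩

lemma FactorsIn.mul {T : F[X] → Prop} {p r : F[X]} (hp : Irreducible p) (hm : p.Monic)
    (h0 : p.coeff 0 ≠ 0) (hT : T p) (hr : FactorsIn T r) : FactorsIn T (p * r) := by
  refine ⟨hm.mul hr.1, by rw [mul_coeff_zero]; exact mul_ne_zero h0 hr.2.1,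
    fun q hq hqm hd => ?_⟩
  rcases hq.prime.dvd_or_dvd hd with hd | hd
  · rwa [eq_of_monic_of_associated hqm hm (hq.associated_of_dvd hp hd)]
  · exact hr.2.2 q hq hqm hd

lemma FactorsIn.of_mul_left {T : F[X] → Prop} {p r : F[X]} (hm : p.Monic)
    (h : FactorsIn T (p * r)) : FactorsIn T r := by
  obtain ⟨h1, h2, h3⟩ := h
  rw [mul_coeff_zero] at h2
  exact ⟨hm.of_mul_monic_left h1, right_ne_zero_of_mul h2,
    fun q hq hqm hd => h3 q hq hqm (hd.mul_left p)⟩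

lemma exists_factorsIn_daggerRev (hσ : ∀ x, σ (σ x) = x) (e : F[X] → ℕ) (g : F[X])
    (hg : g.Monic) (h : g.coeff 0 ≠ 0) :
    ∃ r, FactorsIn (fun p => e p ≤ e (daggerRev σ p)) r ∧ r.natDegree = g.natDegree ∧
      r * daggerRev σ r = g * daggerRev σ g := by
  revert g
  refine monic_coeff_zero_induction ?_ ?_
  · exact ⟨1, FactorsIn.one _, rfl, rfl⟩
  · rintro p g hp hm h0 hg hg0 ⟨r, hr, hd, hn⟩
    by_cases hT : e p ≤ e (daggerRev σ p)
    · refine ⟨p * r, hr.mul hp hm h0 hT, by rw [hm.natDegree_mul hr.1, hm.natDegree_mul hg, hd],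
        ?_⟩
      rw [daggerRev_mul, daggerRev_mul, mul_mul_mul_comm, hn, mul_mul_mul_comm]
    · have hpm := monic_daggerRev (σ := σ) h0
      refine ⟨daggerRev σ p * r, hr.mul (irreducible_daggerRev hσ hp hm h0) hpm
        (coeff_zero_daggerRev_ne_zero hm h0) ?_, ?_, ?_⟩
      · rw [daggerRev_daggerRev hσ hm h0]; omega
      · rw [hpm.natDegree_mul hr.1, hm.natDegree_mul hg, hd, natDegree_daggerRev h0]
      · rw [daggerRev_mul, daggerRev_mul, mul_mul_mul_comm, hn, mul_mul_mul_comm p,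
          daggerRev_daggerRev hσ hm h0, mul_comm p]

lemma FactorsIn.exists_eq_mul_symm {e : F[X] → ℕ} (he : Function.Injective e) (r : F[X])
    (hr : FactorsIn (fun p => e p ≤ e (daggerRev σ p)) r) :
    ∃ s y, FactorsIn (fun p => e p < e (daggerRev σ p)) s ∧ y.Monic ∧ y.coeff 0 ≠ 0 ∧
      daggerRev σ y = y ∧ r = s * y := by
  suffices h : ∀ r : F[X], r.Monic → r.coeff 0 ≠ 0 →
      FactorsIn (fun p => e p ≤ e (daggerRev σ p)) r →
      ∃ s y, FactorsIn (fun p => e p < e (daggerRev σ p)) s ∧ y.Monic ∧ y.coeff 0 ≠ 0 ∧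
        daggerRev σ y = y ∧ r = s * y from h r hr.1 hr.2.1 hr
  refine monic_coeff_zero_induction ?_ ?_
  · exact fun _ => ⟨1, 1, FactorsIn.one _, monic_one, by simp, daggerRev_one, by simp⟩
  · intro p g hp hm h0 hg hg0 ih hr
    obtain ⟨s, y, hs, hy, hy0, hyd, rfl⟩ := ih (hr.of_mul_left hm)
    rcases (hr.2.2 p hp hm (dvd_mul_right _ _)).lt_or_eq with hlt | heq
    · exact ⟨p * s, y, hs.mul hp hm h0 hlt, hy, hy0, hyd, by ring⟩
    · exact ⟨s, p * y, hs, hm.mul hy, by rw [mul_coeff_zero]; exact mul_ne_zero h0 hy0,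
        by rw [daggerRev_mul, hyd, ← he heq], by ring⟩

lemma FactorsIn.isCoprime_daggerRev (hσ : ∀ x, σ (σ x) = x) {e : F[X] → ℕ} {r s : F[X]}
    (hr : FactorsIn (fun p => e p < e (daggerRev σ p)) r)
    (hs : FactorsIn (fun p => e p < e (daggerRev σ p)) s) :
    IsCoprime r (daggerRev σ s) := by
  refine isCoprime_of_irreducible_dvd (fun h => hr.1.ne_zero h.1) fun p' hp' hd hd' => ?_
  obtain ⟨p, hm, hp, hpp⟩ := exists_monic_irreducible_factor p' hp'.not_isUnit
  replace hd := hpp.trans hd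
  replace hd' := hpp.trans hd'
  have h0 : p.coeff 0 ≠ 0 := by
    obtain ⟨c, hc⟩ := hd
    have := hr.2.1
    rw [hc, mul_coeff_zero] at this
    exact left_ne_zero_of_mul this
  have h1 := hr.2.2 p hp hm hd
  have h2 := hs.2.2 _ (irreducible_daggerRev hσ hp hm h0) (monic_daggerRev h0) (by
    obtain ⟨c, hc⟩ := hd'
    rw [← daggerRev_daggerRev hσ hs.1 hs.2.1, hc, daggerRev_mul]
    exact dvd_mul_right _ _)
  simp only [daggerRev_daggerRev hσ hm h0] at h1 h2
  omega

lemma FactorsIn.mul_daggerRev_injective (hσ : ∀ x, σ (σ x) = x) {e : F[X] → ℕ}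
    {r s r' s' : F[X]}
    (hr : FactorsIn (fun p => e p < e (daggerRev σ p)) r)
    (hs : FactorsIn (fun p => e p < e (daggerRev σ p)) s)
    (hr' : FactorsIn (fun p => e p < e (daggerRev σ p)) r')
    (hs' : FactorsIn (fun p => e p < e (daggerRev σ p)) s')
    (h : r * daggerRev σ s = r' * daggerRev σ s') : r = r' ∧ s = s' := by
  have h1 : r = r' := by
    refine eq_of_monic_of_associated hr.1 hr'.1 (associated_of_dvd_dvd ?_ ?_)
    · exact (hr.isCoprime_daggerRev hσ hs').dvd_of_dvd_mul_right (h ▸ dvd_mul_right _ _)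
    · exact (hr'.isCoprime_daggerRev hσ hs).dvd_of_dvd_mul_right (h ▸ dvd_mul_right _ _)
  subst h1
  refine ⟨rfl, ?_⟩
  rw [← daggerRev_daggerRev hσ hs.1 hs.2.1, mul_left_cancel₀ hr.1.ne_zero h,
    daggerRev_daggerRev hσ hs'.1 hs'.2.1]

end Dagger

section NormOne

variable {F : Type} [Field F] {σ : F →+* F} {q : ℕ}

/-- The elements of norm one in `F`. -/
noncomputable def normOne (F : Type) [Field F] (q : ℕ) : Finset F := nthRootsFinset (q + 1) 1

lemma mem_normOne {a : F} : a ∈ normOne F q ↔ a ^ (q + 1) = 1 := by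
  rw [normOne, mem_nthRootsFinset (Nat.succ_pos q)]

lemma card_normOne_le : (normOne F q).card ≤ q + 1 := by
  classical
  rw [normOne, nthRootsFinset_def]
  exact (Multiset.toFinset_card_le _).trans (card_nthRoots _ _)

lemma coeff_zero_mem_normOne (hσ : ∀ x : F, σ x = x ^ q) {y : F[X]} (hy : y.Monic)
    (h0 : y.coeff 0 ≠ 0) (hs : daggerRev σ y = y) : y.coeff 0 ∈ normOne F q := by
  have h := coeff_zero_daggerRev (σ := σ) hy
  rw [hs, hσ] at h
  rw [mem_normOne, pow_succ']
  nth_rewrite 1 [h]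
  exact inv_mul_cancel₀ (pow_ne_zero q h0)

/-- The constant coefficient of `g·g†` for monic `g`. -/
noncomputable def normConst (σ : F →+* F) (g : F[X]) : F := g.coeff 0 * (σ (g.coeff 0))⁻¹

lemma normConst_mul (f g : F[X]) : normConst σ (f * g) = normConst σ f * normConst σ g := by
  simp only [normConst, mul_coeff_zero, map_mul, mul_inv]
  ring

lemma coeff_zero_mul_daggerRev {g : F[X]} (hg : g.Monic) :
    (g * daggerRev σ g).coeff 0 = normConst σ g := by
  rw [mul_coeff_zero, coeff_zero_daggerRev hg, normConst]

lemma normConst_pow (f : F[X]) (j : ℕ) : normConst σ (f ^ j) = normConst σ f ^ j := by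
  induction j with
  | zero => simp [normConst]
  | succ j ih => rw [pow_succ, normConst_mul, ih, pow_succ]

lemma card_toFinset_roots_le [DecidableEq F] (hq : 2 ≤ q) (c : F) :
    ((X ^ q - C c * X : F[X]).roots.toFinset).card ≤ q := by
  refine (Multiset.toFinset_card_le _).trans ((card_roots' _).trans ?_)
  refine (natDegree_sub_le _ _).trans (max_le (natDegree_X_pow_le q) ?_)
  exact (natDegree_C_mul_le _ _).trans (natDegree_X_le.trans (by omega))

end NormOne

section Counting

variable {F : Type} [Field F] [Fintype F]

/-- The monic polynomials of degree `d` over a finite field. -/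
noncomputable def monicOfDegree (F : Type) [Field F] [Fintype F] (d : ℕ) : Finset F[X] :=
  (Finset.univ : Finset (Fin d → F)).map
    (((degreeLTEquiv F d).symm.toEquiv.trans (monicEquivDegreeLT d).symm).toEmbedding.trans
      (Function.Embedding.subtype _))

lemma mem_monicOfDegree {d : ℕ} {f : F[X]} :
    f ∈ monicOfDegree F d ↔ f.Monic ∧ f.natDegree = d := by
  simp only [monicOfDegree, Finset.mem_map, Finset.mem_univ, true_and]
  constructor
  · rintro ⟨c, rfl⟩
    exact ((monicEquivDegreeLT d).symm ((degreeLTEquiv F d).symm c)).2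
  · intro h
    refine ⟨degreeLTEquiv F d (monicEquivDegreeLT d ⟨f, h⟩), ?_⟩
    simp

lemma card_monicOfDegree (d : ℕ) : (monicOfDegree F d).card = Fintype.card F ^ d := by
  simp [monicOfDegree]

variable {σ : F →+* F} {q : ℕ}

open scoped Classical in
/-- The monic polynomials `y` of degree `l` with `y(0) ≠ 0` and `y† = y`. -/
noncomputable def symmOfDegree (σ : F →+* F) (l : ℕ) : Finset F[X] :=
  (monicOfDegree F l).filter fun y => y.coeff 0 ≠ 0 ∧ daggerRev σ y = y

lemma mem_symmOfDegree {l : ℕ} {y : F[X]} : y ∈ symmOfDegree σ l ↔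
    (y.Monic ∧ y.natDegree = l) ∧ y.coeff 0 ≠ 0 ∧ daggerRev σ y = y := by
  simp only [symmOfDegree, Finset.mem_filter, mem_monicOfDegree]

open scoped Classical in
lemma card_symmOfDegree_filter_le (hq : 2 ≤ q) (hF : Fintype.card F = q ^ 2)
    (hσ : ∀ x : F, σ x = x ^ q) {l : ℕ} (hl : 1 ≤ l) (a : F) :
    ((symmOfDegree σ l).filter fun y => y.coeff 0 = a).card ≤ q ^ (l - 1) := by
  set M : Finset F := if Even l then (X ^ q - C (σ a) * X : F[X]).roots.toFinset else {0} with hM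
  set m := (l - 1) / 2
  have hcoeff : ∀ y ∈ (symmOfDegree σ l).filter (fun y => y.coeff 0 = a), ∀ i ≤ l,
      σ a ≠ 0 ∧ y.coeff i = (σ a)⁻¹ * σ (y.coeff (l - i)) := by
    intro y hy i hi
    rw [Finset.mem_filter, mem_symmOfDegree] at hy
    obtain ⟨⟨⟨-, hd⟩, h0, hs⟩, rfl⟩ := hy
    refine ⟨by simpa using h0, ?_⟩
    conv_lhs => rw [← hs, coeff_daggerRev y (hd ▸ hi), hd]
  have hcard : M.card ≤ if Even l then q else 1 := by
    rw [hM]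
    split_ifs
    · exact card_toFinset_roots_le hq _
    · simp
  calc _ ≤ ((Finset.univ : Finset (Fin m → F)) ×ˢ M).card := by
        refine Finset.card_le_card_of_injOn
          (fun y => (fun i => y.coeff (i + 1), if Even l then y.coeff (l / 2) else 0)) ?_ ?_
        · intro y hy
          simp only [Finset.coe_product, Set.mem_prod, Finset.coe_univ, Set.mem_univ, true_and,
            hM]
          split_ifs with he
          · obtain ⟨h0, h⟩ := hcoeff y hy (l / 2) (Nat.div_le_self _ _)
            have hl2 : l - l / 2 = l / 2 := by obtain ⟨c, rfl⟩ := he; omega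
            rw [hl2] at h
            have hne : (X ^ q - C (σ a) * X : F[X]) ≠ 0 := by
              intro h'
              have := congrArg (fun f => coeff f q) h'
              simp [coeff_X, show 1 ≠ q by omega] at this
            simp only [Finset.mem_coe, Multiset.mem_toFinset, mem_roots hne, IsRoot.def,
              eval_sub, eval_pow, eval_X, eval_mul, eval_C]
            rw [← hσ, sub_eq_zero]
            conv_rhs => rw [h, mul_inv_cancel_left₀ h0]
          · simp
        · intro y hy z hz hyz
          simp only [Prod.mk.injEq] at hyz
          obtain ⟨h1, h2⟩ := hyz
          have hlow : ∀ i, 2 * i ≤ l → y.coeff i = z.coeff i := by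
            intro i hi
            rcases Nat.eq_zero_or_pos i with rfl | hi0
            · rw [(Finset.mem_filter.1 hy).2, (Finset.mem_filter.1 hz).2]
            · by_cases he : 2 * i = l
              · have hev : Even l := ⟨i, by omega⟩
                rw [if_pos hev, if_pos hev, show l / 2 = i by omega] at h2
                exact h2
              · have := congrFun h1 ⟨i - 1, by omega⟩
                simpa [Nat.sub_add_cancel hi0] using this
          ext i
          rcases Nat.le_total (2 * i) l with hi | hi
          · exact hlow i hi
          · by_cases hil : i ≤ l
            · rw [(hcoeff y hy i hil).2, (hcoeff z hz i hil).2, hlow (l - i) (by omega)]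
            · have hy' := (mem_symmOfDegree.1 (Finset.mem_filter.1 hy).1).1.2
              have hz' := (mem_symmOfDegree.1 (Finset.mem_filter.1 hz).1).1.2
              rw [coeff_eq_zero_of_natDegree_lt (by omega),
                coeff_eq_zero_of_natDegree_lt (by omega)]
    _ = q ^ (2 * m) * M.card := by
        rw [Finset.card_product, Finset.card_univ, Fintype.card_fun, hF, Fintype.card_fin, pow_mul]
    _ ≤ q ^ (2 * m) * (if Even l then q else 1) := Nat.mul_le_mul_left _ hcard
    _ = q ^ (l - 1) := by
        split_ifs with he
        · rw [← pow_succ]; congr 1; obtain ⟨c, rfl⟩ := he; omega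
        · rw [mul_one]; congr 1; obtain ⟨c, rfl⟩ := Nat.not_even_iff_odd.1 he; omega

lemma card_symmOfDegree_le (hq : 2 ≤ q) (hF : Fintype.card F = q ^ 2)
    (hσ : ∀ x : F, σ x = x ^ q) (l : ℕ) : (symmOfDegree σ l).card ≤ 2 * q ^ l := by
  classical
  rcases Nat.eq_zero_or_pos l with rfl | hl
  · refine (Finset.card_filter_le _ _).trans ?_
    rw [card_monicOfDegree]
    simp
  · calc _ = ∑ a ∈ normOne F q, ((symmOfDegree σ l).filter fun y => y.coeff 0 = a).card := by
          refine Finset.card_eq_sum_card_fiberwise fun y hy => ?_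
          obtain ⟨⟨h1, -⟩, h2, h3⟩ := mem_symmOfDegree.1 hy
          exact coeff_zero_mem_normOne hσ h1 h2 h3
      _ ≤ ∑ a ∈ normOne F q, q ^ (l - 1) :=
          Finset.sum_le_sum fun a _ => card_symmOfDegree_filter_le hq hF hσ hl a
      _ ≤ (q + 1) * q ^ (l - 1) := by
          rw [Finset.sum_const, smul_eq_mul]
          exact Nat.mul_le_mul_right _ card_normOne_le
      _ ≤ 2 * q * q ^ (l - 1) := Nat.mul_le_mul_right _ (by omega)
      _ = 2 * q ^ l := by
          rw [mul_assoc, ← pow_succ', Nat.sub_add_cancel hl]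

/-- An irreducible polynomial of degree dividing `k` divides `X ^ M - c` with
`M = (q ^ (2k) - 1) / (q + 1)`. -/
lemma irreducible_dvd_X_pow_sub_C (hq : 2 ≤ q) (hF : Fintype.card F = q ^ 2)
    (hσ : ∀ x : F, σ x = x ^ q) {p : F[X]} (hp : Irreducible p) (hm : p.Monic)
    (h0 : p.coeff 0 ≠ 0) (j : ℕ) :
    p ∣ X ^ ((q - 1) * ∑ i ∈ Finset.range (j * p.natDegree), (q ^ 2) ^ i) -
      C (normConst σ p ^ j)⁻¹ := by
  have : Fact (Irreducible p) := ⟨hp⟩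
  set r := p.natDegree with hr
  let pb := AdjoinRoot.powerBasis hm.ne_zero
  have : Module.Finite F (AdjoinRoot p) := pb.finite
  have : Finite (AdjoinRoot p) := Module.finite_of_finite F
  have hdim : Module.finrank F (AdjoinRoot p) = r := by
    rw [pb.finrank, AdjoinRoot.powerBasis_dim]
  have hcard : Nat.card (AdjoinRoot p) = (q ^ 2) ^ r := by
    rw [Module.natCard_eq_pow_finrank (K := F), hdim, Nat.card_eq_fintype_card, hF]
  have hq2 : 2 ≤ q ^ 2 := by nlinarith
  have hnorm : algebraMap F (AdjoinRoot p) ((-1) ^ r * p.coeff 0) =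
      AdjoinRoot.root p ^ (∑ i ∈ Finset.range r, (q ^ 2) ^ i) := by
    have h1 := Algebra.PowerBasis.norm_gen_eq_coeff_zero_minpoly pb
    rw [AdjoinRoot.powerBasis_dim, AdjoinRoot.powerBasis_gen,
      AdjoinRoot.minpoly_root hm.ne_zero, hm.leadingCoeff, inv_one, C_1, mul_one] at h1
    rw [← h1, FiniteField.algebraMap_norm_eq_pow, hcard, Nat.card_eq_fintype_card, hF,
      Nat.geomSum_eq hq2]
  have hfix : ∀ x : F, x ^ (q ^ 2) = x := fun x => by rw [← hF, FiniteField.pow_card]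
  have hfixp : ∀ (x : F) (i : ℕ), x ^ ((q ^ 2) ^ i) = x := fun x i => by
    induction i with
    | zero => simp
    | succ i ih => rw [pow_succ, pow_mul, ih, hfix]
  have hsum : ∀ j : ℕ, algebraMap F (AdjoinRoot p) (((-1) ^ r * p.coeff 0) ^ j) =
      AdjoinRoot.root p ^ (∑ i ∈ Finset.range (j * r), (q ^ 2) ^ i) := by
    intro j
    induction j with
    | zero => simp
    | succ j ih =>
      rw [Nat.succ_mul, Finset.sum_range_add, pow_succ _ j, pow_add, ← ih, map_mul]
      congr 1
      simp_rw [pow_add, ← Finset.mul_sum]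
      rw [pow_mul', ← hnorm, ← map_pow, hfixp]
  have hneg : ((-1 : F)) ^ (q - 1) = 1 := by
    have h := hσ (-1)
    rw [map_neg, map_one] at h
    have h2 : (-1 : F) * (-1) ^ (q - 1) = -1 := by
      rw [← pow_succ', Nat.sub_add_cancel (by omega), ← h]
    simpa using h2
  have hc : (p.coeff 0) ^ (q - 1) = (normConst σ p)⁻¹ := by
    rw [normConst, hσ, mul_inv, inv_inv, eq_inv_mul_iff_mul_eq₀ h0, ← pow_succ',
      Nat.sub_add_cancel (by omega)]
  rw [← AdjoinRoot.mk_eq_zero, map_sub, map_pow, AdjoinRoot.mk_X, AdjoinRoot.mk_C, sub_eq_zero,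
    mul_comm, pow_mul, ← hsum, ← map_pow, ← AdjoinRoot.algebraMap_eq]
  congr 1
  calc (((-1) ^ r * p.coeff 0) ^ j) ^ (q - 1)
      = ((-1) ^ (q - 1)) ^ (r * j) * (p.coeff 0 ^ (q - 1)) ^ j := by ring
    _ = (normConst σ p ^ j)⁻¹ := by rw [hneg, hc, one_pow, one_mul, inv_pow]

lemma sum_natDegree_irreducible_le (hq : 2 ≤ q) (hF : Fintype.card F = q ^ 2)
    (hσ : ∀ x : F, σ x = x ^ q) {k : ℕ} (hk : 1 ≤ k) (b : F) (S : Finset F[X])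
    (hS : ∀ p ∈ S, Irreducible p ∧ p.Monic ∧ p.coeff 0 ≠ 0 ∧
      ∃ j, j * p.natDegree = k ∧ normConst σ p ^ j = b) :
    ∑ p ∈ S, p.natDegree ≤ q ^ (2 * k - 1) := by
  set M := (q - 1) * ∑ i ∈ Finset.range k, (q ^ 2) ^ i with hM
  have hM' : M * (q + 1) + 1 = q ^ (2 * k) := by
    have h := Nat.geomSum_eq (m := q ^ 2) (by nlinarith) k
    have hg := geom_sum_mul_add (q ^ 2 - 1) k
    obtain ⟨t, rfl⟩ : ∃ t, q = t + 1 := ⟨q - 1, by omega⟩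
    have e : (t + 1) ^ 2 - 1 + 1 = (t + 1) ^ 2 := Nat.sub_add_cancel (Nat.one_le_two_pow.trans
      (Nat.pow_le_pow_left hq 2))
    rw [e, ← pow_mul] at hg
    rw [hM, ← hg, show (t + 1) ^ 2 - 1 = t * (t + 1 + 1) by rw [Nat.sub_eq_iff_eq_add]; ring; nlinarith,
      Nat.add_sub_cancel]
    ring
  have hMpos : 0 < M := by
    have : 1 < q ^ (2 * k) := Nat.one_lt_pow (by omega) (by omega)
    by_contra h
    simp only [not_lt, Nat.le_zero] at h
    rw [h] at hM'
    omega
  have hle : M ≤ q ^ (2 * k - 1) := by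
    have : q ^ (2 * k) = q ^ (2 * k - 1) * q := by rw [← pow_succ, Nat.sub_add_cancel (by omega)]
    rw [this] at hM'
    nlinarith
  have hdvd : ∏ p ∈ S, p ∣ (X ^ M - C b⁻¹ : F[X]) := by
    refine Finset.prod_dvd_of_coprime ?_ ?_
    · intro p hp p' hp' hne
      refine (hS p hp).1.coprime_iff_not_dvd.2 fun h => hne ?_
      exact eq_of_monic_of_associated (hS p hp).2.1 (hS p' hp').2.1
        ((hS p hp).1.associated_of_dvd (hS p' hp').1 h)
    · intro p hp
      obtain ⟨hi, hm, h0, j, hj, rfl⟩ := hS p hp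
      have := irreducible_dvd_X_pow_sub_C hq hF hσ hi hm h0 j
      rwa [hj] at this
  have := natDegree_le_of_dvd hdvd (X_pow_sub_C_ne_zero hMpos _)
  rw [natDegree_X_pow_sub_C, natDegree_prod _ _ fun p hp => (hS p hp).2.1.ne_zero] at this
  exact this.trans hle

end Counting

section LogDerivative

variable {F : Type} [Field F] [Fintype F] {σ : F →+* F} {q : ℕ}

open scoped Classical in
/-- The polynomials of degree `d` satisfying `FactorsIn T`. -/
noncomputable def factorsInOfDegree (T : F[X] → Prop) (d : ℕ) : Finset F[X] :=
  (monicOfDegree F d).filter (FactorsIn T)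

lemma mem_factorsInOfDegree {T : F[X] → Prop} {d : ℕ} {r : F[X]} :
    r ∈ factorsInOfDegree T d ↔ FactorsIn T r ∧ r.natDegree = d := by
  simp only [factorsInOfDegree, Finset.mem_filter, mem_monicOfDegree]
  exact ⟨fun h => ⟨h.2, h.1.2⟩, fun h => ⟨⟨h.1.1, h.2⟩, h.1⟩⟩

open scoped Classical in
/-- The monic irreducible polynomials of degree at most `d`. -/
noncomputable def irreducibleOfDegreeLE (F : Type) [Field F] [Fintype F] (d : ℕ) : Finset F[X] :=
  ((Finset.range (d + 1)).biUnion (monicOfDegree F)).filter Irreducible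

lemma mem_irreducibleOfDegreeLE {d : ℕ} {p : F[X]} :
    p ∈ irreducibleOfDegreeLE F d ↔ Irreducible p ∧ p.Monic ∧ p.natDegree ≤ d := by
  simp only [irreducibleOfDegreeLE, Finset.mem_filter, Finset.mem_biUnion, Finset.mem_range,
    mem_monicOfDegree, Nat.lt_succ_iff]
  exact ⟨fun ⟨⟨i, hi, hm, hd⟩, hp⟩ => ⟨hp, hm, hd ▸ hi⟩,
    fun ⟨hp, hm, hd⟩ => ⟨⟨_, hd, hm, rfl⟩, hp⟩⟩

open scoped Classical in
lemma le_sum_natDegree_of_pow_dvd {r : F[X]} (hr : r.Monic) :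
    r.natDegree ≤ ∑ x ∈ irreducibleOfDegreeLE F r.natDegree ×ˢ Finset.Icc 1 r.natDegree,
      if x.1 ^ x.2 ∣ r then x.1.natDegree else 0 := by
  set s := UniqueFactorizationMonoid.normalizedFactors r with hs
  have hmem : ∀ p ∈ s, Irreducible p ∧ p.Monic ∧ p ∣ r := fun p hp =>
    (Polynomial.mem_normalizedFactors_iff hr.ne_zero).1 hp
  have hprod : s.prod = r := by
    rw [hs, UniqueFactorizationMonoid.prod_normalizedFactors_eq hr.ne_zero, hr.normalize_eq_self]
  have hdeg : r.natDegree = ∑ p ∈ s.toFinset, s.count p * p.natDegree := by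
    conv_lhs => rw [← hprod]
    rw [natDegree_multiset_prod_of_monic s fun p hp => (hmem p hp).2.1,
      Finset.sum_multiset_map_count]
    simp
  have hpow : ∀ p j, j ≤ s.count p → p ^ j ∣ r := fun p j hj => by
    have := Multiset.prod_dvd_prod_of_le (Multiset.le_count_iff_replicate_le.1 hj)
    rwa [Multiset.prod_replicate, hprod] at this
  rw [Finset.sum_product]
  have hsub : s.toFinset ⊆ irreducibleOfDegreeLE F r.natDegree := fun p hp => by
    obtain ⟨h1, h2, h3⟩ := hmem p (Multiset.mem_toFinset.1 hp)
    exact mem_irreducibleOfDegreeLE.2 ⟨h1, h2, natDegree_le_of_dvd h3 hr.ne_zero⟩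
  refine le_trans ?_ (Finset.sum_le_sum_of_subset hsub)
  conv_lhs => rw [hdeg]
  refine Finset.sum_le_sum fun p hp => ?_
  obtain ⟨h1, h2, -⟩ := hmem p (Multiset.mem_toFinset.1 hp)
  have hle : s.count p ≤ r.natDegree := by
    have := natDegree_le_of_dvd (hpow p _ le_rfl) hr.ne_zero
    rw [natDegree_pow] at this
    exact (Nat.le_mul_of_pos_right _ h1.natDegree_pos).trans this
  calc s.count p * p.natDegree = ∑ j ∈ Finset.Icc 1 (s.count p), p.natDegree := by simp
    _ = ∑ j ∈ Finset.Icc 1 (s.count p), if p ^ j ∣ r then p.natDegree else 0 :=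
        Finset.sum_congr rfl fun j hj => by rw [if_pos (hpow p j (Finset.mem_Icc.1 hj).2)]
    _ ≤ _ := Finset.sum_le_sum_of_subset (Finset.Icc_subset_Icc_right hle)

open scoped Classical in
lemma mul_card_factorsInOfDegree_filter_le (hq : 2 ≤ q) (hF : Fintype.card F = q ^ 2)
    (hσ : ∀ x : F, σ x = x ^ q) (T : F[X] → Prop) (d : ℕ) (a : F) :
    d * ((factorsInOfDegree T d).filter fun r => normConst σ r = a).card ≤
      ∑ k ∈ Finset.Icc 1 d, (factorsInOfDegree T (d - k)).card * q ^ (2 * k - 1) := by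
  set A := (factorsInOfDegree T d).filter fun r => normConst σ r = a with hA
  set I := irreducibleOfDegreeLE F d ×ˢ Finset.Icc 1 d with hI
  have hdA : ∀ r ∈ A, FactorsIn T r ∧ r.natDegree = d ∧ normConst σ r = a := fun r hr => by
    rw [hA, Finset.mem_filter, mem_factorsInOfDegree] at hr
    exact ⟨hr.1.1, hr.1.2, hr.2⟩
  let good : ℕ → F[X] → F[X] × ℕ → Prop := fun k r x =>
    x.2 * x.1.natDegree = k ∧ x.1.coeff 0 ≠ 0 ∧ normConst σ x.1 ^ x.2 * normConst σ r = a
  have hterm : ∀ x ∈ I, ∑ r ∈ A, (if x.1 ^ x.2 ∣ r then x.1.natDegree else 0) ≤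
      ∑ k ∈ Finset.Icc 1 d, ∑ r ∈ factorsInOfDegree T (d - k),
        if good k r x then x.1.natDegree else 0 := by
    rintro ⟨p, j⟩ hx
    rw [hI, Finset.mem_product, mem_irreducibleOfDegreeLE, Finset.mem_Icc] at hx
    obtain ⟨⟨hp, hm, -⟩, hj1, -⟩ := hx
    simp only at hp hm hj1 ⊢
    rw [← Finset.sum_filter]
    rcases (A.filter fun r => p ^ j ∣ r).eq_empty_or_nonempty with he | ⟨r₀, hr₀⟩
    · rw [he]; simp
    rw [Finset.mem_filter] at hr₀
    obtain ⟨hr₀A, t, rfl⟩ := hr₀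
    obtain ⟨hr, hrd, -⟩ := hdA _ hr₀A
    have h0 : p.coeff 0 ≠ 0 := by
      have := hr.2.1
      rw [mul_coeff_zero] at this
      intro h
      have h' : (p ^ j).coeff 0 = 0 := by
        rw [coeff_zero_eq_eval_zero, eval_pow, ← coeff_zero_eq_eval_zero, h,
          zero_pow (by omega)]
      exact this (by rw [h', zero_mul])
    rw [(hm.pow j).natDegree_mul ((hm.pow j).of_mul_monic_left hr.1), natDegree_pow] at hrd
    have hpos := hp.natDegree_pos
    have hk : j * p.natDegree ∈ Finset.Icc 1 d :=
      Finset.mem_Icc.2 ⟨Nat.mul_pos hj1 hpos, by omega⟩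
    refine le_trans ?_ (Finset.single_le_sum (f := fun k => ∑ r ∈ factorsInOfDegree T (d - k),
        if good k r (p, j) then p.natDegree else 0) (fun _ _ => Nat.zero_le _) hk)
    rw [← Finset.sum_filter, Finset.sum_const, Finset.sum_const]
    refine Nat.mul_le_mul_right _ ?_
    refine (Finset.card_le_card ?_).trans (Finset.card_image_le (f := fun r => p ^ j * r))
    intro r hr
    rw [Finset.mem_filter] at hr
    obtain ⟨hrA, u, rfl⟩ := hr
    obtain ⟨hr1, hr2, hr3⟩ := hdA _ hrA
    have hu := hr1.of_mul_left (hm.pow j)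
    refine Finset.mem_image.2 ⟨u, Finset.mem_filter.2 ⟨mem_factorsInOfDegree.2 ⟨hu, ?_⟩,
      rfl, h0, ?_⟩, rfl⟩
    · rw [(hm.pow j).natDegree_mul hu.1, natDegree_pow] at hr2
      omega
    · rw [← normConst_pow, ← normConst_mul, hr3]
  have hgood : ∀ k ∈ Finset.Icc 1 d, ∀ r ∈ factorsInOfDegree T (d - k),
      ∑ x ∈ I, (if good k r x then x.1.natDegree else 0) ≤ q ^ (2 * k - 1) := by
    intro k hk r hr
    have hr0 : normConst σ r ≠ 0 := by
      have := (mem_factorsInOfDegree.1 hr).1.2.1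
      exact mul_ne_zero this (inv_ne_zero (by simpa using this))
    have hIg : ∀ x ∈ I.filter (good k r), Irreducible x.1 ∧ x.1.Monic ∧ good k r x := by
      intro x hx
      rw [Finset.mem_filter, hI, Finset.mem_product, mem_irreducibleOfDegreeLE] at hx
      exact ⟨hx.1.1.1, hx.1.1.2.1, hx.2⟩
    rw [← Finset.sum_filter, ← Finset.sum_image (s := I.filter (good k r)) (g := Prod.fst)
      (f := natDegree)]
    · refine sum_natDegree_irreducible_le hq hF hσ (Finset.mem_Icc.1 hk).1
        (a * (normConst σ r)⁻¹) _ fun p hp => ?_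
      obtain ⟨x, hx, rfl⟩ := Finset.mem_image.1 hp
      obtain ⟨h1, h2, h3, h4, h5⟩ := hIg x hx
      exact ⟨h1, h2, h4, x.2, h3, by rw [← h5, mul_inv_cancel_right₀ hr0]⟩
    · intro x hx y hy hxy
      obtain ⟨h1, -, h3, -⟩ := hIg x hx
      obtain ⟨-, -, h3', -⟩ := hIg y hy
      rw [← hxy, ← h3] at h3'
      exact Prod.ext hxy (Nat.eq_of_mul_eq_mul_right h1.natDegree_pos h3').symm
  calc d * A.card = ∑ r ∈ A, d := by rw [Finset.sum_const, smul_eq_mul, mul_comm]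
    _ ≤ ∑ r ∈ A, ∑ x ∈ I, (if x.1 ^ x.2 ∣ r then x.1.natDegree else 0) :=
        Finset.sum_le_sum fun r hr => by
          obtain ⟨h1, h2, -⟩ := hdA r hr
          have := le_sum_natDegree_of_pow_dvd h1.1
          rwa [h2] at this
    _ = ∑ x ∈ I, ∑ r ∈ A, (if x.1 ^ x.2 ∣ r then x.1.natDegree else 0) := Finset.sum_comm
    _ ≤ ∑ x ∈ I, ∑ k ∈ Finset.Icc 1 d, ∑ r ∈ factorsInOfDegree T (d - k),
        (if good k r x then x.1.natDegree else 0) := Finset.sum_le_sum hterm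
    _ = ∑ k ∈ Finset.Icc 1 d, ∑ r ∈ factorsInOfDegree T (d - k), ∑ x ∈ I,
        (if good k r x then x.1.natDegree else 0) := by
        rw [Finset.sum_comm]
        exact Finset.sum_congr rfl fun k _ => Finset.sum_comm
    _ ≤ ∑ k ∈ Finset.Icc 1 d, ∑ r ∈ factorsInOfDegree T (d - k), q ^ (2 * k - 1) :=
        Finset.sum_le_sum fun k hk => Finset.sum_le_sum fun r hr => hgood k hk r hr
    _ = _ := by simp only [Finset.sum_const, smul_eq_mul]

end LogDerivative

section CauchyProducts

open Finset.HasAntidiagonal (antidiagonal mem_antidiagonal)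

lemma sum_range_antidiagonal_le {f g : ℕ → ℝ} (hf : ∀ i, 0 ≤ f i) (hg : ∀ i, 0 ≤ g i) (d : ℕ) :
    ∑ k ∈ Finset.range (d + 1), ∑ x ∈ antidiagonal k, f x.1 * g x.2 ≤
      (∑ i ∈ Finset.range (d + 1), f i) * ∑ j ∈ Finset.range (d + 1), g j := by
  rw [Finset.sum_mul_sum, ← Finset.sum_product', Finset.sum_sigma',
    ← Finset.sum_image (s := (Finset.range (d + 1)).sigma fun k => antidiagonal k)
    (g := fun x => x.2) (f := fun x : ℕ × ℕ => f x.1 * g x.2)]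
  · refine Finset.sum_le_sum_of_subset_of_nonneg ?_ fun x _ _ => mul_nonneg (hf _) (hg _)
    intro x hx
    simp only [Finset.mem_image, Finset.mem_sigma, Finset.mem_range, mem_antidiagonal] at hx
    obtain ⟨⟨k, y⟩, ⟨h1, h2⟩, rfl⟩ := hx
    simp only [Finset.mem_product, Finset.mem_range] at *
    omega
  · rintro ⟨k, y⟩ hx ⟨k', y'⟩ hx' h
    simp only [Finset.coe_sigma, Set.mem_sigma_iff, Finset.mem_coe,
      mem_antidiagonal] at hx hx' h
    subst h
    obtain rfl : k = k' := hx.2.symm.trans hx'.2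
    rfl

lemma sq_sum_range_le {f : ℕ → ℝ} (hf : ∀ i, 0 ≤ f i) (d : ℕ) :
    (∑ i ∈ Finset.range (d + 1), f i) ^ 2 ≤
      ∑ k ∈ Finset.range (2 * d + 1), ∑ x ∈ antidiagonal k, f x.1 * f x.2 := by
  rw [sq, Finset.sum_mul_sum, ← Finset.sum_product',
    ← Finset.sum_fiberwise_of_maps_to (t := Finset.range (2 * d + 1)) (g := fun x => x.1 + x.2)]
  · refine Finset.sum_le_sum fun k _ => ?_
    refine Finset.sum_le_sum_of_subset_of_nonneg (fun x hx => ?_)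
      fun x _ _ => mul_nonneg (hf _) (hf _)
    exact mem_antidiagonal.2 (Finset.mem_filter.1 hx).2
  · intro x hx
    simp only [Finset.mem_product, Finset.mem_range] at *
    omega

end CauchyProducts

section Bounds

open Finset.HasAntidiagonal (antidiagonal mem_antidiagonal)

variable {F : Type} [Field F] [Fintype F] {σ : F →+* F} {q : ℕ}

lemma sum_antidiagonal_card_mul_card_le (hσ : ∀ x, σ (σ x) = x) (e : F[X] → ℕ) (k : ℕ) :
    ∑ x ∈ antidiagonal k,
      (factorsInOfDegree (fun p => e p < e (daggerRev σ p)) x.1).card *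
        (factorsInOfDegree (fun p => e p < e (daggerRev σ p)) x.2).card ≤
      Fintype.card F ^ k := by
  simp_rw [← Finset.card_product]
  rw [← Finset.card_sigma, ← card_monicOfDegree]
  refine Finset.card_le_card_of_injOn (fun z => z.2.1 * daggerRev σ z.2.2) ?_ ?_
  · rintro ⟨x, r, s⟩ hz
    simp only [Finset.coe_sigma, Set.mem_sigma_iff, Finset.mem_coe, mem_antidiagonal,
      Finset.mem_product, mem_factorsInOfDegree] at hz
    obtain ⟨hx, ⟨hr, hrd⟩, hs, hsd⟩ := hz
    have hm := monic_daggerRev (σ := σ) hs.2.1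
    refine mem_monicOfDegree.2 ⟨hr.1.mul hm, ?_⟩
    rw [hr.1.natDegree_mul hm, natDegree_daggerRev hs.2.1, hrd, hsd, hx]
  · rintro ⟨⟨i, j⟩, r, s⟩ hz ⟨⟨i', j'⟩, r', s'⟩ hz' h
    simp only [Finset.coe_sigma, Set.mem_sigma_iff, Finset.mem_coe, mem_antidiagonal,
      Finset.mem_product, mem_factorsInOfDegree] at hz hz' h
    obtain ⟨-, ⟨hr, rfl⟩, hs, rfl⟩ := hz
    obtain ⟨-, ⟨hr', rfl⟩, hs', rfl⟩ := hz'
    obtain ⟨rfl, rfl⟩ := hr.mul_daggerRev_injective hσ hs hr' hs' h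
    rfl

lemma card_factorsInOfDegree_le_sum {e : F[X] → ℕ} (he : Function.Injective e) (k : ℕ) :
    (factorsInOfDegree (fun p => e p ≤ e (daggerRev σ p)) k).card ≤
      ∑ x ∈ antidiagonal k,
        (factorsInOfDegree (fun p => e p < e (daggerRev σ p)) x.1).card *
          (symmOfDegree σ x.2).card := by
  classical
  simp_rw [← Finset.card_product]
  rw [← Finset.card_sigma]
  refine (Finset.card_le_card fun r hr => ?_).trans
    (Finset.card_image_le (f := fun z => z.2.1 * z.2.2))
  obtain ⟨hr, hd⟩ := mem_factorsInOfDegree.1 hr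
  obtain ⟨s, y, hs, hy, hy0, hys, rfl⟩ := hr.exists_eq_mul_symm he
  rw [hs.1.natDegree_mul hy] at hd
  refine Finset.mem_image.2 ⟨⟨(s.natDegree, y.natDegree), (s, y)⟩, ?_, rfl⟩
  simp only [Finset.mem_sigma, mem_antidiagonal, Finset.mem_product,
    mem_factorsInOfDegree, mem_symmOfDegree]
  exact ⟨hd, ⟨hs, trivial⟩, ⟨hy, trivial⟩, hy0, hys⟩

lemma sum_card_factorsInOfDegree_lt_le (hq : 2 ≤ q) (hF : Fintype.card F = q ^ 2)
    (hσ : ∀ x, σ (σ x) = x) (e : F[X] → ℕ) (d : ℕ) :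
    ∑ i ∈ Finset.range (d + 1),
      ((factorsInOfDegree (fun p => e p < e (daggerRev σ p)) i).card : ℝ) / (q : ℝ) ^ (2 * i) ≤
      Real.sqrt (2 * d + 1) := by
  have hq0 : (0 : ℝ) < q := by positivity
  refine Real.le_sqrt_of_sq_le ((sq_sum_range_le (fun i => by positivity) d).trans ?_)
  calc _ ≤ ∑ k ∈ Finset.range (2 * d + 1), (1 : ℝ) := by
        refine Finset.sum_le_sum fun k _ => ?_
        have h := sum_antidiagonal_card_mul_card_le hσ e k
        rw [hF, ← pow_mul] at h
        have h' : ∀ x ∈ antidiagonal k,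
            ((factorsInOfDegree (fun p => e p < e (daggerRev σ p)) x.1).card : ℝ) /
              (q : ℝ) ^ (2 * x.1) *
            (((factorsInOfDegree (fun p => e p < e (daggerRev σ p)) x.2).card : ℝ) /
              (q : ℝ) ^ (2 * x.2)) =
            ((factorsInOfDegree (fun p => e p < e (daggerRev σ p)) x.1).card *
              (factorsInOfDegree (fun p => e p < e (daggerRev σ p)) x.2).card : ℕ) /
              (q : ℝ) ^ (2 * k) := by
          intro x hx
          rw [← mem_antidiagonal.1 hx, mul_add, pow_add, div_mul_div_comm, Nat.cast_mul]
        rw [Finset.sum_congr rfl h', ← Finset.sum_div, div_le_one (by positivity)]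
        exact_mod_cast h
    _ = _ := by simp

lemma sum_card_symmOfDegree_le (hq : 2 ≤ q) (hF : Fintype.card F = q ^ 2)
    (hσ : ∀ x : F, σ x = x ^ q) (d : ℕ) :
    ∑ l ∈ Finset.range d, ((symmOfDegree σ l).card : ℝ) / (q : ℝ) ^ (2 * l) ≤ 4 := by
  have hq2 : (2 : ℝ) ≤ q := by exact_mod_cast hq
  have hq0 : (0 : ℝ) < q := by positivity
  calc _ ≤ ∑ l ∈ Finset.range d, 2 * (1 / 2 : ℝ) ^ l := by
        refine Finset.sum_le_sum fun l _ => ?_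
        have h : ((symmOfDegree σ l).card : ℝ) ≤ 2 * (q : ℝ) ^ l := by
          exact_mod_cast card_symmOfDegree_le hq hF hσ l
        have h2 : (2 : ℝ) ^ l ≤ (q : ℝ) ^ l := pow_le_pow_left₀ (by norm_num) hq2 l
        rw [div_le_iff₀ (by positivity), two_mul l, pow_add, one_div, inv_pow]
        refine h.trans ?_
        have : (1 : ℝ) ≤ ((2 : ℝ) ^ l)⁻¹ * (q : ℝ) ^ l := by
          rw [inv_mul_eq_div, le_div_iff₀ (by positivity), one_mul]
          exact h2
        calc 2 * (q : ℝ) ^ l = 2 * 1 * (q : ℝ) ^ l := by ring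
          _ ≤ 2 * (((2 : ℝ) ^ l)⁻¹ * (q : ℝ) ^ l) * (q : ℝ) ^ l := by gcongr
          _ = _ := by ring
    _ = 2 * ∑ l ∈ Finset.range d, (1 / 2 : ℝ) ^ l := by rw [Finset.mul_sum]
    _ ≤ 4 := by linarith [sum_geometric_two_le d]

lemma apply_apply_eq_self (hF : Fintype.card F = q ^ 2) (hσ : ∀ x : F, σ x = x ^ q) (x : F) :
    σ (σ x) = x := by
  rw [hσ, hσ, ← pow_mul, ← sq, ← hF, FiniteField.pow_card]

lemma sum_card_factorsInOfDegree_le (hq : 2 ≤ q) (hF : Fintype.card F = q ^ 2)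
    (hσ : ∀ x : F, σ x = x ^ q) {e : F[X] → ℕ} (he : Function.Injective e) (d : ℕ) :
    ∑ k ∈ Finset.range (d + 1),
      ((factorsInOfDegree (fun p => e p ≤ e (daggerRev σ p)) k).card : ℝ) / (q : ℝ) ^ (2 * k) ≤
      4 * Real.sqrt (2 * d + 1) := by
  have hq0 : (0 : ℝ) < q := by positivity
  have hW := sum_card_factorsInOfDegree_lt_le hq hF (apply_apply_eq_self hF hσ) e d
  have hY := sum_card_symmOfDegree_le hq hF hσ (d + 1)
  refine le_trans ?_ ((sum_range_antidiagonal_le (fun i => by positivity)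
    (fun i => by positivity) d).trans ((mul_le_mul hW hY (Finset.sum_nonneg fun i _ => by
      positivity) (Real.sqrt_nonneg _)).trans_eq (mul_comm _ _)))
  refine Finset.sum_le_sum fun k _ => ?_
  have h := card_factorsInOfDegree_le_sum (σ := σ) he k
  rw [div_le_iff₀ (by positivity), Finset.sum_mul]
  calc _ ≤ ((∑ x ∈ antidiagonal k,
        (factorsInOfDegree (fun p => e p < e (daggerRev σ p)) x.1).card *
          (symmOfDegree σ x.2).card : ℕ) : ℝ) := by exact_mod_cast h
    _ = _ := by
        push_cast
        refine Finset.sum_congr rfl fun x hx => ?_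
        rw [← mem_antidiagonal.1 hx, mul_add, pow_add]
        field_simp

open scoped Classical in
lemma card_factorsInOfDegree_filter_mul_sqrt_le (hq : 2 ≤ q) (hF : Fintype.card F = q ^ 2)
    (hσ : ∀ x : F, σ x = x ^ q) {e : F[X] → ℕ} (he : Function.Injective e) {d : ℕ} (hd : 1 ≤ d)
    (a : F) :
    (((factorsInOfDegree (fun p => e p ≤ e (daggerRev σ p)) d).filter
      fun r => normConst σ r = a).card : ℝ) * Real.sqrt d ≤ 8 * (q : ℝ) ^ (2 * d - 1) := by
  set T : F[X] → Prop := fun p => e p ≤ e (daggerRev σ p)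
  have hq0 : (0 : ℝ) < q := by positivity
  have hd1 : (1 : ℝ) ≤ d := by exact_mod_cast hd
  have hlog : (d : ℝ) * ((factorsInOfDegree T d).filter fun r => normConst σ r = a).card ≤
      ∑ k ∈ Finset.Icc 1 d, ((factorsInOfDegree T (d - k)).card : ℝ) * (q : ℝ) ^ (2 * k - 1) := by
    exact_mod_cast mul_card_factorsInOfDegree_filter_le hq hF hσ T d a
  have hre : ∑ k ∈ Finset.Icc 1 d, ((factorsInOfDegree T (d - k)).card : ℝ) *
      (q : ℝ) ^ (2 * k - 1) ≤ (q : ℝ) ^ (2 * d - 1) * ∑ k ∈ Finset.range (d + 1),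
        ((factorsInOfDegree T k).card : ℝ) / (q : ℝ) ^ (2 * k) := by
    rw [Finset.mul_sum]
    calc _ = ∑ k ∈ Finset.Icc 1 d, (q : ℝ) ^ (2 * d - 1) *
          (((factorsInOfDegree T (d - k)).card : ℝ) / (q : ℝ) ^ (2 * (d - k))) := by
          refine Finset.sum_congr rfl fun k hk => ?_
          have hk := Finset.mem_Icc.1 hk
          rw [show 2 * d - 1 = 2 * k - 1 + 2 * (d - k) by omega, pow_add]
          field_simp
      _ = ∑ j ∈ (Finset.Icc 1 d).image (d - ·), (q : ℝ) ^ (2 * d - 1) *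
          (((factorsInOfDegree T j).card : ℝ) / (q : ℝ) ^ (2 * j)) := by
          rw [Finset.sum_image]
          intro x hx y hy h
          have hx := Finset.mem_Icc.1 hx
          have hy := Finset.mem_Icc.1 hy
          simp only at h
          omega
      _ ≤ _ := by
          refine Finset.sum_le_sum_of_subset_of_nonneg (fun j hj => ?_)
            fun _ _ _ => by positivity
          obtain ⟨k, -, rfl⟩ := Finset.mem_image.1 hj
          exact Finset.mem_range.2 (by omega)
  have hV := sum_card_factorsInOfDegree_le hq hF hσ he d
  have hs : Real.sqrt (2 * d + 1) ≤ 2 * Real.sqrt d := by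
    rw [Real.sqrt_le_left (by positivity), mul_pow, Real.sq_sqrt (by positivity)]
    linarith
  have hsd : 0 < Real.sqrt d := Real.sqrt_pos.2 (by linarith)
  have hmul : Real.sqrt d * Real.sqrt d = d := Real.mul_self_sqrt (by linarith)
  have hfin : (d : ℝ) * ((factorsInOfDegree T d).filter fun r => normConst σ r = a).card ≤
      (q : ℝ) ^ (2 * d - 1) * (4 * (2 * Real.sqrt d)) :=
    hlog.trans (hre.trans (by gcongr; exact hV.trans (by gcongr)))
  refine le_of_mul_le_mul_right ?_ hsd
  rw [mul_assoc, hmul]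
  linarith

end Bounds

section NearNorms

variable {F : Type} [Field F] [Fintype F] {σ : F →+* F} {q : ℕ}

lemma normConst_mem_normOne (hF : Fintype.card F = q ^ 2) (hσ : ∀ x : F, σ x = x ^ q)
    {g : F[X]} (h : g.coeff 0 ≠ 0) : normConst σ g ∈ normOne F q := by
  have h2 := apply_apply_eq_self hF hσ (g.coeff 0)
  have h0 : σ (g.coeff 0) ≠ 0 := by simpa using h
  rw [mem_normOne, pow_succ, ← hσ, normConst, map_mul, map_inv₀, h2]
  field_simp

open scoped Classical in
lemma card_factorsInOfDegree_mul_sqrt_le (hq : 2 ≤ q) (hF : Fintype.card F = q ^ 2)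
    (hσ : ∀ x : F, σ x = x ^ q) {e : F[X] → ℕ} (he : Function.Injective e) {d : ℕ} (hd : 1 ≤ d) :
    ((factorsInOfDegree (fun p => e p ≤ e (daggerRev σ p)) d).card : ℝ) * Real.sqrt d ≤
      16 * (q : ℝ) ^ (2 * d) := by
  have hq2 : (2 : ℝ) ≤ q := by exact_mod_cast hq
  have hU : ((normOne F q).card : ℝ) ≤ q + 1 := by exact_mod_cast card_normOne_le
  rw [Finset.card_eq_sum_card_fiberwise (t := normOne F q) (f := normConst σ) fun r hr =>
    normConst_mem_normOne hF hσ (mem_factorsInOfDegree.1 hr).1.2.1, Nat.cast_sum, Finset.sum_mul]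
  calc _ ≤ ∑ a ∈ normOne F q, 8 * (q : ℝ) ^ (2 * d - 1) := Finset.sum_le_sum fun a _ =>
        card_factorsInOfDegree_filter_mul_sqrt_le hq hF hσ he hd a
    _ = (normOne F q).card * (8 * (q : ℝ) ^ (2 * d - 1)) := by rw [Finset.sum_const, nsmul_eq_mul]
    _ ≤ (2 * q) * (8 * (q : ℝ) ^ (2 * d - 1)) := by gcongr; linarith
    _ = 16 * (q * (q : ℝ) ^ (2 * d - 1)) := by ring
    _ = 16 * (q : ℝ) ^ (2 * d) := by rw [← pow_succ', Nat.sub_add_cancel (by omega)]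

open scoped Classical in
/-- The products `r·r†·h` with constant coefficient `a`, where `r` has degree `d` and only has
irreducible factors satisfying `T`, and `h` is †-symmetric of degree `l`. -/
noncomputable def nearNorms (σ : F →+* F) (T : F[X] → Prop) (a : F) (d l : ℕ) : Finset F[X] :=
  ((factorsInOfDegree T d ×ˢ symmOfDegree σ l).filter
    fun x => normConst σ x.1 * x.2.coeff 0 = a).image fun x => x.1 * daggerRev σ x.1 * x.2

open scoped Classical in
lemma card_nearNorms_zero_le (T : F[X] → Prop) (a : F) (d : ℕ) :
    (nearNorms σ T a d 0).card ≤
      ((factorsInOfDegree T d).filter fun r => normConst σ r = a).card := by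
  refine Finset.card_image_le.trans (Finset.card_le_card_of_injOn Prod.fst ?_ ?_)
  · intro x hx
    rw [Finset.mem_coe, Finset.mem_filter, Finset.mem_product, mem_symmOfDegree] at hx
    obtain ⟨⟨h1, ⟨h2, h3⟩, -⟩, h4⟩ := hx
    rw [h2.natDegree_eq_zero.1 h3, coeff_one_zero, mul_one] at h4
    exact Finset.mem_filter.2 ⟨h1, h4⟩
  · intro x hx y hy h
    rw [Finset.mem_coe, Finset.mem_filter, Finset.mem_product, mem_symmOfDegree] at hx hy
    exact Prod.ext h (by rw [hx.1.2.1.1.natDegree_eq_zero.1 hx.1.2.1.2,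
      hy.1.2.1.1.natDegree_eq_zero.1 hy.1.2.1.2])

lemma card_nearNorms_le (hq : 2 ≤ q) (hF : Fintype.card F = q ^ 2)
    (hσ : ∀ x : F, σ x = x ^ q) (T : F[X] → Prop) (a : F) (d : ℕ) {l : ℕ} (hl : 1 ≤ l) :
    (nearNorms σ T a d l).card ≤ (factorsInOfDegree T d).card * q ^ (l - 1) := by
  classical
  refine Finset.card_image_le.trans ?_
  rw [Finset.card_eq_sum_card_fiberwise (t := factorsInOfDegree T d) (f := Prod.fst) fun x hx =>
    (Finset.mem_product.1 (Finset.mem_filter.1 hx).1).1, ← smul_eq_mul, ← Finset.sum_const]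
  refine Finset.sum_le_sum fun r hr => ?_
  have hr0 : normConst σ r ≠ 0 := by
    have := (mem_factorsInOfDegree.1 hr).1.2.1
    exact mul_ne_zero this (inv_ne_zero (by simpa using this))
  refine le_trans (Finset.card_le_card_of_injOn Prod.snd ?_ ?_)
    (card_symmOfDegree_filter_le hq hF hσ hl ((normConst σ r)⁻¹ * a))
  · rintro ⟨s, h⟩ hx
    simp only [Finset.mem_coe, Finset.mem_filter, Finset.mem_product] at hx ⊢
    obtain ⟨⟨⟨-, h1⟩, h2⟩, rfl⟩ := hx
    exact ⟨h1, by rw [← h2, inv_mul_cancel_left₀ hr0]⟩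
  · intro x hx y hy h
    rw [Finset.mem_coe, Finset.mem_filter] at hx hy
    exact Prod.ext (hx.2.trans hy.2.symm) h

lemma card_nearNorms_mul_sqrt_le (hq : 2 ≤ q) (hF : Fintype.card F = q ^ 2)
    (hσ : ∀ x : F, σ x = x ^ q) {e : F[X] → ℕ} (he : Function.Injective e) (a : F)
    {n d l : ℕ} (hn : 1 ≤ n) (hdl : 2 * d + l = n) (hl : l ^ 2 ≤ n) :
    ((nearNorms σ (fun p => e p ≤ e (daggerRev σ p)) a d l).card : ℝ) * Real.sqrt n ≤
      32 * (q : ℝ) ^ (n - 1) := by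
  classical
  set T : F[X] → Prop := fun p => e p ≤ e (daggerRev σ p)
  rcases Nat.eq_zero_or_pos d with rfl | hd
  · obtain rfl : l = n := by omega
    obtain rfl : l = 1 := by nlinarith
    have h1 := card_nearNorms_le hq hF hσ T a 0 le_rfl
    have h2 : (factorsInOfDegree T 0).card ≤ 1 := by
      refine (Finset.card_filter_le _ _).trans ?_
      rw [card_monicOfDegree, pow_zero]
    have h3 : ((nearNorms σ T a 0 1).card : ℝ) ≤ 1 := by
      exact_mod_cast h1.trans (by simpa using h2)
    rw [Nat.sub_self, pow_zero, Nat.cast_one, Real.sqrt_one]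
    linarith
  · have hnd : n ≤ 4 * d := by
      rcases Nat.lt_or_ge l 2 with h | h
      · omega
      · nlinarith
    have hs : Real.sqrt n ≤ 2 * Real.sqrt d := by
      rw [Real.sqrt_le_left (by positivity), mul_pow, Real.sq_sqrt (by positivity)]
      have : (n : ℝ) ≤ 4 * d := by exact_mod_cast hnd
      linarith
    rcases Nat.eq_zero_or_pos l with rfl | hl1
    · have h1 : ((nearNorms σ T a d 0).card : ℝ) ≤
          ((factorsInOfDegree T d).filter fun r => normConst σ r = a).card := by
        exact_mod_cast card_nearNorms_zero_le T a d
      have h2 := card_factorsInOfDegree_filter_mul_sqrt_le hq hF hσ he hd a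
      obtain rfl : n = 2 * d := by omega
      calc _ ≤ (((factorsInOfDegree T d).filter fun r => normConst σ r = a).card : ℝ) *
            (2 * Real.sqrt d) := by gcongr
        _ = 2 * ((((factorsInOfDegree T d).filter fun r => normConst σ r = a).card : ℝ) *
            Real.sqrt d) := by ring
        _ ≤ 2 * (8 * (q : ℝ) ^ (2 * d - 1)) := by gcongr
        _ ≤ 32 * (q : ℝ) ^ (2 * d - 1) := by
            have : (0 : ℝ) ≤ (q : ℝ) ^ (2 * d - 1) := by positivity
            linarith
    · have h1 : ((nearNorms σ T a d l).card : ℝ) ≤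
          (factorsInOfDegree T d).card * (q : ℝ) ^ (l - 1) := by
        exact_mod_cast card_nearNorms_le hq hF hσ T a d hl1
      have h2 := card_factorsInOfDegree_mul_sqrt_le hq hF hσ he hd
      calc _ ≤ ((factorsInOfDegree T d).card * (q : ℝ) ^ (l - 1)) * (2 * Real.sqrt d) := by gcongr
        _ = 2 * (q : ℝ) ^ (l - 1) * ((factorsInOfDegree T d).card * Real.sqrt d) := by ring
        _ ≤ 2 * (q : ℝ) ^ (l - 1) * (16 * (q : ℝ) ^ (2 * d)) := by gcongr
        _ = 32 * ((q : ℝ) ^ (l - 1) * (q : ℝ) ^ (2 * d)) := by ring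
        _ = _ := by rw [← pow_add, show l - 1 + 2 * d = n - 1 by omega]

lemma mem_nearNorms_of_eq (hF : Fintype.card F = q ^ 2)
    (hσ : ∀ x : F, σ x = x ^ q) (e : F[X] → ℕ) {g h : F[X]} (hg : g.Monic) (hg0 : g.coeff 0 ≠ 0)
    (hh : h.Monic) (hf : IsDaggerSymm σ (g * daggerRev σ g * h)) :
    g * daggerRev σ g * h ∈ nearNorms σ (fun p => e p ≤ e (daggerRev σ p))
      ((g * daggerRev σ g * h).coeff 0) g.natDegree h.natDegree := by
  classical
  have hσσ := apply_apply_eq_self hF hσ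
  obtain ⟨h0, hs⟩ := isDaggerSymm_iff.1 hf
  rw [mul_coeff_zero] at h0
  rw [daggerRev_mul, daggerRev_mul_self_symm hσσ hg hg0] at hs
  have hh' := mul_left_cancel₀ (hg.mul (monic_daggerRev hg0)).ne_zero hs
  obtain ⟨r, hr, hd, hN⟩ := exists_factorsIn_daggerRev hσσ e g hg hg0
  rw [← hN]
  refine Finset.mem_image.2 ⟨(r, h), Finset.mem_filter.2 ⟨Finset.mem_product.2
    ⟨mem_factorsInOfDegree.2 ⟨hr, hd⟩, mem_symmOfDegree.2 ⟨⟨hh, rfl⟩,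
      right_ne_zero_of_mul h0, hh'⟩⟩, ?_⟩, rfl⟩
  rw [mul_coeff_zero _ h, coeff_zero_mul_daggerRev hr.1]

lemma exists_injective_polynomial_nat (F : Type) [Field F] [Finite F] :
    ∃ e : F[X] → ℕ, Function.Injective e := by
  have : Countable F[X] := by
    rw [← Cardinal.mk_le_aleph0_iff]
    refine cardinalMk_le_max.trans (max_le ?_ le_rfl)
    exact Cardinal.mk_le_aleph0
  exact Countable.exists_injective_nat _

end NearNorms

/-- **Polynomials nearly factorizing as `g·g†`.**
Over a field with `q0²` elements with involution `x ↦ x^{q0}`, the number of †-symmetric monic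
polynomials `f` of degree `n`, with constant coefficient `a ∈ U`, which factor as `f = g·g†·h`
with `g, h` monic, `g(0) ≠ 0`, and `deg h ≤ m ≤ n^{1/2}`, is `≤ C q0ⁿ⁻¹ (m+1)/n^{1/2}`. -/
theorem stmt11 : ∃ C : ℝ, 0 < C ∧
    ∀ (F : Type) [Field F] [Fintype F], ∀ (q0 n m : ℕ) (σ : F →+* F) (a : F),
      IsPrimePow q0 → Fintype.card F = q0 ^ 2 → (∀ x : F, σ x = x ^ q0) →
      1 ≤ n → (m : ℝ) ≤ Real.sqrt n → a ^ (q0 + 1) = 1 →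
      ({f : F[X] | f.Monic ∧ IsDaggerSymm σ f ∧ f.natDegree = n ∧ f.coeff 0 = a ∧
          ∃ g h : F[X], g.Monic ∧ h.Monic ∧ g.coeff 0 ≠ 0 ∧ h.natDegree ≤ m ∧
            f = g * daggerRev σ g * h}.ncard : ℝ) ≤
        C * (q0 : ℝ) ^ (n - 1) * ((m : ℝ) + 1) / Real.sqrt n := by
  classical
  refine ⟨32, by norm_num, fun F _ _ q n m σ a hq hF hσ hn hm _ => ?_⟩
  obtain ⟨e, he⟩ := exists_injective_polynomial_nat F
  have hq2 := hq.two_le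
  set T : F[X] → Prop := fun p => e p ≤ e (daggerRev σ p)
  set L := (Finset.range (m + 1)).filter fun l => ∃ d, 2 * d + l = n
  have hsqrt : 0 < Real.sqrt n := Real.sqrt_pos.2 (by exact_mod_cast hn)
  have hmn : m ^ 2 ≤ n := by
    rw [Real.le_sqrt (by positivity) (by positivity)] at hm
    exact_mod_cast hm
  have hcard : ∀ l ∈ L, ((nearNorms σ T a ((n - l) / 2) l).card : ℝ) ≤
      32 * (q : ℝ) ^ (n - 1) / Real.sqrt n := by
    intro l hl
    obtain ⟨hlm, d, hd⟩ := Finset.mem_filter.1 hl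
    rw [le_div_iff₀ hsqrt]
    refine card_nearNorms_mul_sqrt_le hq2 hF hσ he a hn (by omega) (le_trans ?_ hmn)
    exact Nat.pow_le_pow_left (Nat.lt_succ_iff.1 (Finset.mem_range.1 hlm)) 2
  have hsub : {f : F[X] | f.Monic ∧ IsDaggerSymm σ f ∧ f.natDegree = n ∧ f.coeff 0 = a ∧
      ∃ g h : F[X], g.Monic ∧ h.Monic ∧ g.coeff 0 ≠ 0 ∧ h.natDegree ≤ m ∧
        f = g * daggerRev σ g * h} ⊆ (L.biUnion fun l => nearNorms σ T a ((n - l) / 2) l :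
          Finset F[X]) := by
    rintro f ⟨-, hs, hd, rfl, g, h, hg, hh, hg0, hdm, rfl⟩
    have hgm := monic_daggerRev (σ := σ) hg0
    rw [(hg.mul hgm).natDegree_mul hh, hg.natDegree_mul hgm, natDegree_daggerRev hg0] at hd
    refine Finset.mem_biUnion.2 ⟨h.natDegree, Finset.mem_filter.2
      ⟨Finset.mem_range.2 (by omega), g.natDegree, by omega⟩, ?_⟩
    rw [show (n - h.natDegree) / 2 = g.natDegree by omega]
    exact mem_nearNorms_of_eq hF hσ e hg hg0 hh hs
  have hL : (L.card : ℝ) ≤ m + 1 := by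
    exact_mod_cast (Finset.card_filter_le _ _).trans (Finset.card_range _).le
  calc _ ≤ ((L.biUnion fun l => nearNorms σ T a ((n - l) / 2) l).card : ℝ) := by
        rw [← Set.ncard_coe_finset]
        exact_mod_cast Set.ncard_le_ncard hsub (Finset.finite_toSet _)
    _ ≤ ∑ l ∈ L, ((nearNorms σ T a ((n - l) / 2) l).card : ℝ) := by
        exact_mod_cast Finset.card_biUnion_le
    _ ≤ L.card * (32 * (q : ℝ) ^ (n - 1) / Real.sqrt n) := by
        rw [← nsmul_eq_mul, ← Finset.sum_const]
        exact Finset.sum_le_sum hcard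
    _ ≤ (m + 1) * (32 * (q : ℝ) ^ (n - 1) / Real.sqrt n) := by gcongr
    _ = _ := by ring
end

section
/- There is an absolute constant C > 0 with the following property. Let r ≥ 2 be an integer, let F be a finite field with q elements, let n ≥ 1, and let a ∈ F^×. Then the number of monic polynomials f of degree n over F with constant coefficient a such that every monic irreducible factor of f has degree divisible by r or multiplicity (as a factor of f) divisible by r, is at most C·q^{n−1}·n^{−1+1/r}. -/
open Polynomial

/-- `f` has property `P_r`: every monic irreducible factor of `f` has degree divisible by `r`
or multiplicity (as a factor of `f`) divisible by `r`. -/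
def HasPropertyP {F : Type} [Field F] (r : ℕ) (f : F[X]) : Prop :=
  ∀ g : F[X], g.Monic → Irreducible g → g ∣ f →
    (r ∣ g.natDegree ∨ ∃ k : ℕ, g ^ k ∣ f ∧ ¬ g ^ (k + 1) ∣ f ∧ r ∣ k)

namespace Polynomial

open UniqueFactorizationMonoid

section Factorization

variable {F : Type} [Field F]

lemma monic_irreducible_of_mem_normalizedFactors {f P : F[X]} [DecidableEq F]
    (h : P ∈ normalizedFactors f) : P.Monic ∧ Irreducible P := by
  have hi := irreducible_of_normalized_factor P h
  refine ⟨?_, hi⟩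
  rw [← normalize_normalized_factor P h]
  exact monic_normalize hi.ne_zero

lemma prod_normalizedFactors_of_monic {f : F[X]} [DecidableEq F] (hf : f.Monic) :
    (normalizedFactors f).prod = f := by
  rw [prod_normalizedFactors_eq hf.ne_zero, hf.normalize_eq_self]

lemma _root_.HasPropertyP.dvd_natDegree_or_dvd_count [DecidableEq F] [DecidableEq F[X]] {r : ℕ}
    {f P : F[X]} (hf : HasPropertyP r f) (hP : P ∈ normalizedFactors f) :
    r ∣ P.natDegree ∨ r ∣ (normalizedFactors f).count P := by
  obtain ⟨hm, hi⟩ := monic_irreducible_of_mem_normalizedFactors hP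
  refine (hf P hm hi (dvd_of_mem_normalizedFactors hP)).imp_right ?_
  rintro ⟨k, hk, hk', hr⟩
  rwa [count_normalizedFactors_eq hi hm.normalize_eq_self hk hk']

lemma natDegree_eq_sum_count_mul [DecidableEq F] [DecidableEq F[X]] {f : F[X]} (hf : f.Monic) :
    f.natDegree =
      ∑ P ∈ (normalizedFactors f).toFinset, (normalizedFactors f).count P * P.natDegree := by
  conv_lhs => rw [← prod_normalizedFactors_of_monic hf]
  rw [natDegree_multiset_prod_of_monic _ fun P hP =>
    (monic_irreducible_of_mem_normalizedFactors hP).1, Finset.sum_multiset_map_count]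
  simp

lemma prod_filter_ne_mul_pow_count [DecidableEq F] [DecidableEq F[X]] {f : F[X]} (hf : f.Monic)
    (P : F[X]) :
    ((normalizedFactors f).filter (· ≠ P)).prod * P ^ (normalizedFactors f).count P = f := by
  conv_rhs => rw [← prod_normalizedFactors_of_monic hf,
    ← Multiset.filter_add_not (· ≠ P) (normalizedFactors f), Multiset.prod_add]
  congr 1
  simp only [ne_eq, not_not]
  rw [Multiset.filter_eq', Multiset.prod_replicate]

end Factorization

section Counting

variable {F : Type} [Field F] [Fintype F]

variable (F) in
lemma finite_setOf_monic_natDegree_eq (d : ℕ) : {f : F[X] | f.Monic ∧ f.natDegree = d}.Finite := by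
  let e := (monicEquivDegreeLT (R := F) d).trans (degreeLTEquiv F d).toEquiv
  exact Set.finite_coe_iff.mp (Finite.of_equiv _ e.symm)

variable (F) in
/-- The monic polynomials of degree `d` over a finite field, as a finset. -/
noncomputable def monicFinset (d : ℕ) : Finset F[X] :=
  (finite_setOf_monic_natDegree_eq F d).toFinset

@[simp]
lemma mem_monicFinset {d : ℕ} {f : F[X]} : f ∈ monicFinset F d ↔ f.Monic ∧ f.natDegree = d := by
  simp [monicFinset]

lemma card_monicFinset (d : ℕ) : (monicFinset F d).card = Fintype.card F ^ d := by
  let e := (monicEquivDegreeLT (R := F) d).trans (degreeLTEquiv F d).toEquiv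
  have h : Nat.card {f : F[X] | f.Monic ∧ f.natDegree = d} = Nat.card (Fin d → F) :=
    Nat.card_congr e
  rw [Nat.card_coe_set_eq, Set.ncard_eq_toFinset_card _ (finite_setOf_monic_natDegree_eq F d)] at h
  rw [monicFinset, h]
  simp

lemma Irreducible.dvd_X_pow_geom_sum_sub_C {P : F[X]} (hP : Irreducible P) (hm : P.Monic) :
    P ∣ X ^ (∑ i ∈ Finset.range P.natDegree, Fintype.card F ^ i) -
      C ((-1) ^ P.natDegree * P.coeff 0) := by
  have : Fact (Irreducible P) := ⟨hP⟩
  have : FiniteDimensional F (AdjoinRoot P) := (AdjoinRoot.powerBasis hP.ne_zero).finite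
  have : Finite (AdjoinRoot P) := Module.finite_of_finite F
  have hfr : Module.finrank F (AdjoinRoot P) = P.natDegree := by
    rw [(AdjoinRoot.powerBasis hP.ne_zero).finrank, AdjoinRoot.powerBasis_dim]
  have hmin : minpoly F (AdjoinRoot.powerBasis hP.ne_zero).gen = P := by
    rw [AdjoinRoot.minpoly_powerBasis_gen, hm.leadingCoeff]; simp
  have h1 := FiniteField.algebraMap_norm_eq_pow (K := F) (K' := AdjoinRoot P)
    (x := AdjoinRoot.root P)
  have h2 := Algebra.PowerBasis.norm_gen_eq_coeff_zero_minpoly (AdjoinRoot.powerBasis hP.ne_zero)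
  rw [hmin, AdjoinRoot.powerBasis_gen, AdjoinRoot.powerBasis_dim] at h2
  rw [← AdjoinRoot.mk_eq_zero, map_sub, map_pow, AdjoinRoot.mk_X, AdjoinRoot.mk_C, sub_eq_zero,
    ← h2]
  rw [AdjoinRoot.algebraMap_eq] at h1
  rw [h1, Nat.geomSum_eq Fintype.one_lt_card, ← Nat.card_eq_fintype_card,
    Module.natCard_eq_pow_finrank (K := F) (V := AdjoinRoot P), hfr]

/-- At most `(1 + q + ⋯ + q ^ (m - 1)) / m` monic irreducible polynomials of degree `m` have a
given constant coefficient. -/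
lemma natDegree_mul_card_irreducible_le {m : ℕ} (hm : m ≠ 0) {c : F}
    (s : Finset F[X])
    (hs : ∀ P ∈ s, P.Monic ∧ Irreducible P ∧ P.natDegree = m ∧ P.coeff 0 = c) :
    m * s.card ≤ ∑ i ∈ Finset.range m, Fintype.card F ^ i := by
  set e := ∑ i ∈ Finset.range m, Fintype.card F ^ i with he
  have hdvd : ∏ P ∈ s, P ∣ X ^ e - C ((-1) ^ m * c) := by
    refine Finset.prod_dvd_of_coprime (fun P hP Q hQ hPQ => ?_) fun P hP => ?_
    · obtain ⟨hPm, hPi, -, -⟩ := hs P hP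
      obtain ⟨hQm, hQi, -, -⟩ := hs Q hQ
      refine ((EuclideanDomain.dvd_or_coprime P Q hPi).symm).resolve_right fun h => hPQ ?_
      exact eq_of_monic_of_associated hPm hQm (hPi.associated_of_dvd hQi h)
    · obtain ⟨hPm, hPi, hd, h0⟩ := hs P hP
      have := Irreducible.dvd_X_pow_geom_sum_sub_C hPi hPm
      rwa [hd, h0] at this
  have hepos : 0 < e := by
    refine Finset.sum_pos (fun i _ => pow_pos Fintype.card_pos i) ?_
    simpa using hm
  have hle := natDegree_le_of_dvd hdvd (X_pow_sub_C_ne_zero hepos _)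
  rw [natDegree_X_pow_sub_C, natDegree_prod_of_monic _ _ fun P hP => (hs P hP).1,
    Finset.sum_congr rfl fun P hP => (hs P hP).2.2.1] at hle
  simpa [mul_comm] using hle

/-- At most `(q ^ m - 1) / m` monic irreducible polynomials of degree `m` have nonzero constant
coefficient. -/
lemma natDegree_mul_card_irreducible_lt {m : ℕ} (hm : m ≠ 0) (s : Finset F[X])
    (hs : ∀ P ∈ s, P.Monic ∧ Irreducible P ∧ P.natDegree = m ∧ P.coeff 0 ≠ 0) :
    m * s.card + 1 ≤ Fintype.card F ^ m := by
  classical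
  have h1 := Finset.card_eq_sum_card_fiberwise (f := fun P : F[X] => P.coeff 0) (s := s)
    (t := Finset.univ.erase (0 : F)) fun P hP => by simpa using (hs P hP).2.2.2
  have h2 : m * s.card ≤ (Fintype.card F - 1) * ∑ i ∈ Finset.range m, Fintype.card F ^ i := by
    rw [h1, Finset.mul_sum]
    refine (Finset.sum_le_card_nsmul _ _ (∑ i ∈ Finset.range m, Fintype.card F ^ i)
      fun c hc => ?_).trans_eq ?_
    · refine natDegree_mul_card_irreducible_le hm (c := c) _ fun P hP => ?_
      rw [Finset.mem_filter] at hP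
      obtain ⟨h, h', h'', -⟩ := hs P hP.1
      exact ⟨h, h', h'', hP.2⟩
    · rw [Finset.card_erase_of_mem (Finset.mem_univ _), Finset.card_univ, smul_eq_mul]
  have h3 := Nat.geomSum_eq (m := Fintype.card F) Fintype.one_lt_card m
  have h4 : 1 ≤ Fintype.card F ^ m := Nat.one_le_pow _ _ Fintype.card_pos
  rw [h3, Nat.mul_div_cancel' (by simpa using Nat.sub_dvd_pow_sub_pow (Fintype.card F) 1 m)] at h2
  omega

lemma geom_sum_le_two_mul_pow {q : ℕ} (hq : 2 ≤ q) (m : ℕ) :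
    ∑ i ∈ Finset.range (m + 1), q ^ i ≤ 2 * q ^ m := by
  induction m with
  | zero => simp
  | succ m ih =>
    rw [Finset.sum_range_succ]
    have : 2 * q ^ m ≤ q ^ (m + 1) := by rw [pow_succ']; gcongr
    omega

/-- The monic prime powers of degree `m` with a given constant coefficient have density
`O(1 / m)`. -/
lemma natDegree_mul_card_isPrimePow_le {m : ℕ} (hm : m ≠ 0) {c : F}
    (s : Finset F[X])
    (hs : ∀ h ∈ s, h.natDegree = m ∧ h.coeff 0 = c ∧
      ∃ P : F[X], P.Monic ∧ Irreducible P ∧ ∃ k ≠ 0, h = P ^ k) :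
    m * s.card ≤ 10 * Fintype.card F ^ (m - 1) := by
  classical
  set q := Fintype.card F with hq
  have hq2 : 2 ≤ q := Fintype.one_lt_card
  have h1 : m * (s.filter Irreducible).card ≤ 2 * q ^ (m - 1) := by
    refine (natDegree_mul_card_irreducible_le hm (c := c) _ fun P hP => ?_).trans ?_
    · rw [Finset.mem_filter] at hP
      obtain ⟨hd, h0, P', hP'm, -, k, -, rfl⟩ := hs P hP.1
      exact ⟨hP'm.pow k, hP.2, hd, h0⟩
    · have := geom_sum_le_two_mul_pow hq2 (m - 1)
      rwa [Nat.sub_add_cancel (Nat.one_le_iff_ne_zero.2 hm)] at this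
  have h2 : m * (s.filter fun h => ¬ Irreducible h).card ≤ 8 * q ^ (m - 1) := by
    have hsub : s.filter (fun h => ¬ Irreducible h) ⊆
        ((Finset.range (m / 2 + 1)).biUnion (monicFinset F)).image
          fun P => P ^ (m / P.natDegree) := by
      intro h hh
      rw [Finset.mem_filter] at hh
      obtain ⟨hd, -, P, hPm, hPi, k, hk, rfl⟩ := hs h hh.1
      have hk1 : k ≠ 1 := by rintro rfl; exact hh.2 (by simpa using hPi)
      rw [natDegree_pow] at hd
      have hk2 : 2 ≤ k := by omega
      have hdpos := hPi.natDegree_pos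
      refine Finset.mem_image.2 ⟨P, Finset.mem_biUnion.2 ⟨P.natDegree, ?_, by simpa using hPm⟩, ?_⟩
      · rw [Finset.mem_range, Nat.lt_succ_iff, Nat.le_div_iff_mul_le two_pos]
        nlinarith
      · rw [← hd, Nat.mul_div_cancel _ hdpos]
    have hcard : (s.filter fun h => ¬ Irreducible h).card ≤ 2 * q ^ (m / 2) := by
      refine (Finset.card_le_card hsub).trans (Finset.card_image_le.trans ?_)
      refine Finset.card_biUnion_le.trans ?_
      simp only [card_monicFinset]
      exact geom_sum_le_two_mul_pow hq2 _
    rcases Nat.lt_or_ge m 2 with hm2 | hm2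
    · have hm1 : m = 1 := by omega
      have : s.filter (fun h => ¬ Irreducible h) = ∅ := by
        refine Finset.filter_eq_empty_iff.2 fun h hh => not_not.2 ?_
        exact irreducible_of_degree_eq_one
          ((degree_eq_iff_natDegree_eq_of_pos one_pos).2 ((hs h hh).1.trans hm1))
      simp [this]
    · have hpow : q ^ (m - 1) = q ^ (m / 2) * q ^ (m - 1 - m / 2) := by
        rw [← pow_add]; congr 1; omega
      have hlt : m - 1 - m / 2 < q ^ (m - 1 - m / 2) := Nat.lt_pow_self hq2
      have hm4 : m ≤ 4 * q ^ (m - 1 - m / 2) := by omega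
      rw [hpow]
      calc m * (s.filter fun h => ¬ Irreducible h).card
          ≤ (4 * q ^ (m - 1 - m / 2)) * (2 * q ^ (m / 2)) := Nat.mul_le_mul hm4 hcard
        _ = _ := by ring
  have h3 := Finset.card_filter_add_card_filter_not (s := s) (p := Irreducible)
  rw [← h3, mul_add]
  omega

open scoped Classical in
/-- The monic polynomials of degree less than `n` with nonzero constant coefficient whose monic
irreducible factors have degree or multiplicity divisible by `r`. -/
noncomputable def propertyFinset (F : Type) [Field F] [Fintype F] (r n : ℕ) : Finset F[X] :=
  ((Finset.range n).biUnion (monicFinset F)).filter fun f => f.coeff 0 ≠ 0 ∧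
    ∀ P ∈ normalizedFactors f, r ∣ P.natDegree ∨ r ∣ (normalizedFactors f).count P

open scoped Classical in
lemma mem_propertyFinset {r n : ℕ} {f : F[X]} : f ∈ propertyFinset F r n ↔
    f.Monic ∧ f.natDegree < n ∧ f.coeff 0 ≠ 0 ∧
      ∀ P ∈ normalizedFactors f, r ∣ P.natDegree ∨ r ∣ (normalizedFactors f).count P := by
  simp only [propertyFinset, Finset.mem_filter, Finset.mem_biUnion, Finset.mem_range,
    mem_monicFinset]
  constructor
  · rintro ⟨⟨d, hd, hf, rfl⟩, h⟩
    exact ⟨hf, hd, h⟩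
  · rintro ⟨hf, hd, h⟩
    exact ⟨⟨_, hd, hf, rfl⟩, h⟩

open scoped Classical in
lemma prod_filter_ne_mem_propertyFinset {r n : ℕ} {f P : F[X]} (hf : f.Monic)
    (hn : f.natDegree = n) (h0 : f.coeff 0 ≠ 0) (hr : HasPropertyP r f)
    (hP : P ∈ normalizedFactors f) :
    ((normalizedFactors f).filter (· ≠ P)).prod ∈ propertyFinset F r n := by
  obtain ⟨hPm, hPi⟩ := monic_irreducible_of_mem_normalizedFactors hP
  have hfac := prod_filter_ne_mul_pow_count hf P
  have hmem : ∀ Q ∈ (normalizedFactors f).filter (· ≠ P), Q.Monic ∧ Irreducible Q := fun Q hQ =>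
    monic_irreducible_of_mem_normalizedFactors (Multiset.mem_of_mem_filter hQ)
  have hgm : ((normalizedFactors f).filter (· ≠ P)).prod.Monic := by
    simpa using monic_multiset_prod_of_monic _ id fun Q hQ => (hmem Q hQ).1
  have hnf : normalizedFactors ((normalizedFactors f).filter (· ≠ P)).prod =
      (normalizedFactors f).filter (· ≠ P) := by
    rw [normalizedFactors_prod_eq _ fun Q hQ => (hmem Q hQ).2]
    conv_rhs => rw [← Multiset.map_id ((normalizedFactors f).filter (· ≠ P))]
    exact Multiset.map_congr rfl fun Q hQ => (hmem Q hQ).1.normalize_eq_self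
  have hcount : 0 < (normalizedFactors f).count P := Multiset.count_pos.2 hP
  refine mem_propertyFinset.2 ⟨hgm, ?_, fun h => h0 ?_, ?_⟩
  · have := hgm.natDegree_mul (hPm.pow ((normalizedFactors f).count P))
    rw [hfac, natDegree_pow, hn] at this
    have := Nat.mul_pos hcount hPi.natDegree_pos
    omega
  · rw [← hfac, mul_coeff_zero, h, zero_mul]
  · rw [hnf]
    intro Q hQ
    have hQ' := Multiset.mem_filter.1 hQ
    rw [Multiset.count_filter_of_pos (p := (· ≠ P)) hQ'.2]
    exact hr.dvd_natDegree_or_dvd_count hQ'.1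

/-- Splitting off a full prime power from each `f` in turn bounds the number of `f` of degree `n`
with property `P_r` by a sum over cofactors. -/
lemma natDegree_mul_card_le_sum_propertyFinset {r n : ℕ} {a : F} (ha : a ≠ 0) (s : Finset F[X])
    (hs : ∀ f ∈ s, f.Monic ∧ f.natDegree = n ∧ f.coeff 0 = a ∧ HasPropertyP r f) :
    n * s.card ≤ ∑ g ∈ propertyFinset F r n, 10 * Fintype.card F ^ (n - g.natDegree - 1) := by
  classical
  set T : Finset (Σ _ : F[X], F[X]) := s.sigma fun f => (normalizedFactors f).toFinset with hT
  set φ : (Σ _ : F[X], F[X]) → F[X] × F[X] := fun x =>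
    (((normalizedFactors x.1).filter (· ≠ x.2)).prod, x.2 ^ (normalizedFactors x.1).count x.2)
    with hφ
  have hmemT : ∀ x ∈ T, x.1 ∈ s ∧ x.2 ∈ normalizedFactors x.1 := fun x hx => by
    simpa only [hT, Finset.mem_sigma, Multiset.mem_toFinset] using hx
  have hmul : ∀ x ∈ T, (φ x).1 * (φ x).2 = x.1 := fun x hx =>
    prod_filter_ne_mul_pow_count (hs _ (hmemT x hx).1).1 _
  have hinj : Set.InjOn φ T := by
    rintro ⟨f, P⟩ hx ⟨f', P'⟩ hx' h
    have hff : f = f' := (hmul _ hx).symm.trans ((congrArg (fun y => y.1 * y.2) h).trans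
      (hmul _ hx'))
    subst hff
    obtain ⟨hPm, hPi⟩ := monic_irreducible_of_mem_normalizedFactors (hmemT _ hx).2
    obtain ⟨hPm', hPi'⟩ := monic_irreducible_of_mem_normalizedFactors (hmemT _ hx').2
    have hpow : P ^ (normalizedFactors f).count P = P' ^ (normalizedFactors f).count P' :=
      congrArg Prod.snd h
    have hdvd : P ∣ P' := hPi.prime.dvd_of_dvd_pow
      (hpow ▸ dvd_pow_self P (Multiset.count_pos.2 (hmemT _ hx).2).ne')
    have hPP : P = P' := eq_of_monic_of_associated hPm hPm' (hPi.associated_of_dvd hPi' hdvd)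
    rw [hPP]
  have hG : ∀ y ∈ T.image φ, y.1 ∈ propertyFinset F r n := by
    intro y hy
    obtain ⟨x, hx, rfl⟩ := Finset.mem_image.1 hy
    obtain ⟨h1, h2, h3, h4⟩ := hs _ (hmemT x hx).1
    exact prod_filter_ne_mem_propertyFinset h1 h2 (h3 ▸ ha) h4 (hmemT x hx).2
  have hY : ∀ y ∈ T.image φ, y.2.natDegree = n - y.1.natDegree ∧ y.2.coeff 0 = a / y.1.coeff 0 ∧
      ∃ P : F[X], P.Monic ∧ Irreducible P ∧ ∃ k ≠ 0, y.2 = P ^ k := by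
    intro y hy
    have hy1 := mem_propertyFinset.1 (hG y hy)
    obtain ⟨x, hx, rfl⟩ := Finset.mem_image.1 hy
    obtain ⟨hPm, hPi⟩ := monic_irreducible_of_mem_normalizedFactors (hmemT x hx).2
    obtain ⟨h1, h2, h3, h4⟩ := hs _ (hmemT x hx).1
    have hm2 : (φ x).2.Monic := hPm.pow _
    refine ⟨?_, ?_, x.2, hPm, hPi, _, (Multiset.count_pos.2 (hmemT x hx).2).ne', rfl⟩
    · have := hy1.1.natDegree_mul hm2
      rw [hmul x hx, h2] at this
      omega
    · rw [eq_div_iff hy1.2.2.1, mul_comm, ← mul_coeff_zero, hmul x hx, h3]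
  have hsum : n * s.card = ∑ y ∈ T.image φ, y.2.natDegree := by
    rw [Finset.sum_image hinj, hT, Finset.sum_sigma, mul_comm, ← smul_eq_mul, ← Finset.sum_const]
    refine Finset.sum_congr rfl fun f hf => ?_
    rw [← (hs f hf).2.1, natDegree_eq_sum_count_mul (hs f hf).1]
    refine Finset.sum_congr rfl fun P _ => ?_
    simp [hφ, natDegree_pow]
  rw [hsum, ← Finset.sum_fiberwise_of_maps_to hG]
  refine Finset.sum_le_sum fun g hg => ?_
  have hgn := (mem_propertyFinset.1 hg).2.1
  have hfib : ∀ y ∈ (T.image φ).filter fun y => y.1 = g, y ∈ T.image φ ∧ y.1 = g := fun y hy =>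
    Finset.mem_filter.1 hy
  rw [Finset.sum_congr rfl fun y hy => by rw [(hY y (hfib y hy).1).1, (hfib y hy).2],
    Finset.sum_const, smul_eq_mul, mul_comm]
  have hcard : ((T.image φ).filter fun y => y.1 = g).card =
      (((T.image φ).filter fun y => y.1 = g).image Prod.snd).card := by
    refine (Finset.card_image_of_injOn fun y hy z hz h => ?_).symm
    exact Prod.ext ((hfib y hy).2.trans (hfib z hz).2.symm) h
  rw [hcard]
  refine natDegree_mul_card_isPrimePow_le (by omega) (c := a / g.coeff 0) _ fun h hh => ?_
  obtain ⟨y, hy, rfl⟩ := Finset.mem_image.1 hh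
  have := hY y (hfib y hy).1
  rwa [(hfib y hy).2] at this

lemma sum_range_inv_pow_le_exp {Q : ℝ} (hQ : 1 < Q) (N : ℕ) :
    ∑ k ∈ Finset.range N, Q⁻¹ ^ k ≤ Real.exp (Q - 1)⁻¹ := by
  have h0 : 0 ≤ Q⁻¹ := by positivity
  have h1 : Q⁻¹ < 1 := inv_lt_one_of_one_lt₀ hQ
  calc ∑ k ∈ Finset.range N, Q⁻¹ ^ k ≤ ∑' k : ℕ, Q⁻¹ ^ k :=
        (summable_geometric_of_lt_one h0 h1).sum_le_tsum _ fun _ _ => by positivity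
    _ = (Q - 1)⁻¹ + 1 := by
        rw [tsum_geometric_of_lt_one h0 h1]
        have : Q - 1 ≠ 0 := by linarith
        field_simp
        ring
    _ ≤ _ := Real.add_one_le_exp _

/-- The Euler factor attached to an irreducible polynomial of norm `Q`. -/
lemma sum_filter_inv_pow_le_exp {Q : ℝ} (hQ : 1 < Q) {r : ℕ} (hr : 2 ≤ r) (d N : ℕ) :
    ∑ k ∈ (Finset.range N).filter (fun k => r ∣ d ∨ r ∣ k), Q⁻¹ ^ k ≤
      Real.exp ((if r ∣ d then (Q - 1)⁻¹ else 0) + (Q ^ 2 - 1)⁻¹) := by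
  have hQ2 : 1 < Q ^ 2 := one_lt_pow₀ hQ two_ne_zero
  have hpos : 0 < (Q ^ 2 - 1)⁻¹ := inv_pos.2 (by linarith)
  split_ifs with h
  · simp only [h, true_or, Finset.filter_true]
    exact (sum_range_inv_pow_le_exp hQ N).trans (Real.exp_le_exp.2 (by linarith))
  · simp only [h, false_or, zero_add]
    refine le_trans ?_ (sum_range_inv_pow_le_exp hQ2 N)
    have hsub : (Finset.range N).filter (fun k => r ∣ k) ⊆
        (Finset.range N).image fun j => r * j := by
      intro k hk
      obtain ⟨hk, j, rfl⟩ := Finset.mem_filter.1 hk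
      refine Finset.mem_image.2 ⟨j, ?_, rfl⟩
      rw [Finset.mem_range] at hk ⊢
      nlinarith
    refine (Finset.sum_le_sum_of_subset_of_nonneg hsub fun _ _ _ => by positivity).trans ?_
    rw [Finset.sum_image fun i _ j _ hij => Nat.eq_of_mul_eq_mul_left (by omega) hij]
    refine Finset.sum_le_sum fun j _ => ?_
    rw [← inv_pow, ← pow_mul]
    exact pow_le_pow_of_le_one (by positivity) (inv_le_one_of_one_le₀ hQ.le)
      (Nat.mul_le_mul_right j hr)

lemma sum_Ico_ite_dvd_inv_le {r : ℕ} (hr : 2 ≤ r) (n : ℕ) :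
    ∑ d ∈ Finset.Ico 1 n, (if r ∣ d then (d : ℝ)⁻¹ else 0) ≤ (1 + Real.log n) / r := by
  rw [← Finset.sum_filter]
  have hsub : (Finset.Ico 1 n).filter (fun k => r ∣ k) ⊆
      (Finset.range n).image fun j => r * (j + 1) := by
    intro k hk
    obtain ⟨hk, j, rfl⟩ := Finset.mem_filter.1 hk
    rw [Finset.mem_Ico] at hk
    obtain _ | j := j
    · simp at hk
    refine Finset.mem_image.2 ⟨j, ?_, rfl⟩
    rw [Finset.mem_range]
    nlinarith
  refine (Finset.sum_le_sum_of_subset_of_nonneg hsub fun _ _ _ => by positivity).trans ?_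
  rw [Finset.sum_image fun i _ j _ hij => by
    have := Nat.eq_of_mul_eq_mul_left (by omega) hij; omega]
  have h := harmonic_le_one_add_log n
  rw [harmonic] at h
  push_cast at h ⊢
  simp only [mul_inv]
  rw [← Finset.mul_sum, mul_comm, ← div_eq_mul_inv]
  gcongr

open scoped Classical in
/-- The monic irreducible polynomials of degree less than `n` other than `X`. -/
noncomputable def irreducibleFinset (F : Type) [Field F] [Fintype F] (n : ℕ) : Finset F[X] :=
  ((Finset.range n).biUnion (monicFinset F)).filter fun P => Irreducible P ∧ P.coeff 0 ≠ 0

lemma mem_irreducibleFinset {n : ℕ} {P : F[X]} : P ∈ irreducibleFinset F n ↔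
    P.Monic ∧ P.natDegree < n ∧ Irreducible P ∧ P.coeff 0 ≠ 0 := by
  simp only [irreducibleFinset, Finset.mem_filter, Finset.mem_biUnion, Finset.mem_range,
    mem_monicFinset]
  constructor
  · rintro ⟨⟨d, hd, hf, rfl⟩, h⟩
    exact ⟨hf, hd, h⟩
  · rintro ⟨hf, hd, h⟩
    exact ⟨⟨_, hd, hf, rfl⟩, h⟩

lemma sum_irreducibleFinset_le {r : ℕ} (hr : 2 ≤ r) (n : ℕ) :
    ∑ P ∈ irreducibleFinset F n,
      ((if r ∣ P.natDegree then ((Fintype.card F : ℝ) ^ P.natDegree - 1)⁻¹ else 0) +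
        (((Fintype.card F : ℝ) ^ P.natDegree) ^ 2 - 1)⁻¹) ≤ (1 + Real.log n) / r + 2 := by
  have hmaps : ∀ P ∈ irreducibleFinset F n, P.natDegree ∈ Finset.Ico 1 n := fun P hP => by
    have h := mem_irreducibleFinset.1 hP
    exact Finset.mem_Ico.2 ⟨h.2.2.1.natDegree_pos, h.2.1⟩
  rw [← Finset.sum_fiberwise_of_maps_to hmaps]
  have hterm : ∀ d ∈ Finset.Ico 1 n,
      ∑ P ∈ (irreducibleFinset F n).filter (fun P => P.natDegree = d),
        ((if r ∣ P.natDegree then ((Fintype.card F : ℝ) ^ P.natDegree - 1)⁻¹ else 0) +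
          (((Fintype.card F : ℝ) ^ P.natDegree) ^ 2 - 1)⁻¹) ≤
      (if r ∣ d then (d : ℝ)⁻¹ else 0) + (1 / 2 : ℝ) ^ d := by
    intro d hd
    have hd1 : 1 ≤ d := (Finset.mem_Ico.1 hd).1
    rw [Finset.sum_congr rfl fun P hP => by rw [(Finset.mem_filter.1 hP).2], Finset.sum_const,
      nsmul_eq_mul]
    set N := ((irreducibleFinset F n).filter fun P => P.natDegree = d).card with hN
    have hcard : d * N + 1 ≤ Fintype.card F ^ d := by
      refine natDegree_mul_card_irreducible_lt (by omega) _ fun P hP => ?_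
      rw [Finset.mem_filter] at hP
      have h := mem_irreducibleFinset.1 hP.1
      exact ⟨h.1, h.2.2.1, hP.2, h.2.2.2⟩
    have hcard' : (d : ℝ) * N + 1 ≤ (Fintype.card F : ℝ) ^ d := by exact_mod_cast hcard
    have hQ2 : (2 : ℝ) ^ d ≤ (Fintype.card F : ℝ) ^ d := by
      gcongr
      exact_mod_cast (Fintype.one_lt_card : 1 < Fintype.card F)
    have h2d : (2 : ℝ) ≤ 2 ^ d := le_self_pow₀ one_le_two (by omega)
    set Q := (Fintype.card F : ℝ) ^ d with hQ
    have hd0 : (1 : ℝ) ≤ d := by exact_mod_cast hd1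
    have hQ1 : 0 < Q - 1 := by linarith
    have hN0 : (0 : ℝ) ≤ N := Nat.cast_nonneg _
    rw [mul_add]
    gcongr ?_ + ?_
    · split_ifs
      · rw [← div_eq_mul_inv, div_le_iff₀ hQ1, inv_mul_eq_div, le_div_iff₀ (by linarith)]
        linarith
      · simp
    · have hNQ : (N : ℝ) ≤ Q - 1 := by nlinarith
      have hQ2' : 0 < Q ^ 2 - 1 := by nlinarith
      rw [one_div_pow, ← div_eq_mul_inv, div_le_div_iff₀ hQ2' (by positivity)]
      nlinarith
  refine (Finset.sum_le_sum hterm).trans ?_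
  rw [Finset.sum_add_distrib]
  gcongr
  · exact sum_Ico_ite_dvd_inv_le hr n
  · refine le_trans ?_ (sum_geometric_two_le n)
    refine Finset.sum_le_sum_of_subset_of_nonneg (fun d hd => ?_) fun _ _ _ => by positivity
    exact Finset.mem_range.2 (Finset.mem_Ico.1 hd).2

open scoped Classical in
lemma sum_propertyFinset_le_prod (r n : ℕ) :
    ∑ g ∈ propertyFinset F r n, ((Fintype.card F : ℝ) ^ g.natDegree)⁻¹ ≤
      ∏ P ∈ irreducibleFinset F n,
        ∑ k ∈ (Finset.range n).filter (fun k => r ∣ P.natDegree ∨ r ∣ k),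
          ((Fintype.card F : ℝ) ^ P.natDegree)⁻¹ ^ k := by
  set S := irreducibleFinset F n with hS
  set κ : F[X] → S → ℕ := fun g P => (normalizedFactors g).count P.1 with hκ
  have hsub : ∀ g ∈ propertyFinset F r n, ∀ P ∈ normalizedFactors g, P ∈ S := by
    intro g hg P hP
    obtain ⟨hgm, hgd, hg0, -⟩ := mem_propertyFinset.1 hg
    obtain ⟨hPm, hPi⟩ := monic_irreducible_of_mem_normalizedFactors hP
    have hdvd := dvd_of_mem_normalizedFactors hP
    refine mem_irreducibleFinset.2
      ⟨hPm, (natDegree_le_of_dvd hdvd hgm.ne_zero).trans_lt hgd, hPi, fun h => hg0 ?_⟩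
    obtain ⟨u, hu⟩ := hdvd
    rw [hu, mul_coeff_zero, h, zero_mul]
  have hdeg : ∀ g ∈ propertyFinset F r n, g.natDegree = ∑ P : S, κ g P * P.1.natDegree := by
    intro g hg
    rw [natDegree_eq_sum_count_mul (mem_propertyFinset.1 hg).1,
      Finset.sum_coe_sort S fun P => (normalizedFactors g).count P * P.natDegree]
    refine Finset.sum_subset (fun P hP => hsub g hg P (Multiset.mem_toFinset.1 hP)) ?_
    intro P _ hP
    rw [Multiset.count_eq_zero.2 fun h => hP (Multiset.mem_toFinset.2 h), zero_mul]
  have hinj : Set.InjOn κ (propertyFinset F r n) := by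
    intro g hg g' hg' h
    rw [← prod_normalizedFactors_of_monic (mem_propertyFinset.1 hg).1,
      ← prod_normalizedFactors_of_monic (mem_propertyFinset.1 hg').1]
    congr 1
    ext P
    by_cases hP : P ∈ S
    · exact congrFun h ⟨P, hP⟩
    · rw [Multiset.count_eq_zero.2 fun h => hP (hsub g hg P h),
        Multiset.count_eq_zero.2 fun h => hP (hsub g' hg' P h)]
  rw [← Finset.prod_coe_sort, Finset.prod_univ_sum]
  have hterm : ∀ g ∈ propertyFinset F r n, ((Fintype.card F : ℝ) ^ g.natDegree)⁻¹ =
      ∏ P : S, ((Fintype.card F : ℝ) ^ P.1.natDegree)⁻¹ ^ κ g P := by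
    intro g hg
    rw [hdeg g hg, ← Finset.prod_pow_eq_pow_sum, ← Finset.prod_inv_distrib]
    refine Finset.prod_congr rfl fun P _ => ?_
    rw [inv_pow, ← pow_mul, mul_comm]
  rw [Finset.sum_congr rfl hterm, ← Finset.sum_image
    (f := fun k : S → ℕ => ∏ P : S, ((Fintype.card F : ℝ) ^ P.1.natDegree)⁻¹ ^ k P) hinj]
  refine Finset.sum_le_sum_of_subset_of_nonneg (fun k hk => ?_)
    fun _ _ _ => Finset.prod_nonneg fun _ _ => by positivity
  obtain ⟨g, hg, rfl⟩ := Finset.mem_image.1 hk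
  obtain ⟨-, hgd, -, hgr⟩ := mem_propertyFinset.1 hg
  refine Fintype.mem_piFinset.2 fun P => Finset.mem_filter.2 ⟨Finset.mem_range.2 ?_, ?_⟩
  · refine lt_of_le_of_lt ?_ hgd
    rw [hdeg g hg]
    refine le_trans (Nat.le_mul_of_pos_right _ ?_)
      (Finset.single_le_sum (f := fun P : S => κ g P * P.1.natDegree) (fun _ _ => Nat.zero_le _)
        (Finset.mem_univ P))
    exact (mem_irreducibleFinset.1 P.2).2.2.1.natDegree_pos
  · by_cases hP : P.1 ∈ normalizedFactors g
    · exact hgr _ hP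
    · exact Or.inr (by simp only [hκ, Multiset.count_eq_zero.2 hP, dvd_zero])

lemma sum_propertyFinset_le {r n : ℕ} (hr : 2 ≤ r) (hn : 1 ≤ n) :
    ∑ g ∈ propertyFinset F r n, ((Fintype.card F : ℝ) ^ g.natDegree)⁻¹ ≤
      Real.exp 3 * (n : ℝ) ^ (1 / (r : ℝ)) := by
  have hn0 : (0 : ℝ) < n := by exact_mod_cast hn
  have hr1 : (1 : ℝ) ≤ r := by exact_mod_cast (by omega : 1 ≤ r)
  refine (sum_propertyFinset_le_prod r n).trans ?_
  refine (Finset.prod_le_prod (fun _ _ => Finset.sum_nonneg fun _ _ => by positivity)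
    fun P hP => sum_filter_inv_pow_le_exp ?_ hr P.natDegree n).trans ?_
  · refine one_lt_pow₀ ?_ (mem_irreducibleFinset.1 hP).2.2.1.natDegree_pos.ne'
    exact_mod_cast (Fintype.one_lt_card : 1 < Fintype.card F)
  rw [← Real.exp_sum, Real.rpow_def_of_pos hn0, ← Real.exp_add, Real.exp_le_exp]
  refine (sum_irreducibleFinset_le hr n).trans ?_
  have : 1 / (r : ℝ) ≤ 1 := by rw [div_le_one (by linarith)]; exact hr1
  rw [add_div, div_eq_mul_one_div (Real.log n)]
  linarith

end Counting

end Polynomial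

/-- **Counting polynomials with property `P_r`, unrestricted case.**
The number of monic polynomials of degree `n` over a finite field with `q` elements, with
constant coefficient `a ≠ 0`, having property `P_r` (with `r ≥ 2`), is
`≤ C qⁿ⁻¹ n^{-1+1/r}`. -/
theorem stmt12 : ∃ C : ℝ, 0 < C ∧
    ∀ (F : Type) [Field F] [Fintype F], ∀ (q n r : ℕ) (a : F),
      Fintype.card F = q → 2 ≤ r → 1 ≤ n → a ≠ 0 →
      ({f : F[X] | f.Monic ∧ f.natDegree = n ∧ f.coeff 0 = a ∧
          HasPropertyP r f}.ncard : ℝ) ≤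
        C * (q : ℝ) ^ (n - 1) * (n : ℝ) ^ (-1 + 1 / (r : ℝ)) := by
  refine ⟨10 * Real.exp 3, by positivity, ?_⟩
  rintro F _ _ q n r a rfl hr hn ha
  set A := {f : F[X] | f.Monic ∧ f.natDegree = n ∧ f.coeff 0 = a ∧ HasPropertyP r f} with hA
  have hfin : A.Finite := (finite_setOf_monic_natDegree_eq F n).subset fun f hf => ⟨hf.1, hf.2.1⟩
  have hcount := natDegree_mul_card_le_sum_propertyFinset (r := r) (n := n) ha hfin.toFinset
    fun f hf => by simpa [hA] using hf
  rw [← Set.ncard_eq_toFinset_card A hfin] at hcount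
  have hn0 : (0 : ℝ) < n := by exact_mod_cast hn
  have hq0 : (Fintype.card F : ℝ) ≠ 0 := by exact_mod_cast Fintype.card_ne_zero
  have hreal : (n : ℝ) * A.ncard ≤ 10 * (Fintype.card F : ℝ) ^ (n - 1) *
      ∑ g ∈ propertyFinset F r n, ((Fintype.card F : ℝ) ^ g.natDegree)⁻¹ := by
    refine (show (n : ℝ) * A.ncard ≤ ((∑ g ∈ propertyFinset F r n,
      10 * Fintype.card F ^ (n - g.natDegree - 1) : ℕ) : ℝ) by exact_mod_cast hcount).trans_eq ?_
    push_cast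
    rw [Finset.mul_sum]
    refine Finset.sum_congr rfl fun g hg => ?_
    have hgn := (mem_propertyFinset.1 hg).2.1
    rw [mul_assoc, ← pow_sub₀ _ hq0 (by omega), Nat.sub_right_comm]
  rw [Real.rpow_add hn0, Real.rpow_neg_one]
  have hbound := hreal.trans (mul_le_mul_of_nonneg_left (sum_propertyFinset_le hr hn)
    (by positivity))
  rw [mul_comm, ← le_div_iff₀ hn0] at hbound
  refine hbound.trans_eq ?_
  rw [div_eq_mul_inv]
  ring
end

section
/- There is an absolute constant C > 0 with the following property. Let r ≥ 2 be an integer, let F be a finite field with q elements, let n ≥ 1, and let a ∈ {1, −1}. Let N be the total number of *-symmetric monic polynomials of degree n over F with constant coefficient a. Then the number of *-symmetric monic polynomials f of degree n over F with constant coefficient a such that every monic irreducible factor of f has degree divisible by r or multiplicity (as a factor of f) divisible by r, is at most C·N·n^{−1+1/r} if r is odd, and at most C·N·n^{−1+3/(2r)} if r is even. -/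
open Polynomial

/-- `f` is *-symmetric: `f(0) ≠ 0` and `f* = f`, where `f*(X) = Xⁿ f(1/X)/f(0)`. -/
def IsStarSymm {F : Type} [Field F] (f : F[X]) : Prop :=
  f.coeff 0 ≠ 0 ∧ f.reverse = Polynomial.C (f.coeff 0) * f

/-- The monic reciprocal `f* = Xⁿ f(1/X) / f(0)` of a polynomial. -/
noncomputable def starPoly {F : Type} [Field F] (f : F[X]) : F[X] :=
  C (f.coeff 0)⁻¹ * f.reverse

section Star

variable {F : Type} [Field F]

lemma starPoly_monic {f : F[X]} (h0 : f.coeff 0 ≠ 0) : (starPoly f).Monic := by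
  have : f.trailingCoeff = f.coeff 0 := by
    rw [trailingCoeff, natTrailingDegree_eq_zero.2 (Or.inr h0)]
  rw [starPoly, Monic, leadingCoeff_mul, leadingCoeff_C, reverse_leadingCoeff, this,
    inv_mul_cancel₀ h0]

lemma natDegree_starPoly {f : F[X]} (h0 : f.coeff 0 ≠ 0) :
    (starPoly f).natDegree = f.natDegree := by
  rw [starPoly, natDegree_C_mul (inv_ne_zero h0), reverse_natDegree,
    natTrailingDegree_eq_zero.2 (Or.inr h0), Nat.sub_zero]

lemma coeff_zero_starPoly {f : F[X]} (hf : f.Monic) : (starPoly f).coeff 0 = (f.coeff 0)⁻¹ := by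
  rw [starPoly, coeff_C_mul, coeff_zero_reverse, hf.leadingCoeff, mul_one]

lemma starPoly_mul (f g : F[X]) : starPoly (f * g) = starPoly f * starPoly g := by
  rw [starPoly, starPoly, starPoly, reverse_mul_of_domain, mul_coeff_zero, mul_inv, C_mul]
  ring

lemma starPoly_one : starPoly (1 : F[X]) = 1 := by
  have : reverse (1 : F[X]) = 1 := by simpa using reverse_C (1 : F)
  simp [starPoly, this]

lemma starPoly_pow (f : F[X]) (k : ℕ) : starPoly (f ^ k) = starPoly f ^ k := by
  induction k with
  | zero => simpa using starPoly_one
  | succ k ih => rw [pow_succ, starPoly_mul, ih, pow_succ]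

lemma reverse_reverse_of_coeff_zero_ne {f : F[X]} (h0 : f.coeff 0 ≠ 0) :
    f.reverse.reverse = f := by
  have hd : f.reverse.natDegree = f.natDegree := by
    rw [reverse_natDegree, natTrailingDegree_eq_zero.2 (Or.inr h0), Nat.sub_zero]
  rw [reverse, hd, reverse, reflect_reflect]

lemma starPoly_starPoly {f : F[X]} (hf : f.Monic) (h0 : f.coeff 0 ≠ 0) :
    starPoly (starPoly f) = f := by
  rw [starPoly, coeff_zero_starPoly hf, starPoly, reverse_mul_of_domain, reverse_C,
    reverse_reverse_of_coeff_zero_ne h0, inv_inv, ← mul_assoc, ← C_mul, mul_inv_cancel₀ h0, C_1,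
    one_mul]

lemma starPoly_dvd {f g : F[X]} (h : f ∣ g) : starPoly f ∣ starPoly g := by
  obtain ⟨k, rfl⟩ := h
  exact ⟨_, starPoly_mul _ _⟩

lemma irreducible_starPoly {f : F[X]} (hf : f.Monic) (h0 : f.coeff 0 ≠ 0) (hi : Irreducible f) :
    Irreducible (starPoly f) := by
  have h0' : (starPoly f).coeff 0 ≠ 0 := by
    rw [coeff_zero_starPoly hf]; exact inv_ne_zero h0
  rw [(starPoly_monic h0).irreducible_iff_natDegree]
  refine ⟨fun h => ?_, fun a b ha hb hab => ?_⟩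
  · have := hi.natDegree_pos
    rw [← natDegree_starPoly h0, h] at this
    simp at this
  · have hc : a.coeff 0 * b.coeff 0 ≠ 0 := by rw [← mul_coeff_zero, hab]; exact h0'
    have ha0 := left_ne_zero_of_mul hc
    have hb0 := right_ne_zero_of_mul hc
    have := (hf.irreducible_iff_natDegree.1 hi).2 _ _ (starPoly_monic ha0) (starPoly_monic hb0)
      (by rw [← starPoly_mul, hab, starPoly_starPoly hf h0])
    rwa [natDegree_starPoly ha0, natDegree_starPoly hb0] at this

lemma eval_one_reverse (f : F[X]) : f.reverse.eval 1 = f.eval 1 := by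
  let := invertibleOne (α := F)
  simpa [eval₂_id] using eval₂_reverse_mul_pow (RingHom.id F) 1 f

/-- A root of `f` inverts to a root of `starPoly f`. -/
lemma aeval_inv_starPoly {K : Type} [Field K] [Algebra F K] {f : F[X]} {x : K} (hx : x ≠ 0)
    (h : aeval x f = 0) : aeval x⁻¹ (starPoly f) = 0 := by
  let := invertibleOfNonzero hx
  have := (eval₂_reverse_eq_zero_iff (algebraMap F K) x f).2 h
  rw [invOf_eq_inv] at this
  rw [starPoly, map_mul, aeval_def x⁻¹ f.reverse, this, mul_zero]

end Star

section SelfDual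

variable {F : Type} [Field F]

lemma not_root_of_sq_eq_one {g : F[X]} (hi : Irreducible g)
    (h1 : g.eval 1 ≠ 0) (hm1 : g.eval (-1) ≠ 0) : ¬ g ∣ X ^ 2 - 1 := by
  intro h
  have key : ∀ c : F, g.eval c ≠ 0 → ¬ g ∣ X - C c := by
    intro c hc hd
    have := hi.associated_of_dvd (irreducible_X_sub_C c) hd
    exact hc (dvd_iff_isRoot.1 this.symm.dvd)
  have e : (X ^ 2 - 1 : F[X]) = (X - C 1) * (X - C (-1)) := by
    simp only [C_neg, C_1]; ring
  rw [e] at h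
  exact (hi.prime.dvd_or_dvd h).elim (key 1 h1) (key (-1) hm1)

/-- A self-reciprocal irreducible polynomial without roots `±1` has even degree `2d` and divides
`X ^ (q ^ d + 1) - 1`. -/
lemma selfDual_irreducible [Fintype F] {g : F[X]} (hi : Irreducible g)
    (h0 : g.coeff 0 ≠ 0) (h1 : g.eval 1 ≠ 0) (hm1 : g.eval (-1) ≠ 0) (hs : starPoly g = g) :
    ∃ d, g.natDegree = 2 * d ∧ g ∣ X ^ (Fintype.card F ^ d + 1) - 1 := by
  have : Fact (Irreducible g) := ⟨hi⟩
  have : Module.Finite F (AdjoinRoot g) := (AdjoinRoot.powerBasis hi.ne_zero).finite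
  have : Finite (AdjoinRoot g) := Module.finite_of_finite F
  have hfr : Module.finrank F (AdjoinRoot g) = g.natDegree := by
    rw [(AdjoinRoot.powerBasis hi.ne_zero).finrank, AdjoinRoot.powerBasis_dim]
  set α : AdjoinRoot g := AdjoinRoot.root g with hα
  have hroot : aeval α g = 0 := by
    rw [AdjoinRoot.aeval_eq, AdjoinRoot.mk_self]
  have hα0 : α ≠ 0 := by
    intro h
    rw [h, ← coeff_zero_eq_aeval_zero'] at hroot
    exact h0 ((map_eq_zero _).1 hroot)
  have hdvd : ∀ p : F[X], aeval α p = 0 → g ∣ p := fun p hp => by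
    rwa [AdjoinRoot.aeval_eq, AdjoinRoot.mk_eq_zero] at hp
  have hinv : aeval α⁻¹ g = 0 := by
    have := aeval_inv_starPoly hα0 hroot
    rwa [hs] at this
  let σ₀ : AdjoinRoot g →ₐ[F] AdjoinRoot g :=
    AdjoinRoot.liftAlgHom g (Algebra.ofId F _) α⁻¹ hinv
  have hσ₀ : σ₀ α = α⁻¹ := AdjoinRoot.liftAlgHom_root _ _ _ _
  let σ : AdjoinRoot g ≃ₐ[F] AdjoinRoot g :=
    AlgEquiv.ofBijective σ₀ (Algebra.IsAlgebraic.algHom_bijective σ₀)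
  have hσ : σ α = α⁻¹ := hσ₀
  obtain ⟨⟨i, hi'⟩, hφ⟩ :=
    (FiniteField.bijective_frobeniusAlgEquivOfAlgebraic_pow F (AdjoinRoot g)).2 σ
  simp only at hφ
  set φ := FiniteField.frobeniusAlgEquivOfAlgebraic F (AdjoinRoot g)
  have hσ2 : σ ^ 2 = 1 := by
    apply AlgEquiv.coe_toAlgHom_injective
    apply AdjoinRoot.algHom_ext
    change σ (σ α) = α
    rw [hσ, map_inv₀, hσ, inv_inv]
  have hpow : α ^ (Fintype.card F ^ i) = α⁻¹ := by
    rw [← hσ, ← hφ, AlgEquiv.coe_pow, FiniteField.coe_frobeniusAlgEquivOfAlgebraic_iterate]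
  have hord : g.natDegree ∣ 2 * i := by
    rw [← hfr, ← FiniteField.orderOf_frobeniusAlgEquivOfAlgebraic F (AdjoinRoot g)]
    apply orderOf_dvd_of_pow_eq_one
    rw [mul_comm, pow_mul]
    change (φ ^ i) ^ 2 = 1
    rw [hφ, hσ2]
  have hii : i ≠ 0 := by
    rintro rfl
    rw [pow_zero, pow_one] at hpow
    apply not_root_of_sq_eq_one hi h1 hm1
    apply hdvd
    rw [map_sub, map_pow, aeval_X, map_one, pow_two]
    nth_rw 2 [hpow]
    rw [mul_inv_cancel₀ hα0, sub_self]
  rw [hfr] at hi'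
  have h2 : g.natDegree = 2 * i := by
    obtain ⟨c, hc⟩ := hord
    have : c = 1 := by
      rcases c with _ | _ | c
      · omega
      · rfl
      · nlinarith
    rw [hc, this, mul_one]
  refine ⟨i, h2, hdvd _ ?_⟩
  rw [map_sub, map_pow, aeval_X, map_one, pow_succ, hpow, inv_mul_cancel₀ hα0, sub_self]

/-- Distinct monic irreducible divisors of a polynomial have total degree at most its degree. -/
lemma sum_natDegree_le_of_dvd {P : F[X]} (hP : P ≠ 0) (s : Finset F[X])
    (hm : ∀ g ∈ s, g.Monic) (hi : ∀ g ∈ s, Irreducible g) (hd : ∀ g ∈ s, g ∣ P) :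
    ∑ g ∈ s, g.natDegree ≤ P.natDegree := by
  rw [← natDegree_prod_of_monic _ _ hm]
  refine natDegree_le_of_dvd (Finset.prod_dvd_of_coprime ?_ hd) hP
  intro a ha b hb hab
  refine (hi a ha).coprime_iff_not_dvd.2 fun h => hab ?_
  exact eq_of_monic_of_associated (hm a ha) (hm b hb) ((hi a ha).associated_of_dvd (hi b hb) h)

end SelfDual

section Family

variable {F : Type} [Field F]

lemma finiteMultiplicity_of_irreducible {p f : F[X]} (hp : Irreducible p) (hf : f ≠ 0) :
    FiniteMultiplicity p f :=
  FiniteMultiplicity.of_not_isUnit hp.not_isUnit hf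

lemma hasPropertyP_iff {r : ℕ} {f : F[X]} (hf : f ≠ 0) :
    HasPropertyP r f ↔
      ∀ p : F[X], p.Monic → Irreducible p → r ∣ p.natDegree ∨ r ∣ multiplicity p f := by
  constructor
  · intro h p hm hi
    by_cases hd : p ∣ f
    · refine (h p hm hi hd).imp_right ?_
      rintro ⟨k, hk, hk', hr⟩
      rwa [multiplicity_eq_of_dvd_of_not_dvd hk hk']
    · right
      rw [multiplicity_eq_zero.2 hd]
      exact dvd_zero r
  · intro h p hm hi hd
    refine (h p hm hi).imp_right fun hr => ⟨_, pow_multiplicity_dvd p f, ?_, hr⟩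
    exact (finiteMultiplicity_of_irreducible hi hf).not_pow_dvd_of_multiplicity_lt
      (Nat.lt_succ_self _)

/-- Monic irreducible polynomials whose roots are different from `0` and `±1`. -/
structure IsGeneric (g : F[X]) : Prop where
  monic : g.Monic
  irreducible : Irreducible g
  coeff_zero_ne : g.coeff 0 ≠ 0
  eval_one_ne : g.eval 1 ≠ 0
  eval_neg_one_ne : g.eval (-1) ≠ 0

/-- *-symmetric monic polynomials of degree `2 * l` with property `P_r` and without roots `±1`. -/
def symmFamily (F : Type) [Field F] (r l : ℕ) : Set F[X] :=
  {h | h.Monic ∧ h.natDegree = 2 * l ∧ h.coeff 0 ≠ 0 ∧ starPoly h = h ∧ h.eval 1 ≠ 0 ∧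
    h.eval (-1) ≠ 0 ∧ HasPropertyP r h}

open Classical in
/-- The *-symmetric polynomial attached to an irreducible polynomial. -/
noncomputable def symmetrization (g : F[X]) : F[X] :=
  if starPoly g = g then g else g * starPoly g

/-- Half of the degree of the symmetrization. -/
noncomputable def halfDegree (g : F[X]) : ℕ := (symmetrization g).natDegree / 2

/-- Multiplicities of `g` in a polynomial with property `P_r` are divisible by `multStep r g`. -/
def multStep (r : ℕ) (g : F[X]) : ℕ := if r ∣ g.natDegree then 1 else r

lemma symmetrization_monic {g : F[X]} (hg : IsGeneric g) : (symmetrization g).Monic := by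
  unfold symmetrization
  split_ifs
  · exact hg.monic
  · exact hg.monic.mul (starPoly_monic hg.coeff_zero_ne)

lemma starPoly_symmetrization {g : F[X]} (hg : IsGeneric g) :
    starPoly (symmetrization g) = symmetrization g := by
  unfold symmetrization
  split_ifs with h
  · exact h
  · rw [starPoly_mul, starPoly_starPoly hg.monic hg.coeff_zero_ne, mul_comm]

lemma dvd_symmetrization (g : F[X]) : g ∣ symmetrization g := by
  unfold symmetrization
  split_ifs
  · exact dvd_rfl
  · exact dvd_mul_right _ _

lemma two_mul_halfDegree [Fintype F] {g : F[X]} (hg : IsGeneric g) :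
    2 * halfDegree g = (symmetrization g).natDegree := by
  apply Nat.mul_div_cancel'
  unfold symmetrization
  split_ifs with h
  · obtain ⟨d, hd, -⟩ := selfDual_irreducible hg.irreducible hg.coeff_zero_ne hg.eval_one_ne
      hg.eval_neg_one_ne h
    exact ⟨d, hd⟩
  · rw [hg.monic.natDegree_mul (starPoly_monic hg.coeff_zero_ne),
      natDegree_starPoly hg.coeff_zero_ne]
    exact ⟨_, (two_mul _).symm⟩

lemma halfDegree_of_starPoly_ne {g : F[X]} (hg : IsGeneric g) (h : starPoly g ≠ g) :
    halfDegree g = g.natDegree := by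
  rw [halfDegree, symmetrization, if_neg h,
    hg.monic.natDegree_mul (starPoly_monic hg.coeff_zero_ne), natDegree_starPoly hg.coeff_zero_ne]
  omega

lemma halfDegree_pos [Fintype F] {g : F[X]} (hg : IsGeneric g) : 0 < halfDegree g := by
  have h := two_mul_halfDegree hg
  have h2 : g.natDegree ≤ (symmetrization g).natDegree :=
    natDegree_le_of_dvd (dvd_symmetrization g) (symmetrization_monic hg).ne_zero
  have := hg.irreducible.natDegree_pos
  omega

lemma symmetrization_pow_dvd {g h : F[X]} (hg : IsGeneric g) (hs : starPoly h = h) {k : ℕ}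
    (hk : g ^ k ∣ h) : symmetrization g ^ k ∣ h := by
  unfold symmetrization
  split_ifs with hgs
  · exact hk
  · rw [mul_pow]
    refine IsCoprime.mul_dvd (IsCoprime.pow ?_) hk ?_
    · refine hg.irreducible.coprime_iff_not_dvd.2 fun hd => hgs ?_
      exact (eq_of_monic_of_associated hg.monic (starPoly_monic hg.coeff_zero_ne)
        (hg.irreducible.associated_of_dvd
          (irreducible_starPoly hg.monic hg.coeff_zero_ne hg.irreducible) hd)).symm
    · rw [← starPoly_pow, ← hs]
      exact starPoly_dvd hk

lemma natDegree_of_dvd_symmetrization {g p : F[X]} (hg : IsGeneric g) (hp : Irreducible p)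
    (h : p ∣ symmetrization g) : p.natDegree = g.natDegree := by
  have h1 : p ∣ g → p.natDegree = g.natDegree := fun hd =>
    natDegree_eq_of_degree_eq (degree_eq_degree_of_associated
      (hp.associated_of_dvd hg.irreducible hd))
  unfold symmetrization at h
  split_ifs at h
  · exact h1 h
  · refine (hp.prime.dvd_or_dvd h).elim h1 fun hd => ?_
    rw [← natDegree_starPoly hg.coeff_zero_ne]
    exact natDegree_eq_of_degree_eq (degree_eq_degree_of_associated
      (hp.associated_of_dvd (irreducible_starPoly hg.monic hg.coeff_zero_ne hg.irreducible) hd))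

lemma symmFamily_quotient [Fintype F] {r l k : ℕ} {g h h' : F[X]} (hg : IsGeneric g)
    (hh : h ∈ symmFamily F r l) (hk : multStep r g ∣ k) (e : symmetrization g ^ k * h' = h) :
    k * halfDegree g ≤ l ∧ h' ∈ symmFamily F r (l - k * halfDegree g) := by
  obtain ⟨hm, hdeg, h0, hs, h1, hm1, hP⟩ := hh
  have hπ := (symmetrization_monic hg).pow k
  have hm' : h'.Monic := hπ.of_mul_monic_left (e ▸ hm)
  have hd : 2 * (k * halfDegree g) + h'.natDegree = 2 * l := by
    rw [← hdeg, ← e, hπ.natDegree_mul hm', natDegree_pow, ← two_mul_halfDegree hg]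
    ring
  have h0' : h'.coeff 0 ≠ 0 := by
    rw [← e, mul_coeff_zero] at h0
    exact right_ne_zero_of_mul h0
  refine ⟨by omega, hm', by omega, h0', ?_, ?_, ?_, ?_⟩
  · apply mul_left_cancel₀ hπ.ne_zero
    have := hs
    rw [← e, starPoly_mul, starPoly_pow, starPoly_symmetrization hg] at this
    exact this
  · rw [← e, eval_mul] at h1
    exact right_ne_zero_of_mul h1
  · rw [← e, eval_mul] at hm1
    exact right_ne_zero_of_mul hm1
  · rw [hasPropertyP_iff hm'.ne_zero]
    intro p hpm hpi
    by_cases hr : r ∣ p.natDegree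
    · exact Or.inl hr
    right
    have hrh := ((hasPropertyP_iff hm.ne_zero).1 hP p hpm hpi).resolve_left hr
    rw [← e, multiplicity_mul hpi.prime
      (finiteMultiplicity_of_irreducible hpi (e ▸ hm.ne_zero)),
      (finiteMultiplicity_of_irreducible hpi (symmetrization_monic hg).ne_zero).multiplicity_pow
        hpi.prime] at hrh
    refine (Nat.dvd_add_right ?_).1 hrh
    by_cases hps : p ∣ symmetrization g
    · rw [natDegree_of_dvd_symmetrization hg hpi hps] at hr
      rw [multStep, if_neg hr] at hk
      exact hk.mul_right _
    · rw [multiplicity_eq_zero.2 hps, mul_zero]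
      exact dvd_zero r

lemma finite_setOf_natDegree_le (F : Type) [Field F] [Finite F] (n : ℕ) :
    {f : F[X] | f.natDegree ≤ n}.Finite := by
  have : Finite (degreeLT F (n + 1)) := Finite.of_equiv _ (degreeLTEquiv F (n + 1)).toEquiv.symm
  refine (Set.toFinite (degreeLT F (n + 1) : Set F[X])).subset fun f hf => ?_
  rw [SetLike.mem_coe, mem_degreeLT]
  exact degree_le_natDegree.trans_lt (by exact_mod_cast Nat.lt_succ_of_le hf)

lemma finite_symmFamily (F : Type) [Field F] [Finite F] (r l : ℕ) : (symmFamily F r l).Finite :=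
  (finite_setOf_natDegree_le F (2 * l)).subset fun _ hf => hf.2.1.le

lemma ncard_dvd_le [Fintype F] {r l k : ℕ} {g : F[X]} (hg : IsGeneric g)
    (hk : multStep r g ∣ k) :
    {h ∈ symmFamily F r l | g ^ k ∣ h}.ncard ≤
      (symmFamily F r (l - k * halfDegree g)).ncard := by
  refine (Set.ncard_le_ncard (t := (fun x => symmetrization g ^ k * x) ''
    symmFamily F r (l - k * halfDegree g)) ?_ ((finite_symmFamily F r _).image _)).trans
    (Set.ncard_image_le (finite_symmFamily F r _))
  rintro h ⟨hh, hd⟩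
  obtain ⟨h', rfl⟩ := symmetrization_pow_dvd hg hh.2.2.2.1 hd
  exact ⟨h', (symmFamily_quotient hg hh hk rfl).2, rfl⟩

lemma mult_mul_halfDegree_le [Fintype F] {r l k : ℕ} {g h : F[X]} (hg : IsGeneric g)
    (hh : h ∈ symmFamily F r l) (hk : g ^ k ∣ h) : k * halfDegree g ≤ l := by
  have := natDegree_le_of_dvd (symmetrization_pow_dvd hg hh.2.2.2.1 hk) hh.1.ne_zero
  rw [natDegree_pow, ← two_mul_halfDegree hg, hh.2.1] at this
  nlinarith

lemma isGeneric_of_dvd {g h : F[X]} (hm : g.Monic) (hi : Irreducible g)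
    (h0 : h.coeff 0 ≠ 0) (h1 : h.eval 1 ≠ 0) (hm1 : h.eval (-1) ≠ 0) (hd : g ∣ h) :
    IsGeneric g := by
  obtain ⟨k, rfl⟩ := hd
  rw [mul_coeff_zero] at h0
  rw [eval_mul] at h1 hm1
  exact ⟨hm, hi, left_ne_zero_of_mul h0, left_ne_zero_of_mul h1, left_ne_zero_of_mul hm1⟩

lemma sum_natDegree_mul_multiplicity {h : F[X]} (hm : h.Monic) (G : Finset F[X])
    (hG : ∀ g ∈ G, g.Monic ∧ Irreducible g)
    (hall : ∀ g : F[X], g.Monic → Irreducible g → g ∣ h → g ∈ G) :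
    ∑ g ∈ G, g.natDegree * multiplicity g h = h.natDegree := by
  classical
  open UniqueFactorizationMonoid in
  have hmem := fun p => Polynomial.mem_normalizedFactors_iff (p := p) hm.ne_zero
  have hprod := leadingCoeff_mul_prod_normalizedFactors h
  rw [hm.leadingCoeff, C_1, one_mul] at hprod
  conv_rhs => rw [← hprod, natDegree_multiset_prod_of_monic _ fun p hp => ((hmem p).1 hp).2.1,
    Finset.sum_multiset_map_count]
  symm
  apply Finset.sum_subset_zero_on_sdiff
  · intro p hp
    rw [Multiset.mem_toFinset, hmem] at hp
    exact hall p hp.2.1 hp.1 hp.2.2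
  · intro p hp
    rw [Finset.mem_sdiff, Multiset.mem_toFinset, hmem] at hp
    have := hG p hp.1
    rw [multiplicity_eq_zero.2 fun hd => hp.2 ⟨this.2, this.1, hd⟩, mul_zero]
  · intro p hp
    rw [Multiset.mem_toFinset, hmem] at hp
    rw [multiplicity_eq_count_normalizedFactors hp.1 hm.ne_zero, hp.2.1.normalize_eq_self,
      smul_eq_mul, mul_comm]

end Family

section Recurrence

variable {F : Type} [Field F]

lemma multStep_pos {r : ℕ} (hr : 0 < r) (g : F[X]) : 0 < multStep r g := by
  unfold multStep
  split_ifs <;> omega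

open Classical in
lemma multiplicity_eq_multStep_mul_card [Fintype F] {r l : ℕ} (hr : 0 < r) {g h : F[X]}
    (hg : IsGeneric g) (hh : h ∈ symmFamily F r l) :
    multiplicity g h = multStep r g *
      ((Finset.Icc 1 l).filter fun k =>
        multStep r g * halfDegree g ∣ k ∧ g ^ (k / halfDegree g) ∣ h).card := by
  have hs := multStep_pos hr g
  have hD := halfDegree_pos hg
  have hdvd : multStep r g ∣ multiplicity g h := by
    have := (hasPropertyP_iff hh.1.ne_zero).1 hh.2.2.2.2.2.2 g hg.monic hg.irreducible
    unfold multStep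
    split_ifs with h1
    · exact one_dvd _
    · exact this.resolve_left h1
  obtain ⟨c, hc⟩ := hdvd
  have hpow : ∀ k, g ^ k ∣ h ↔ k ≤ multiplicity g h := fun k =>
    (finiteMultiplicity_of_irreducible hg.irreducible hh.1.ne_zero).pow_dvd_iff_le_multiplicity
  have hset : ((Finset.Icc 1 l).filter fun k =>
        multStep r g * halfDegree g ∣ k ∧ g ^ (k / halfDegree g) ∣ h) =
      (Finset.Icc 1 c).image fun j => multStep r g * halfDegree g * j := by
    have hquot : ∀ j, multStep r g * halfDegree g * j / halfDegree g = multStep r g * j := by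
      intro j
      rw [mul_right_comm, Nat.mul_div_cancel _ hD]
    ext k
    simp only [Finset.mem_filter, Finset.mem_Icc, Finset.mem_image]
    constructor
    · rintro ⟨⟨hk1, hkl⟩, ⟨j, rfl⟩, hk⟩
      rw [hquot, hpow, hc] at hk
      exact ⟨j, ⟨Nat.pos_of_ne_zero (by rintro rfl; simp at hk1),
        Nat.le_of_mul_le_mul_left hk hs⟩, rfl⟩
    · rintro ⟨j, ⟨hj1, hjc⟩, rfl⟩
      have hjd : g ^ (multStep r g * j) ∣ h := by
        rw [hpow, hc]
        exact Nat.mul_le_mul_left _ hjc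
      refine ⟨⟨Nat.mul_pos (Nat.mul_pos hs hD) hj1, ?_⟩, dvd_mul_right _ _, by rwa [hquot]⟩
      rw [mul_right_comm]
      exact mult_mul_halfDegree_le hg hh hjd
  rw [hset, Finset.card_image_of_injective _
    (fun a b hab => Nat.eq_of_mul_eq_mul_left (Nat.mul_pos hs hD) hab), Nat.card_Icc,
    Nat.add_sub_cancel, hc]

lemma finite_generic (F : Type) [Field F] [Finite F] (n : ℕ) :
    {g : F[X] | IsGeneric g ∧ g.natDegree ≤ n}.Finite :=
  (finite_setOf_natDegree_le F n).subset fun _ h => h.2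

/-- The generic irreducible polynomials of degree at most `n`. -/
noncomputable def genericFinset (F : Type) [Field F] [Finite F] (n : ℕ) : Finset F[X] :=
  (finite_generic F n).toFinset

lemma mem_genericFinset [Finite F] {n : ℕ} {g : F[X]} :
    g ∈ genericFinset F n ↔ IsGeneric g ∧ g.natDegree ≤ n := by
  simp [genericFinset]

open Classical in
/-- The `k`-th coefficient of twice the logarithmic derivative of the generating function. -/
noncomputable def logCoeff (F : Type) [Field F] [Finite F] (r n k : ℕ) : ℕ :=
  ∑ g ∈ (genericFinset F n).filter (fun g => multStep r g * halfDegree g ∣ k),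
    g.natDegree * multStep r g

lemma symmFamily_recurrence [Fintype F] {r : ℕ} (hr : 0 < r) (l : ℕ) :
    2 * l * (symmFamily F r l).ncard ≤
      ∑ k ∈ Finset.Icc 1 l, logCoeff F r (2 * l) k * (symmFamily F r (l - k)).ncard := by
  classical
  set H := (finite_symmFamily F r l).toFinset with hH
  have hmem : ∀ h, h ∈ H ↔ h ∈ symmFamily F r l := fun h => Set.Finite.mem_toFinset _
  have hG : ∀ g ∈ genericFinset F (2 * l), IsGeneric g := fun g hg => (mem_genericFinset.1 hg).1
  have hdeg : ∀ h ∈ H, 2 * l = ∑ g ∈ genericFinset F (2 * l), ∑ k ∈ Finset.Icc 1 l,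
      if multStep r g * halfDegree g ∣ k ∧ g ^ (k / halfDegree g) ∣ h then
        g.natDegree * multStep r g else 0 := by
    intro h hh
    rw [hmem] at hh
    refine hh.2.1.symm.trans ((sum_natDegree_mul_multiplicity hh.1 (genericFinset F (2 * l))
      (fun g hg => ⟨(hG g hg).monic, (hG g hg).irreducible⟩) ?_).symm.trans ?_)
    rotate_left
    · refine Finset.sum_congr rfl fun g hg => ?_
      rw [← Finset.sum_filter, Finset.sum_const, smul_eq_mul,
        multiplicity_eq_multStep_mul_card hr (hG g hg) hh]
      ring
    · intro g hm hi hd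
      refine mem_genericFinset.2
        ⟨isGeneric_of_dvd hm hi hh.2.2.1 hh.2.2.2.2.1 hh.2.2.2.2.2.1 hd, ?_⟩
      rw [← hh.2.1]
      exact natDegree_le_of_dvd hd hh.1.ne_zero
  have hcard : (symmFamily F r l).ncard = H.card := Set.ncard_eq_toFinset_card _ _
  calc 2 * l * (symmFamily F r l).ncard = ∑ h ∈ H, 2 * l := by
        rw [hcard, Finset.sum_const, smul_eq_mul, mul_comm]
    _ = ∑ k ∈ Finset.Icc 1 l, ∑ g ∈ genericFinset F (2 * l), ∑ h ∈ H,
          if multStep r g * halfDegree g ∣ k ∧ g ^ (k / halfDegree g) ∣ h then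
            g.natDegree * multStep r g else 0 := by
        rw [Finset.sum_congr rfl hdeg, Finset.sum_comm, Finset.sum_comm (s := Finset.Icc 1 l)]
        exact Finset.sum_congr rfl fun g _ => Finset.sum_comm
    _ ≤ _ := by
        refine Finset.sum_le_sum fun k _ => ?_
        rw [logCoeff, Finset.sum_mul, Finset.sum_filter]
        refine Finset.sum_le_sum fun g hg => ?_
        have hD := halfDegree_pos (hG g hg)
        split_ifs with hk
        · obtain ⟨j, rfl⟩ := hk
          have hquot : multStep r g * halfDegree g * j / halfDegree g = multStep r g * j := by
            rw [mul_right_comm, Nat.mul_div_cancel _ hD]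
          simp only [dvd_mul_right, true_and]
          rw [← Finset.sum_filter, Finset.sum_const, smul_eq_mul, mul_comm]
          refine Nat.mul_le_mul_left _ ?_
          have := ncard_dvd_le (l := l) (hG g hg) (dvd_mul_right (multStep r g) j)
          rw [mul_right_comm (multStep r g) j] at this
          refine le_trans (le_of_eq ?_) this
          rw [← Set.ncard_coe_finset, hquot]
          congr 1
          ext h
          simp [hmem]
        · simp [hk]

end Recurrence

section CoeffBound

lemma sum_Icc_pow_le {q : ℕ} (hq : 2 ≤ q) (M : ℕ) : ∑ d ∈ Finset.Icc 1 M, q ^ d ≤ 2 * q ^ M := by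
  induction M with
  | zero => simp
  | succ M ih =>
    rw [Finset.sum_Icc_succ_top (by omega), pow_succ]
    nlinarith [Nat.mul_le_mul_left (q ^ M) hq]

lemma sum_divisors_le {f : ℕ → ℕ} {k : ℕ} (hk : 1 ≤ k) :
    ∑ d ∈ k.divisors, f d ≤ f k + ∑ d ∈ Finset.Icc 1 (k / 2), f d := by
  rw [← Nat.cons_self_properDivisors (by omega), Finset.sum_cons]
  refine Nat.add_le_add_left (Finset.sum_le_sum_of_subset fun d hd => ?_) _
  rw [Nat.mem_properDivisors] at hd
  obtain ⟨⟨c, rfl⟩, hlt⟩ := hd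
  have hd0 : 1 ≤ d := Nat.pos_of_ne_zero (by rintro rfl; simp at hlt)
  have hc : 2 ≤ c := by
    by_contra hc
    interval_cases c <;> omega
  rw [Finset.mem_Icc]
  exact ⟨hd0, by rw [Nat.le_div_iff_mul_le (by norm_num)]; exact Nat.mul_le_mul_left d hc⟩

variable {F : Type} [Field F]

lemma sum_selfDual_le [Fintype F] (d : ℕ) (s : Finset F[X])
    (hs : ∀ g ∈ s, IsGeneric g ∧ starPoly g = g ∧ halfDegree g = d) :
    ∑ g ∈ s, g.natDegree ≤ Fintype.card F ^ d + 1 := by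
  have hdeg : (X ^ (Fintype.card F ^ d + 1) - 1 : F[X]).natDegree = Fintype.card F ^ d + 1 := by
    simpa using natDegree_X_pow_sub_C (n := Fintype.card F ^ d + 1) (r := (1 : F))
  conv_rhs => rw [← hdeg]
  refine sum_natDegree_le_of_dvd ?_ s (fun g hg => (hs g hg).1.monic)
    (fun g hg => (hs g hg).1.irreducible) fun g hg => ?_
  · intro h
    rw [h, natDegree_zero] at hdeg
    omega
  · obtain ⟨hg, hst, hd⟩ := hs g hg
    obtain ⟨e, he, hdvd⟩ := selfDual_irreducible hg.irreducible hg.coeff_zero_ne hg.eval_one_ne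
      hg.eval_neg_one_ne hst
    have : e = d := by
      rw [← hd, halfDegree, symmetrization, if_pos hst, he]
      omega
    rwa [this] at hdvd

lemma sum_not_selfDual_le [Fintype F] {d : ℕ} (hd0 : 1 ≤ d) (s : Finset F[X])
    (hs : ∀ g ∈ s, IsGeneric g ∧ starPoly g ≠ g ∧ halfDegree g = d) :
    ∑ g ∈ s, g.natDegree ≤ Fintype.card F ^ d := by
  have hq := Fintype.one_lt_card (α := F)
  conv_rhs => rw [← FiniteField.X_pow_card_pow_sub_X_natDegree_eq F (by omega : d ≠ 0) hq]
  refine sum_natDegree_le_of_dvd (FiniteField.X_pow_card_pow_sub_X_ne_zero F (by omega) hq) s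
    (fun g hg => (hs g hg).1.monic) (fun g hg => (hs g hg).1.irreducible) fun g hg => ?_
  obtain ⟨hg, hst, hd⟩ := hs g hg
  rw [← Nat.card_eq_fintype_card, ← hg.irreducible.natDegree_dvd_iff_dvd_X_pow_card_pow_sub_X,
    ← hd, halfDegree_of_starPoly_ne hg hst]

open Classical in
lemma natDegree_mul_multStep_le [Fintype F] {r k : ℕ} {g : F[X]} (hg : IsGeneric g)
    (hk : multStep r g * halfDegree g ∣ k) :
    g.natDegree * multStep r g ≤
      (if starPoly g = g ∧ r ∣ 2 * k then g.natDegree else 0) +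
      (if starPoly g ≠ g ∧ r ∣ k then g.natDegree else 0) +
      (if r * halfDegree g ∣ k then r * g.natDegree else 0) := by
  by_cases hr : r ∣ g.natDegree
  · have hD : halfDegree g ∣ k := (dvd_mul_left _ _).trans hk
    rw [multStep, if_pos hr, mul_one, add_assoc]
    by_cases hst : starPoly g = g
    · rw [if_pos (c := starPoly g = g ∧ r ∣ 2 * k)]
      · omega
      · refine ⟨hst, hr.trans ?_⟩
        have := two_mul_halfDegree hg
        rw [symmetrization, if_pos hst] at this
        rw [← this]
        exact mul_dvd_mul_left 2 hD
    · rw [if_pos (c := starPoly g ≠ g ∧ r ∣ k)]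
      · omega
      · refine ⟨hst, hr.trans ?_⟩
        rwa [halfDegree_of_starPoly_ne hg hst] at hD
  · rw [multStep, if_neg hr] at *
    rw [if_pos hk, mul_comm]
    omega

lemma logCoeff_le [Fintype F] {q r n k : ℕ} (hq : Fintype.card F = q) (hk : 1 ≤ k) (hr : 0 < r) :
    logCoeff F r n k ≤ (if r ∣ 2 * k then q ^ k + 5 * q ^ (k / 2) else 0) +
      (if r ∣ k then q ^ k + 2 * q ^ (k / 2) + 6 * r * q ^ (k / r) else 0) := by
  classical
  have hq2 : 2 ≤ q := hq ▸ Fintype.one_lt_card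
  have hG : ∀ g ∈ genericFinset F n, IsGeneric g := fun g hg => (mem_genericFinset.1 hg).1
  set A : ℕ → ℕ := fun d =>
    ∑ g ∈ genericFinset F n with starPoly g = g ∧ halfDegree g = d, g.natDegree with hA
  set B : ℕ → ℕ := fun d =>
    ∑ g ∈ genericFinset F n with starPoly g ≠ g ∧ halfDegree g = d, g.natDegree with hB
  have hAle : ∀ d, A d ≤ q ^ d + 1 := fun d => by
    rw [← hq]
    refine sum_selfDual_le d _ fun g hg => ?_
    rw [Finset.mem_filter] at hg
    exact ⟨hG g hg.1, hg.2⟩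
  have hBle : ∀ d, 1 ≤ d → B d ≤ q ^ d := fun d hd => by
    rw [← hq]
    refine sum_not_selfDual_le hd _ fun g hg => ?_
    rw [Finset.mem_filter] at hg
    exact ⟨hG g hg.1, hg.2⟩
  have hfib : logCoeff F r n k ≤ ∑ d ∈ k.divisors, ((if r ∣ 2 * k then A d else 0) +
      (if r ∣ k then B d else 0) + (if r * d ∣ k then r * (A d + B d) else 0)) := by
    rw [logCoeff, ← Finset.sum_fiberwise_of_maps_to (t := k.divisors) (g := halfDegree)]
    · refine Finset.sum_le_sum fun d _ => ?_
      calc _ ≤ ∑ g ∈ genericFinset F n with halfDegree g = d,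
            ((if starPoly g = g ∧ r ∣ 2 * k then g.natDegree else 0) +
            (if starPoly g ≠ g ∧ r ∣ k then g.natDegree else 0) +
            (if r * d ∣ k then r * g.natDegree else 0)) := by
            refine (Finset.sum_le_sum fun g hg => ?_).trans
              (Finset.sum_le_sum_of_subset fun g hg => ?_)
            · rw [Finset.mem_filter, Finset.mem_filter] at hg
              have := natDegree_mul_multStep_le (hG g hg.1.1) hg.1.2
              rw [hg.2] at this
              convert this
            · rw [Finset.mem_filter, Finset.mem_filter] at hg
              exact Finset.mem_filter.2 ⟨hg.1.1, hg.2⟩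
        _ = _ := by
            rw [Finset.sum_add_distrib, Finset.sum_add_distrib]
            have hAB : ∑ g ∈ genericFinset F n with halfDegree g = d, g.natDegree = A d + B d := by
              rw [← Finset.sum_filter_add_sum_filter_not _ (fun g => starPoly g = g),
                Finset.filter_filter, Finset.filter_filter]
              simp only [hA, hB, and_comm, ne_eq]
            congr 1
            · congr 1
              · split_ifs with h
                · simp only [h, and_true, hA]
                  rw [← Finset.sum_filter, Finset.filter_filter]
                  simp only [and_comm]
                · simp [h]
              · split_ifs with h
                · simp only [h, and_true, hB]
                  rw [← Finset.sum_filter, Finset.filter_filter]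
                  simp only [and_comm]
                · simp [h]
            · split_ifs with h
              · rw [← Finset.mul_sum, hAB]
              · simp
    · intro g hg
      rw [Finset.mem_filter] at hg
      exact Nat.mem_divisors.2 ⟨(dvd_mul_left _ _).trans hg.2, by omega⟩
  refine hfib.trans ?_
  rw [Finset.sum_add_distrib, Finset.sum_add_distrib]
  have hpos : 1 ≤ q ^ (k / 2) := Nat.one_le_pow _ _ (by omega)
  have h1 : ∑ d ∈ k.divisors, A d ≤ q ^ k + 5 * q ^ (k / 2) := by
    refine (Finset.sum_le_sum fun d _ => hAle d).trans ((sum_divisors_le hk).trans ?_)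
    have : ∑ d ∈ Finset.Icc 1 (k / 2), (q ^ d + 1) ≤ ∑ d ∈ Finset.Icc 1 (k / 2), 2 * q ^ d :=
      Finset.sum_le_sum fun d _ => by
        have : 1 ≤ q ^ d := Nat.one_le_pow _ _ (by omega)
        omega
    rw [← Finset.mul_sum] at this
    have := sum_Icc_pow_le hq2 (k / 2)
    omega
  have h2 : ∑ d ∈ k.divisors, B d ≤ q ^ k + 2 * q ^ (k / 2) := by
    refine (Finset.sum_le_sum fun d hd => hBle d (Nat.pos_of_mem_divisors hd)).trans
      ((sum_divisors_le hk).trans ?_)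
    have := sum_Icc_pow_le hq2 (k / 2)
    omega
  have h3 : ∑ d ∈ k.divisors, (if r * d ∣ k then r * (A d + B d) else 0) ≤
      if r ∣ k then 6 * r * q ^ (k / r) else 0 := by
    split_ifs with hrk
    · rw [← Finset.sum_filter, ← Finset.mul_sum]
      have hsub : (k.divisors.filter fun d => r * d ∣ k) ⊆ Finset.Icc 1 (k / r) := by
        intro d hd
        rw [Finset.mem_filter] at hd
        rw [Finset.mem_Icc, Nat.le_div_iff_mul_le hr, mul_comm]
        exact ⟨Nat.pos_of_mem_divisors hd.1, Nat.le_of_dvd hk hd.2⟩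
      have : ∑ d ∈ k.divisors with r * d ∣ k, (A d + B d) ≤ 3 * (2 * q ^ (k / r)) := by
        refine (Finset.sum_le_sum_of_subset hsub).trans
          (le_trans (Finset.sum_le_sum (g := fun d => 3 * q ^ d) fun d hd => ?_) ?_)
        · have h1 := hAle d
          have h2 := hBle d (Finset.mem_Icc.1 hd).1
          have : 1 ≤ q ^ d := Nat.one_le_pow _ _ (by omega)
          omega
        · rw [← Finset.mul_sum]
          exact Nat.mul_le_mul_left _ (sum_Icc_pow_le hq2 _)
      calc _ ≤ r * (3 * (2 * q ^ (k / r))) := Nat.mul_le_mul_left _ this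
        _ = _ := by ring
    · rw [Finset.sum_eq_zero fun d _ => if_neg fun h => hrk ((dvd_mul_right _ _).trans h)]
  have h1' : ∑ d ∈ k.divisors, (if r ∣ 2 * k then A d else 0) ≤
      if r ∣ 2 * k then q ^ k + 5 * q ^ (k / 2) else 0 := by
    split_ifs
    · exact h1
    · simp
  have h2' : ∑ d ∈ k.divisors, (if r ∣ k then B d else 0) ≤
      if r ∣ k then q ^ k + 2 * q ^ (k / 2) else 0 := by
    split_ifs
    · exact h2
    · simp
  split_ifs at * <;> omega

end CoeffBound

section Analysis

lemma sum_convolution_le {f : ℕ → ℕ → ℝ} (hf : ∀ k i, 0 ≤ f k i) (M : ℕ) :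
    ∑ j ∈ Finset.range (M + 1), ∑ k ∈ Finset.Icc 1 j, f k (j - k) ≤
      ∑ k ∈ Finset.Icc 1 M, ∑ i ∈ Finset.range (M + 1), f k i := by
  rw [Finset.sum_comm' (t' := Finset.Icc 1 M) (s' := fun k => Finset.Icc k M)
    (by intro j k; simp only [Finset.mem_range, Finset.mem_Icc]; omega)]
  refine Finset.sum_le_sum fun k _ => ?_
  rw [← Finset.sum_image (f := fun i => f k i) (g := fun j => j - k) (s := Finset.Icc k M)]
  · refine Finset.sum_le_sum_of_subset_of_nonneg (fun i hi => ?_) fun i _ _ => hf k i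
    obtain ⟨j, hj, rfl⟩ := Finset.mem_image.1 hi
    rw [Finset.mem_Icc] at hj
    rw [Finset.mem_range]
    omega
  · intro a ha b hb hab
    simp only [Finset.coe_Icc, Set.mem_Icc] at ha hb
    simp only at hab
    omega

/-- A Grönwall-type inequality: partial sums of a sequence whose generating function has its
logarithmic derivative dominated coefficientwise by `β`. -/
lemma sum_le_exp_of_recurrence {x β : ℕ → ℝ} (hx : ∀ j, 0 ≤ x j) (hβ : ∀ k, 0 ≤ β k) (M : ℕ)
    (h : ∀ m, m * x m ≤ ∑ k ∈ Finset.Icc 1 m, β k * x (m - k)) :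
    ∑ j ∈ Finset.range (M + 1), x j ≤ x 0 * Real.exp (∑ k ∈ Finset.Icc 1 M, β k / k) := by
  set Φ : ℝ → ℝ := fun t => ∑ j ∈ Finset.range (M + 1), x j * t ^ j with hΦ
  set Ψ : ℝ → ℝ := fun t => ∑ k ∈ Finset.Icc 1 M, β k / k * t ^ k with hΨ
  set Φ' : ℝ → ℝ := fun t => ∑ j ∈ Finset.range (M + 1), x j * (j * t ^ (j - 1)) with hΦ'
  set Ψ' : ℝ → ℝ := fun t => ∑ k ∈ Finset.Icc 1 M, β k / k * (k * t ^ (k - 1)) with hΨ'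
  have dΦ : ∀ t, HasDerivAt Φ (Φ' t) t := fun t =>
    HasDerivAt.fun_sum fun j _ => (hasDerivAt_pow j t).const_mul _
  have dΨ : ∀ t, HasDerivAt Ψ (Ψ' t) t := fun t =>
    HasDerivAt.fun_sum fun j _ => (hasDerivAt_pow j t).const_mul _
  have dG : ∀ t, HasDerivAt (fun t => Φ t * Real.exp (-Ψ t))
      (Φ' t * Real.exp (-Ψ t) + Φ t * (Real.exp (-Ψ t) * -Ψ' t)) t := fun t =>
    (dΦ t).mul (dΨ t).neg.exp
  have key : ∀ t, 0 < t → Φ' t ≤ Ψ' t * Φ t := by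
    intro t ht
    have e1 : t * Φ' t = ∑ j ∈ Finset.range (M + 1), j * x j * t ^ j := by
      rw [hΦ', Finset.mul_sum]
      refine Finset.sum_congr rfl fun j _ => ?_
      rcases j with _ | j
      · simp
      · rw [Nat.add_sub_cancel, pow_succ]; ring
    have e2 : t * Ψ' t = ∑ k ∈ Finset.Icc 1 M, β k * t ^ k := by
      rw [hΨ', Finset.mul_sum]
      refine Finset.sum_congr rfl fun k hk => ?_
      obtain ⟨k, rfl⟩ : ∃ i, k = i + 1 := ⟨k - 1, by rw [Finset.mem_Icc] at hk; omega⟩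
      have : ((k + 1 : ℕ) : ℝ) ≠ 0 := by positivity
      rw [Nat.add_sub_cancel, pow_succ]
      field_simp
    have : t * Φ' t ≤ t * Ψ' t * Φ t := by
      rw [e1, e2, hΦ, Finset.sum_mul_sum]
      refine le_trans (Finset.sum_le_sum fun j _ => ?_) (sum_convolution_le
        (f := fun k i => β k * t ^ k * (x i * t ^ i)) (fun k i => by
          have := hx i
          have := hβ k
          positivity) M)
      calc j * x j * t ^ j ≤ (∑ k ∈ Finset.Icc 1 j, β k * x (j - k)) * t ^ j :=
            mul_le_mul_of_nonneg_right (h j) (by positivity)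
        _ = _ := by
          rw [Finset.sum_mul]
          refine Finset.sum_congr rfl fun k hk => ?_
          have : t ^ j = t ^ k * t ^ (j - k) := by
            rw [← pow_add, Nat.add_sub_cancel' (Finset.mem_Icc.1 hk).2]
          rw [this]
          ring
    rw [mul_assoc] at this
    exact le_of_mul_le_mul_left this ht
  have anti : AntitoneOn (fun t => Φ t * Real.exp (-Ψ t)) (Set.Icc 0 1) := by
    refine antitoneOn_of_deriv_nonpos (convex_Icc 0 1)
      (fun t _ => (dG t).continuousAt.continuousWithinAt)
      (fun t _ => (dG t).differentiableAt.differentiableWithinAt) fun t ht => ?_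
    rw [interior_Icc] at ht
    rw [(dG t).deriv]
    have := key t ht.1
    have := Real.exp_pos (-Ψ t)
    nlinarith
  have h01 := anti (Set.left_mem_Icc.2 zero_le_one) (Set.right_mem_Icc.2 zero_le_one) zero_le_one
  have hΨ0 : Ψ 0 = 0 := Finset.sum_eq_zero fun k hk => by
    rw [zero_pow (by rw [Finset.mem_Icc] at hk; omega), mul_zero]
  have hΦ0 : Φ 0 = x 0 := by
    simp only [hΦ]
    rw [Finset.sum_range_succ']
    simp
  have hΦ1 : Φ 1 = ∑ j ∈ Finset.range (M + 1), x j := by simp [hΦ]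
  have hΨ1 : Ψ 1 = ∑ k ∈ Finset.Icc 1 M, β k / k := by simp [hΨ]
  simp only [hΨ0, hΦ0, hΦ1, hΨ1, neg_zero, Real.exp_zero, mul_one, Real.exp_neg] at h01
  rwa [← div_eq_mul_inv, div_le_iff₀ (Real.exp_pos _)] at h01

lemma mul_le_exp_of_recurrence {x β : ℕ → ℝ} (hx : ∀ j, 0 ≤ x j) (hβ : ∀ k, 0 ≤ β k) {B : ℝ}
    (hB : ∀ k, 1 ≤ k → β k ≤ B)
    (h : ∀ m, m * x m ≤ ∑ k ∈ Finset.Icc 1 m, β k * x (m - k)) (m : ℕ) :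
    m * x m ≤ B * (x 0 * Real.exp (∑ k ∈ Finset.Icc 1 m, β k / k)) := by
  have hB0 : 0 ≤ B := (hβ 1).trans (hB 1 le_rfl)
  refine (h m).trans (le_trans ?_ (mul_le_mul_of_nonneg_left
    (sum_le_exp_of_recurrence hx hβ m h) hB0))
  rw [Finset.mul_sum]
  calc ∑ k ∈ Finset.Icc 1 m, β k * x (m - k) ≤ ∑ k ∈ Finset.Icc 1 m, B * x (m - k) :=
        Finset.sum_le_sum fun k hk =>
          mul_le_mul_of_nonneg_right (hB k (Finset.mem_Icc.1 hk).1) (hx _)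
    _ = ∑ i ∈ (Finset.Icc 1 m).image (fun k => m - k), B * x i := by
        rw [Finset.sum_image]
        intro a ha b hb hab
        simp only [Finset.coe_Icc, Set.mem_Icc] at ha hb hab
        omega
    _ ≤ _ := by
        refine Finset.sum_le_sum_of_subset_of_nonneg (fun i hi => ?_)
          fun i _ _ => mul_nonneg hB0 (hx i)
        obtain ⟨k, hk, rfl⟩ := Finset.mem_image.1 hi
        rw [Finset.mem_Icc] at hk
        rw [Finset.mem_range]
        omega

lemma sum_Icc_ite_dvd {s : ℕ} (hs : 0 < s) (m : ℕ) (f : ℕ → ℝ) :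
    ∑ k ∈ Finset.Icc 1 m, (if s ∣ k then f k else 0) =
      ∑ j ∈ Finset.Icc 1 (m / s), f (s * j) := by
  rw [← Finset.sum_filter]
  symm
  refine Finset.sum_nbij (fun j => s * j) ?_ ?_ ?_ fun _ _ => rfl
  · intro j hj
    rw [Finset.mem_Icc, Nat.le_div_iff_mul_le hs] at hj
    rw [Finset.mem_filter, Finset.mem_Icc, mul_comm]
    exact ⟨⟨Nat.mul_pos hj.1 hs, hj.2⟩, dvd_mul_left _ _⟩
  · exact fun a _ b _ hab => Nat.eq_of_mul_eq_mul_left hs hab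
  · intro k hk
    rw [Finset.mem_coe, Finset.mem_filter, Finset.mem_Icc] at hk
    obtain ⟨⟨hk1, hkm⟩, j, rfl⟩ := hk
    refine ⟨j, ?_, rfl⟩
    rw [Finset.mem_coe, Finset.mem_Icc, Nat.le_div_iff_mul_le hs, mul_comm]
    exact ⟨Nat.pos_of_ne_zero (by rintro rfl; simp at hk1), hkm⟩

lemma sum_dvd_inv_le {s m : ℕ} (hs : 0 < s) :
    ∑ k ∈ Finset.Icc 1 m, (if s ∣ k then 1 / (k : ℝ) else 0) ≤ 1 / s * (1 + Real.log m) := by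
  rw [sum_Icc_ite_dvd hs m]
  have hharm := harmonic_le_one_add_log (m / s)
  have hlog : Real.log ((m / s : ℕ) : ℝ) ≤ Real.log m := by
    rcases Nat.eq_zero_or_pos (m / s) with h0 | h0
    · rw [h0, Nat.cast_zero, Real.log_zero]
      exact Real.log_natCast_nonneg m
    · exact Real.log_le_log (by exact_mod_cast h0) (by exact_mod_cast Nat.div_le_self m s)
  have e : ∑ j ∈ Finset.Icc 1 (m / s), 1 / ((s * j : ℕ) : ℝ) =
      1 / s * ((harmonic (m / s) : ℚ) : ℝ) := by
    rw [harmonic_eq_sum_Icc]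
    push_cast
    rw [Finset.mul_sum]
    refine Finset.sum_congr rfl fun j _ => ?_
    rw [one_div, mul_inv, one_div]
  rw [e]
  exact mul_le_mul_of_nonneg_left (hharm.trans (by linarith)) (by positivity)

lemma sum_inv_mul_succ_le (m : ℕ) :
    ∑ k ∈ Finset.Icc 1 m, 1 / ((k : ℝ) + 1) / k ≤ 1 := by
  have : ∑ k ∈ Finset.Icc 1 m, 1 / ((k : ℝ) + 1) / k = 1 - 1 / (m + 1) := by
    induction m with
    | zero => simp
    | succ m ih =>
      rw [Finset.sum_Icc_succ_top (by omega), ih]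
      push_cast
      field_simp
      ring
  rw [this]
  have : (0 : ℝ) ≤ 1 / (m + 1) := by positivity
  linarith

lemma sum_dvd_div_sq_le {r : ℕ} (hr : 2 ≤ r) (m : ℕ) :
    ∑ k ∈ Finset.Icc 1 m, (if r ∣ k then (r : ℝ) / k / k else 0) ≤ 1 := by
  rw [sum_Icc_ite_dvd (by omega) m]
  calc _ ≤ ∑ j ∈ Finset.Icc 1 (m / r), 1 / ((j : ℝ) + 1) / j := by
        refine Finset.sum_le_sum fun j hj => ?_
        have hj1 : (1 : ℝ) ≤ j := by exact_mod_cast (Finset.mem_Icc.1 hj).1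
        have hr2 : (2 : ℝ) ≤ r := by exact_mod_cast hr
        push_cast
        have e : (r : ℝ) / (r * j) / (r * j) = 1 / (r * j) / j := by field_simp
        rw [e]
        gcongr
        nlinarith
    _ ≤ 1 := sum_inv_mul_succ_le _

lemma succ_mul_pow_half_le {q : ℕ} (hq : 2 ≤ q) (k : ℕ) :
    (k + 1) * q ^ (k / 2) ≤ 2 * q ^ k := by
  have e : q ^ k = q ^ (k / 2) * q ^ (k - k / 2) := by
    rw [← pow_add, Nat.add_sub_cancel' (Nat.div_le_self k 2)]
  have h1 : k - k / 2 < 2 ^ (k - k / 2) := Nat.lt_two_pow_self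
  have h2 : 2 ^ (k - k / 2) ≤ q ^ (k - k / 2) := Nat.pow_le_pow_left hq _
  rw [e, mul_comm, mul_left_comm]
  exact Nat.mul_le_mul_left _ (by omega)

lemma mul_pow_div_le {q r k : ℕ} (hq : 2 ≤ q) (hr : 2 ≤ r) (hk : 1 ≤ k) (h : r ∣ k) :
    k * q ^ (k / r) ≤ q ^ k := by
  obtain ⟨j, rfl⟩ := h
  have hj : 1 ≤ j := Nat.pos_of_ne_zero (by rintro rfl; simp at hk)
  rw [Nat.mul_div_cancel_left _ (by omega)]
  obtain ⟨a, rfl⟩ : ∃ a, r = a + 2 := ⟨r - 2, by omega⟩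
  obtain ⟨b, rfl⟩ : ∃ b, j = b + 1 := ⟨j - 1, by omega⟩
  have h1 : a + 1 < 2 ^ (a + 1) := Nat.lt_two_pow_self
  have h2 : b < 2 ^ b := Nat.lt_two_pow_self
  have h3 : (a + 2) * (b + 1) ≤ 2 ^ (a + 1) * 2 ^ b := Nat.mul_le_mul h1 h2
  have h4 : 2 ^ (a + 1) * 2 ^ b ≤ q ^ ((a + 1) * (b + 1)) := by
    rw [← pow_add]
    exact (Nat.pow_le_pow_left hq _).trans (Nat.pow_le_pow_right (by omega) (by nlinarith))
  have e : q ^ ((a + 2) * (b + 1)) = q ^ ((a + 1) * (b + 1)) * q ^ (b + 1) := by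
    rw [← pow_add]; ring_nf
  rw [e]
  exact Nat.mul_le_mul_right _ (h3.trans h4)

end Analysis

section FamilyBound

/-- Dominates the normalized logarithmic derivative coefficients. -/
noncomputable def boundCoeff (r k : ℕ) : ℝ :=
  ((if r ∣ 2 * k then 1 else 0) + (if r ∣ k then 1 else 0) + 14 / (k + 1) +
    6 * (if r ∣ k then (r : ℝ) / k else 0)) / 2

lemma boundCoeff_nonneg (r k : ℕ) : 0 ≤ boundCoeff r k := by
  unfold boundCoeff
  split_ifs <;> positivity

lemma boundCoeff_le {r k : ℕ} (hk : 1 ≤ k) : boundCoeff r k ≤ 15 / 2 := by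
  have hk' : (1 : ℝ) ≤ k := by exact_mod_cast hk
  have h1 : (14 : ℝ) / (k + 1) ≤ 7 := by
    rw [div_le_iff₀ (by positivity)]
    linarith
  have h2 : (if r ∣ k then (r : ℝ) / k else 0) ≤ 1 := by
    split_ifs with h
    · rw [div_le_one (by positivity)]
      exact_mod_cast Nat.le_of_dvd hk h
    · exact zero_le_one
  have h3 : (if r ∣ 2 * k then (1 : ℝ) else 0) ≤ 1 := by split_ifs <;> norm_num
  have h4 : (if r ∣ k then (1 : ℝ) else 0) ≤ 1 := by split_ifs <;> norm_num
  unfold boundCoeff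
  linarith

/-- The sum of the exponents contributed by both kinds of irreducible factors. -/
lemma sum_boundCoeff_le {r m : ℕ} (hr : 2 ≤ r) {δ : ℝ} (hδ1 : δ ≤ 1)
    (hodd : Odd r → δ = 1 / r) (heven : Even r → δ = 3 / (2 * r)) :
    ∑ k ∈ Finset.Icc 1 m, boundCoeff r k / k ≤ δ * Real.log m + 11 := by
  have hr0 : (0 : ℝ) < r := by positivity
  have hsplit : ∑ k ∈ Finset.Icc 1 m, boundCoeff r k / k =
      ((∑ k ∈ Finset.Icc 1 m, (if r ∣ 2 * k then 1 / (k : ℝ) else 0)) +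
        (∑ k ∈ Finset.Icc 1 m, (if r ∣ k then 1 / (k : ℝ) else 0)) +
        14 * (∑ k ∈ Finset.Icc 1 m, 1 / ((k : ℝ) + 1) / k) +
        6 * (∑ k ∈ Finset.Icc 1 m, (if r ∣ k then (r : ℝ) / k / k else 0))) / 2 := by
    rw [Finset.mul_sum, Finset.mul_sum, ← Finset.sum_add_distrib, ← Finset.sum_add_distrib,
      ← Finset.sum_add_distrib, Finset.sum_div]
    refine Finset.sum_congr rfl fun k _ => ?_
    unfold boundCoeff
    split_ifs <;> ring
  have h2 := sum_dvd_inv_le (s := r) (m := m) (by omega)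
  have h3 := sum_inv_mul_succ_le m
  have h4 := sum_dvd_div_sq_le hr m
  have h12 : (∑ k ∈ Finset.Icc 1 m, (if r ∣ 2 * k then 1 / (k : ℝ) else 0)) +
      (∑ k ∈ Finset.Icc 1 m, (if r ∣ k then 1 / (k : ℝ) else 0)) ≤
        2 * δ * (1 + Real.log m) := by
    rcases Nat.even_or_odd r with he | ho
    · obtain ⟨s, hs⟩ := he.two_dvd
      have h1 := sum_dvd_inv_le (s := s) (m := m) (by omega)
      have hdvd : ∀ k, r ∣ 2 * k ↔ s ∣ k := fun k => by
        rw [hs]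
        exact Nat.mul_dvd_mul_iff_left (by norm_num)
      simp only [hdvd]
      have hrs : (r : ℝ) = 2 * s := by exact_mod_cast hs
      have e : 2 * δ = 1 / s + 1 / r := by
        have : (s : ℝ) ≠ 0 := by
          intro h
          rw [hrs, h] at hr0
          simp at hr0
        rw [heven he, hrs]
        field_simp
        norm_num
      rw [e, add_mul]
      exact add_le_add h1 h2
    · have hdvd : ∀ k, r ∣ 2 * k ↔ r ∣ k := fun k =>
        Nat.Coprime.dvd_mul_left (Nat.coprime_two_right.2 ho)
      simp only [hdvd]
      rw [hodd ho, mul_assoc]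
      linarith
  rw [hsplit]
  nlinarith

variable {F : Type} [Field F]

lemma logCoeff_le_boundCoeff [Fintype F] {q r n k : ℕ} (hq : Fintype.card F = q) (hk : 1 ≤ k)
    (hr : 2 ≤ r) : (logCoeff F r n k : ℝ) ≤ 2 * boundCoeff r k * q ^ k := by
  have hq2 : 2 ≤ q := hq ▸ Fintype.one_lt_card
  have h : (logCoeff F r n k : ℝ) ≤
      (if r ∣ 2 * k then (q : ℝ) ^ k + 5 * q ^ (k / 2) else 0) +
      (if r ∣ k then (q : ℝ) ^ k + 2 * q ^ (k / 2) + 6 * r * q ^ (k / r) else 0) := by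
    exact_mod_cast logCoeff_le hq hk (by omega)
  have hk0 : (0 : ℝ) < k := by exact_mod_cast hk
  have h1 : (q : ℝ) ^ (k / 2) ≤ 2 / (k + 1) * q ^ k := by
    rw [div_mul_eq_mul_div, le_div_iff₀ (by positivity), mul_comm]
    exact_mod_cast succ_mul_pow_half_le hq2 k
  have h2 : r ∣ k → (r : ℝ) * q ^ (k / r) ≤ r / k * q ^ k := fun hd => by
    rw [div_mul_eq_mul_div, le_div_iff₀ hk0, mul_assoc]
    refine mul_le_mul_of_nonneg_left ?_ (by positivity)
    rw [mul_comm]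
    exact_mod_cast mul_pow_div_le hq2 hr hk hd
  have h3 : (0 : ℝ) ≤ 2 / (k + 1) * q ^ k := by positivity
  have e : (14 : ℝ) / (k + 1) * q ^ k = 7 * (2 / (k + 1) * q ^ k) := by ring
  refine h.trans ?_
  unfold boundCoeff
  split_ifs with ha hb hb
  · have := h2 hb
    linarith
  · linarith
  · exact absurd (hb.mul_left 2) ha
  · linarith

lemma ncard_symmFamily_zero_le (r : ℕ) : (symmFamily F r 0).ncard ≤ 1 := by
  have : symmFamily F r 0 ⊆ {1} := fun h hh => by
    rw [Set.mem_singleton_iff]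
    exact hh.1.natDegree_eq_zero.1 hh.2.1
  exact (Set.ncard_le_ncard this).trans (Set.ncard_singleton _).le

lemma ncard_symmFamily_le [Fintype F] {q r : ℕ} (hq : Fintype.card F = q) (hr : 2 ≤ r) {δ : ℝ}
    (hδ0 : 0 ≤ δ) (hδ1 : δ ≤ 1)
    (hodd : Odd r → δ = 1 / r) (heven : Even r → δ = 3 / (2 * r)) (l : ℕ) :
    ((l : ℝ) + 1) * (symmFamily F r l).ncard ≤
      15 * Real.exp 11 * q ^ l * ((l : ℝ) + 1) ^ δ := by
  have hq0 : (0 : ℝ) < q := by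
    have : 0 < q := hq ▸ Fintype.card_pos
    exact_mod_cast this
  set x : ℕ → ℝ := fun l => (symmFamily F r l).ncard / (q : ℝ) ^ l with hx
  have hx0 : x 0 ≤ 1 := by
    simp only [hx, pow_zero, div_one]
    exact_mod_cast ncard_symmFamily_zero_le r
  have hxn : ∀ j, 0 ≤ x j := fun j => by positivity
  have hncard : ∀ l, ((symmFamily F r l).ncard : ℝ) = x l * q ^ l := fun l => by
    simp only [hx]
    rw [div_mul_cancel₀ _ (by positivity)]
  have hrec : ∀ m : ℕ, m * x m ≤ ∑ k ∈ Finset.Icc 1 m, boundCoeff r k * x (m - k) := by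
    intro m
    have h1 : (2 * m * (symmFamily F r m).ncard : ℝ) ≤ ∑ k ∈ Finset.Icc 1 m,
        (logCoeff F r (2 * m) k : ℝ) * (symmFamily F r (m - k)).ncard := by
      exact_mod_cast symmFamily_recurrence (F := F) (r := r) (by omega) m
    have h2 : ∑ k ∈ Finset.Icc 1 m,
        (logCoeff F r (2 * m) k : ℝ) * (symmFamily F r (m - k)).ncard ≤
        ∑ k ∈ Finset.Icc 1 m, 2 * (q : ℝ) ^ m * (boundCoeff r k * x (m - k)) := by
      refine Finset.sum_le_sum fun k hk => ?_
      rw [Finset.mem_Icc] at hk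
      refine (mul_le_mul_of_nonneg_right (logCoeff_le_boundCoeff hq hk.1 hr)
        (Nat.cast_nonneg _)).trans (le_of_eq ?_)
      have : (q : ℝ) ^ m = q ^ k * q ^ (m - k) := by
        rw [← pow_add, Nat.add_sub_cancel' hk.2]
      rw [hncard, this]
      ring
    rw [← Finset.mul_sum] at h2
    have h3 := h1.trans h2
    rw [hncard] at h3
    have hp : (0 : ℝ) < 2 * q ^ m := by positivity
    refine le_of_mul_le_mul_left ?_ hp
    linarith
  have hx_le : (l + 1) * x l ≤ 15 * Real.exp 11 * ((l : ℝ) + 1) ^ δ := by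
    have hpow1 : (1 : ℝ) ≤ ((l : ℝ) + 1) ^ δ :=
      Real.one_le_rpow (by linarith [Nat.cast_nonneg (α := ℝ) l]) hδ0
    rcases Nat.eq_zero_or_pos l with rfl | hl
    · have : (1 : ℝ) ≤ Real.exp 11 := Real.one_le_exp (by norm_num)
      push_cast at *
      nlinarith
    · have hl0 : (0 : ℝ) < l := by exact_mod_cast hl
      have hl1 : (1 : ℝ) ≤ l := by exact_mod_cast hl
      have h1 := mul_le_exp_of_recurrence hxn (boundCoeff_nonneg r)
        (fun k hk => boundCoeff_le hk) hrec l
      have h2 : Real.exp (∑ k ∈ Finset.Icc 1 l, boundCoeff r k / k) ≤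
          Real.exp 11 * ((l : ℝ) + 1) ^ δ := by
        refine (Real.exp_le_exp.2 (sum_boundCoeff_le hr hδ1 hodd heven)).trans ?_
        rw [Real.exp_add, mul_comm, mul_comm δ, ← Real.rpow_def_of_pos hl0]
        gcongr
        linarith
      have h3 : x 0 * Real.exp (∑ k ∈ Finset.Icc 1 l, boundCoeff r k / k) ≤
          Real.exp 11 * ((l : ℝ) + 1) ^ δ :=
        (mul_le_of_le_one_left (Real.exp_pos _).le hx0).trans h2
      have := hxn l
      nlinarith
  rw [hncard]
  have hp : (0 : ℝ) < q ^ l := by positivity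
  calc (l + 1) * (x l * q ^ l) = (l + 1) * x l * q ^ l := by ring
    _ ≤ 15 * Real.exp 11 * ((l : ℝ) + 1) ^ δ * q ^ l := by gcongr
    _ = _ := by ring

end FamilyBound

section Decomposition

variable {F : Type} [Field F]

lemma starPoly_X_sub_C {c : F} (hc : c ^ 2 = 1) : starPoly (X - C c) = X - C c := by
  have hc0 : c ≠ 0 := by rintro rfl; simp at hc
  have h0 : (X - C c : F[X]).coeff 0 = -c := by simp
  have h0' : (X - C c : F[X]).coeff 0 ≠ 0 := by rw [h0]; exact neg_ne_zero.2 hc0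
  rw [(starPoly_monic h0').eq_X_add_C (by rw [natDegree_starPoly h0', natDegree_X_sub_C]),
    coeff_zero_starPoly (monic_X_sub_C c), h0, inv_neg, inv_eq_of_mul_eq_one_left (b := c), C_neg,
    sub_eq_add_neg]
  rw [← pow_two, hc]

lemma starPoly_right_of_mul {g h : F[X]} (hg : starPoly g = g) (hg0 : g ≠ 0)
    (hgh : starPoly (g * h) = g * h) : starPoly h = h := by
  rw [starPoly_mul, hg] at hgh
  exact mul_left_cancel₀ hg0 hgh

/-- A self-reciprocal polynomial without roots `±1` has even degree. -/
lemma even_natDegree_of_starPoly_eq [Fintype F] {h : F[X]} (hm : h.Monic) (h0 : h.coeff 0 ≠ 0)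
    (h1 : h.eval 1 ≠ 0) (hm1 : h.eval (-1) ≠ 0) (hs : starPoly h = h) : Even h.natDegree := by
  induction hn : h.natDegree using Nat.strong_induction_on generalizing h with
  | _ n ih =>
    rcases Nat.eq_zero_or_pos n with rfl | hpos
    · exact Even.zero
    · obtain ⟨g, hgm, hgi, hgd⟩ := exists_monic_irreducible_factor h
        (not_isUnit_of_natDegree_pos h (hn ▸ hpos))
      have hg : IsGeneric g := isGeneric_of_dvd hgm hgi h0 h1 hm1 hgd
      obtain ⟨k, hk⟩ := symmetrization_pow_dvd hg hs (k := 1) (by rwa [pow_one])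
      rw [pow_one] at hk
      have hsm := symmetrization_monic hg
      have hkm : k.Monic := hsm.of_mul_monic_left (hk ▸ hm)
      have hdeg : n = (symmetrization g).natDegree + k.natDegree := by
        rw [← hn, hk, hsm.natDegree_mul hkm]
      have h2 := two_mul_halfDegree hg
      have h3 := halfDegree_pos hg
      have hkd : k ∣ h := ⟨_, by rw [hk, mul_comm]⟩
      have := ih k.natDegree (by omega) hkm
        (fun e => h0 (by rw [hk, mul_coeff_zero, e, mul_zero]))
        (fun e => h1 (by rw [hk, eval_mul, e, mul_zero]))
        (fun e => hm1 (by rw [hk, eval_mul, e, mul_zero]))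
        (starPoly_right_of_mul (starPoly_symmetrization hg) hsm.ne_zero (hk ▸ hs)) rfl
      rw [hdeg, ← h2]
      exact (even_two_mul _).add this

lemma not_dvd_X_sub_C_pow {p h : F[X]} {c : F} (hp : Irreducible p) (hd : p ∣ h)
    (hc : h.eval c ≠ 0) (i : ℕ) : ¬ p ∣ (X - C c) ^ i := by
  intro hpi
  have := hp.associated_of_dvd (irreducible_X_sub_C c) (hp.prime.dvd_of_dvd_pow hpi)
  exact hc (dvd_iff_isRoot.1 (this.symm.dvd.trans hd))

/-- Splitting off the linear factors `X ∓ 1` of a self-reciprocal polynomial. -/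
lemma exists_eq_mul_mem_symmFamily [Fintype F] {r : ℕ} {f : F[X]} (hm : f.Monic)
    (h0 : f.coeff 0 ≠ 0) (hs : starPoly f = f) (hP : HasPropertyP r f) :
    ∃ i j l : ℕ, ∃ h ∈ symmFamily F r l, f = (X - C 1) ^ i * (X - C (-1)) ^ j * h ∧
      i + j + 2 * l = f.natDegree ∧ (f.eval 1 = 0 → i ≠ 0) := by
  obtain ⟨k, hk, hk1⟩ := exists_eq_pow_rootMultiplicity_mul_and_not_dvd f hm.ne_zero 1
  have hk0 : k ≠ 0 := by rintro rfl; exact hk1 (dvd_zero _)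
  obtain ⟨h, hh, hhm1⟩ := exists_eq_pow_rootMultiplicity_mul_and_not_dvd k hk0 (-1)
  set i := rootMultiplicity 1 f
  set j := rootMultiplicity (-1) k
  have hf : f = (X - C 1) ^ i * (X - C (-1)) ^ j * h := by rw [mul_assoc, ← hh, ← hk]
  have hL : ((X - C 1) ^ i * (X - C (-1)) ^ j : F[X]).Monic :=
    ((monic_X_sub_C _).pow i).mul ((monic_X_sub_C _).pow j)
  have hLs : starPoly ((X - C 1) ^ i * (X - C (-1)) ^ j : F[X]) =
      (X - C 1) ^ i * (X - C (-1)) ^ j := by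
    rw [starPoly_mul, starPoly_pow, starPoly_pow, starPoly_X_sub_C (by simp),
      starPoly_X_sub_C (by simp)]
  have hhm : h.Monic := hL.of_mul_monic_left (hf ▸ hm)
  have hh0 : h.coeff 0 ≠ 0 := fun e => h0 (by rw [hf, mul_coeff_zero, e, mul_zero])
  have hh1 : h.eval 1 ≠ 0 := fun e =>
    hk1 (dvd_iff_isRoot.2 (by rw [IsRoot, hh, eval_mul, e, mul_zero]))
  have hhm1 : h.eval (-1) ≠ 0 := fun e => hhm1 (dvd_iff_isRoot.2 e)
  have hhs : starPoly h = h := starPoly_right_of_mul hLs hL.ne_zero (hf ▸ hs)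
  obtain ⟨l, hl⟩ := (even_natDegree_of_starPoly_eq hhm hh0 hh1 hhm1 hhs).two_dvd
  refine ⟨i, j, l, h, ⟨hhm, hl, hh0, hhs, hh1, hhm1, ?_⟩, hf, ?_, ?_⟩
  · rw [hasPropertyP_iff hm.ne_zero] at hP
    rw [hasPropertyP_iff hhm.ne_zero]
    intro p hpm hpi
    by_cases hd : p ∣ h
    · have hnd : ¬ p ∣ (X - C 1) ^ i * (X - C (-1)) ^ j := fun e =>
        (hpi.prime.dvd_or_dvd e).elim (not_dvd_X_sub_C_pow hpi hd hh1 i)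
          (not_dvd_X_sub_C_pow hpi hd hhm1 j)
      have := multiplicity_mul hpi.prime
        (finiteMultiplicity_of_irreducible hpi (hf ▸ hm.ne_zero))
      rw [multiplicity_eq_zero.2 hnd, zero_add, ← hf] at this
      rw [← this]
      exact hP p hpm hpi
    · right
      rw [multiplicity_eq_zero.2 hd]
      exact dvd_zero r
  · conv_rhs => rw [hf, hL.natDegree_mul hhm, ((monic_X_sub_C _).pow i).natDegree_mul
      ((monic_X_sub_C _).pow j), natDegree_pow, natDegree_pow, natDegree_X_sub_C,
      natDegree_X_sub_C, hl]
    ring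
  · intro e
    exact (rootMultiplicity_pos hm.ne_zero |>.2 e).ne'

lemma ncard_le_sum_symmFamily [Fintype F] {r n : ℕ} {a : F} (L : ℕ)
    (hL : ∀ i j l : ℕ, i + j + 2 * l = n → (a ≠ 1 → i ≠ 0) → l ≤ L) :
    {f : F[X] | f.Monic ∧ IsStarSymm f ∧ f.natDegree = n ∧ f.coeff 0 = a ∧
      HasPropertyP r f}.ncard ≤
      ∑ l ∈ Finset.range (L + 1), (n - 2 * l + 1) * (symmFamily F r l).ncard := by
  have hsub : {f : F[X] | f.Monic ∧ IsStarSymm f ∧ f.natDegree = n ∧ f.coeff 0 = a ∧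
      HasPropertyP r f} ⊆ ⋃ l ∈ Finset.range (L + 1), ⋃ i ∈ Finset.range (n - 2 * l + 1),
        (fun h => (X - C 1) ^ i * (X - C (-1)) ^ (n - 2 * l - i) * h) '' symmFamily F r l := by
    rintro f ⟨hm, ⟨h0, hrev⟩, hn, hfa, hP⟩
    have hs : starPoly f = f := by
      rw [starPoly, hrev, ← mul_assoc, ← C_mul, inv_mul_cancel₀ h0, C_1, one_mul]
    obtain ⟨i, j, l, h, hh, hf, hd, h1⟩ := exists_eq_mul_mem_symmFamily hm h0 hs hP
    have hl : l ≤ L := by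
      refine hL i j l (hd.trans hn) fun han => h1 ?_
      have := congrArg (eval 1) hrev
      rw [eval_one_reverse, eval_mul, eval_C, hfa] at this
      have : (1 - a) * f.eval 1 = 0 := by rw [sub_mul, ← this]; ring
      exact (mul_eq_zero.1 this).resolve_left (sub_ne_zero.2 (Ne.symm han))
    simp only [Set.mem_iUnion, Finset.mem_range]
    refine ⟨l, by omega, i, by omega, h, hh, ?_⟩
    have : n - 2 * l - i = j := by omega
    simp only [this]
    exact hf.symm
  have hfin : ∀ l i, ((fun h : F[X] => (X - C 1) ^ i * (X - C (-1)) ^ (n - 2 * l - i) * h) ''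
      symmFamily F r l).Finite := fun l i => (finite_symmFamily F r l).image _
  refine (Set.ncard_le_ncard hsub ((Finset.finite_toSet _).biUnion fun l _ =>
    (Finset.finite_toSet _).biUnion fun i _ => hfin l i)).trans ?_
  refine (Finset.set_ncard_biUnion_le _ _).trans (Finset.sum_le_sum fun l _ => ?_)
  refine (Finset.set_ncard_biUnion_le _ _).trans ?_
  refine (Finset.sum_le_card_nsmul _ _ _ fun i _ =>
    Set.ncard_image_le (finite_symmFamily F r l)).trans ?_
  rw [Finset.card_range, smul_eq_mul]

end Decomposition

section LowerBound

variable {F : Type} [Field F]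

lemma isStarSymm_of_coeff_sub {f : F[X]} {n : ℕ} {a : F} (hf : f.Monic) (hn : f.natDegree = n)
    (ha : a ^ 2 = 1) (h : ∀ i ≤ n, f.coeff (n - i) = a * f.coeff i) :
    IsStarSymm f ∧ f.coeff 0 = a := by
  have h0 : f.coeff 0 = a := by
    have := h n le_rfl
    rwa [Nat.sub_self, ← hn, hf.coeff_natDegree, mul_one] at this
  have ha0 : a ≠ 0 := by rintro rfl; simp at ha
  refine ⟨⟨h0 ▸ ha0, ?_⟩, h0⟩
  ext i
  rw [h0, coeff_C_mul, coeff_reverse, hn]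
  rcases le_or_gt i n with hi | hi
  · rw [revAt_le hi, h i hi]
  · rw [revAt_eq_self_of_lt hi, coeff_eq_zero_of_natDegree_lt (hn ▸ hi), mul_zero]

/-- The coefficients of the self-reciprocal polynomial of degree `n` with constant coefficient `a`
whose free coefficients are given by `w`. -/
def selfRecCoeff (n : ℕ) (a : F) (w : ℕ → F) (i : ℕ) : F :=
  if i = 0 then a else if i = n then 1 else if 2 * i ≤ n then w i else a * w (n - i)

lemma selfRecCoeff_sub {n : ℕ} {a : F} (hn : n ≠ 0) (ha : a ^ 2 = 1) {w : ℕ → F}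
    (hw : ∀ i, 2 * i = n → w i = a * w i) {i : ℕ} (hi : i ≤ n) :
    selfRecCoeff n a w (n - i) = a * selfRecCoeff n a w i := by
  have haa : a * a = 1 := by rw [← pow_two, ha]
  unfold selfRecCoeff
  by_cases h1 : i = 0
  · subst h1
    simp [hn, haa]
  by_cases h2 : i = n
  · subst h2
    simp [h1]
  have h3 : n - i ≠ 0 := by omega
  have h4 : n - i ≠ n := by omega
  rw [if_neg h3, if_neg h4, if_neg h1, if_neg h2]
  rcases lt_trichotomy (2 * i) n with h | h | h
  · rw [if_neg (by omega), if_pos h.le, Nat.sub_sub_self hi]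
  · have : n - i = i := by omega
    simp only [this, if_pos h.le]
    exact hw i h
  · rw [if_pos (by omega), if_neg (by omega), ← mul_assoc, haa, one_mul]

lemma pow_le_ncard_isStarSymm [Fintype F] {q n k : ℕ} {a : F} (hq : Fintype.card F = q)
    (hn : n ≠ 0) (ha : a ^ 2 = 1) (hk : 2 * k ≤ n) (hkn : 2 * k = n → a = 1) :
    q ^ k ≤ {f : F[X] | f.Monic ∧ IsStarSymm f ∧ f.natDegree = n ∧ f.coeff 0 = a}.ncard := by
  set S := {f : F[X] | f.Monic ∧ IsStarSymm f ∧ f.natDegree = n ∧ f.coeff 0 = a}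
  have hSfin : S.Finite := (finite_setOf_natDegree_le F n).subset fun f hf => hf.2.2.1.le
  let w : (Fin k → F) → ℕ → F := fun v i => if h : 0 < i ∧ i ≤ k then v ⟨i - 1, by omega⟩ else 0
  let P : (Fin k → F) → F[X] := fun v =>
    ∑ i ∈ Finset.range (n + 1), C (selfRecCoeff n a (w v) i) * X ^ i
  have hcoeff : ∀ v i, i ≤ n → (P v).coeff i = selfRecCoeff n a (w v) i := by
    intro v i hi
    simp only [P, finsetSum_coeff, coeff_C_mul_X_pow]
    rw [Finset.sum_ite_eq, if_pos (Finset.mem_range.2 (by omega))]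
  have hle : ∀ v, (P v).natDegree ≤ n := fun v => natDegree_sum_le_of_forall_le _ _ fun i hi =>
    (natDegree_C_mul_X_pow_le _ _).trans (Nat.lt_succ_iff.1 (Finset.mem_range.1 hi))
  have htop : ∀ v, (P v).coeff n = 1 := fun v => by
    rw [hcoeff v n le_rfl, selfRecCoeff, if_neg hn, if_pos rfl]
  have hmem : ∀ v, P v ∈ S := by
    intro v
    have hd : (P v).natDegree = n := natDegree_eq_of_le_of_coeff_ne_zero (hle v) (by simp [htop])
    have hm : (P v).Monic := monic_of_natDegree_le_of_coeff_eq_one n (hle v) (htop v)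
    have := isStarSymm_of_coeff_sub hm hd ha fun i hi => by
      rw [hcoeff v _ (Nat.sub_le n i), hcoeff v i hi]
      refine selfRecCoeff_sub hn ha (fun j hj => ?_) hi
      by_cases hjk : j = k
      · rw [hkn (hjk ▸ hj), one_mul]
      · have : w v j = 0 := dif_neg (by omega)
        rw [this, mul_zero]
    exact ⟨hm, this.1, hd, this.2⟩
  have hinj : Function.Injective P := by
    intro v v' h
    ext ⟨i, hi⟩
    have : (P v).coeff (i + 1) = (P v').coeff (i + 1) := by rw [h]
    rw [hcoeff _ _ (by omega), hcoeff _ _ (by omega)] at this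
    unfold selfRecCoeff at this
    by_cases hin : i + 1 = n
    · omega
    rw [if_neg (by omega), if_neg hin, if_pos (by omega), if_neg (by omega), if_neg hin,
      if_pos (by omega)] at this
    simpa [w, hi] using this
  calc q ^ k = (Set.univ : Set (Fin k → F)).ncard := by
        rw [Set.ncard_univ, Nat.card_eq_fintype_card, Fintype.card_fun, Fintype.card_fin, hq]
    _ ≤ S.ncard := Set.ncard_le_ncard_of_injOn P (fun v _ => hmem v) hinj.injOn hSfin

end LowerBound

section Conclusion

lemma sum_mul_two_pow_le (m : ℕ) :
    ∑ t ∈ Finset.range m, ((t : ℝ) + 1) * (t + 2) * (2⁻¹) ^ t =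
      16 - (2 * (m : ℝ) ^ 2 + 10 * m + 16) * (2⁻¹) ^ m := by
  induction m with
  | zero => norm_num
  | succ m ih =>
    rw [Finset.sum_range_succ, ih, pow_succ]
    push_cast
    ring

lemma sum_mul_pow_le {q : ℕ} (hq : 2 ≤ q) (k : ℕ) :
    ∑ l ∈ Finset.range (k + 1), (((k - l : ℕ) : ℝ) + 1) * ((k - l : ℕ) + 2) * (q : ℝ) ^ l ≤
      16 * (q : ℝ) ^ k := by
  have hq2 : (2 : ℝ) ≤ q := by exact_mod_cast hq
  rw [← Finset.sum_flip]
  calc _ ≤ ∑ t ∈ Finset.range (k + 1), ((t : ℝ) + 1) * (t + 2) * (2⁻¹) ^ t * (q : ℝ) ^ k := by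
        refine Finset.sum_le_sum fun t ht => ?_
        have htk : t ≤ k := Nat.lt_succ_iff.1 (Finset.mem_range.1 ht)
        rw [Nat.sub_sub_self htk, mul_assoc _ (2⁻¹ ^ t)]
        refine mul_le_mul_of_nonneg_left ?_ (by positivity)
        rw [inv_pow, inv_mul_eq_div, le_div_iff₀ (by positivity)]
        calc (q : ℝ) ^ (k - t) * 2 ^ t ≤ (q : ℝ) ^ (k - t) * (q : ℝ) ^ t := by gcongr
          _ = (q : ℝ) ^ k := by rw [← pow_add, Nat.sub_add_cancel htk]
    _ = (16 - (2 * ((k + 1 : ℕ) : ℝ) ^ 2 + 10 * (k + 1 : ℕ) + 16) * (2⁻¹) ^ (k + 1)) *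
          (q : ℝ) ^ k := by
        rw [← Finset.sum_mul, sum_mul_two_pow_le]
    _ ≤ _ := by
        refine mul_le_mul_of_nonneg_right (sub_le_self _ ?_) (by positivity)
        positivity

lemma ncard_hasPropertyP_le {F : Type} [Field F] [Fintype F] {q n r : ℕ} {a : F}
    (hq : Fintype.card F = q) (hr : 2 ≤ r) (hn : 1 ≤ n) (ha : a = 1 ∨ a = -1) {δ : ℝ}
    (hδ0 : 0 ≤ δ) (hδ1 : δ ≤ 1) (hodd : Odd r → δ = 1 / r) (heven : Even r → δ = 3 / (2 * r)) :
    ({f : F[X] | f.Monic ∧ IsStarSymm f ∧ f.natDegree = n ∧ f.coeff 0 = a ∧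
        HasPropertyP r f}.ncard : ℝ) ≤
      960 * Real.exp 11 * ({f : F[X] | f.Monic ∧ IsStarSymm f ∧ f.natDegree = n ∧
        f.coeff 0 = a}.ncard : ℝ) * (n : ℝ) ^ (-1 + δ) := by
  have ha2 : a ^ 2 = 1 := by rcases ha with rfl | rfl <;> simp
  obtain ⟨k, hk, hkn, hnk, hL⟩ : ∃ k, 2 * k ≤ n ∧ (2 * k = n → a = 1) ∧ n ≤ 2 * k + 2 ∧
      ∀ i j l : ℕ, i + j + 2 * l = n → (a ≠ 1 → i ≠ 0) → l ≤ k := by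
    by_cases ha1 : a = 1
    · exact ⟨n / 2, by omega, fun _ => ha1, by omega, fun i j l h _ => by omega⟩
    · exact ⟨(n - 1) / 2, by omega, fun h => by omega, by omega, fun i j l h hi => by
        have := hi ha1
        omega⟩
  set N := {f : F[X] | f.Monic ∧ IsStarSymm f ∧ f.natDegree = n ∧ f.coeff 0 = a}.ncard
  have hN : (q : ℝ) ^ k ≤ N := by
    exact_mod_cast pow_le_ncard_isStarSymm hq (by omega) ha2 hk hkn
  have hcount := ncard_le_sum_symmFamily (r := r) k hL
  set M := {f : F[X] | f.Monic ∧ IsStarSymm f ∧ f.natDegree = n ∧ f.coeff 0 = a ∧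
    HasPropertyP r f}.ncard
  have hq2 : 2 ≤ q := hq ▸ Fintype.one_lt_card
  have hn0 : (0 : ℝ) < n := by exact_mod_cast hn
  have hterm : ∀ l ∈ Finset.range (k + 1),
      (n : ℝ) * (((n - 2 * l + 1 : ℕ) : ℝ) * (symmFamily F r l).ncard) ≤
        60 * Real.exp 11 * (n : ℝ) ^ δ *
          ((((k - l : ℕ) : ℝ) + 1) * ((k - l : ℕ) + 2) * (q : ℝ) ^ l) := by
    intro l hl
    obtain ⟨t, rfl⟩ := Nat.exists_eq_add_of_le (Nat.lt_succ_iff.1 (Finset.mem_range.1 hl))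
    rw [Nat.add_sub_cancel_left]
    have hH := ncard_symmFamily_le hq hr hδ0 hδ1 hodd heven l
    set H : ℝ := ((symmFamily F r l).ncard : ℝ)
    have hH0 : 0 ≤ H := Nat.cast_nonneg _
    have h1 : ((n - 2 * l + 1 : ℕ) : ℝ) ≤ 2 * (t + 2) := by
      have : n - 2 * l + 1 ≤ 2 * (t + 2) := by omega
      exact_mod_cast this
    have h2 : (n : ℝ) ≤ 2 * ((t + 1) * (l + 1)) := by
      have : n ≤ 2 * ((t + 1) * (l + 1)) := by nlinarith
      exact_mod_cast this
    have h3 : ((l : ℝ) + 1) ^ δ ≤ (n : ℝ) ^ δ := by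
      refine Real.rpow_le_rpow (by positivity) ?_ hδ0
      have : l + 1 ≤ n := by omega
      exact_mod_cast this
    calc (n : ℝ) * (((n - 2 * l + 1 : ℕ) : ℝ) * H)
        ≤ 2 * ((t + 1) * (l + 1)) * (2 * (t + 2) * H) := by gcongr
      _ = 4 * (t + 1) * (t + 2) * ((l + 1) * H) := by ring
      _ ≤ 4 * (t + 1) * (t + 2) * (15 * Real.exp 11 * q ^ l * (n : ℝ) ^ δ) := by
          refine mul_le_mul_of_nonneg_left (hH.trans ?_) (by positivity)
          gcongr
      _ = _ := by ring
  have hmain : (n : ℝ) * M ≤ 960 * Real.exp 11 * N * (n : ℝ) ^ δ := by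
    calc (n : ℝ) * M ≤ (n : ℝ) * ∑ l ∈ Finset.range (k + 1),
          ((n - 2 * l + 1 : ℕ) : ℝ) * (symmFamily F r l).ncard := by
          refine mul_le_mul_of_nonneg_left ?_ hn0.le
          exact_mod_cast hcount
      _ ≤ 60 * Real.exp 11 * (n : ℝ) ^ δ * ∑ l ∈ Finset.range (k + 1),
          ((((k - l : ℕ) : ℝ) + 1) * ((k - l : ℕ) + 2) * (q : ℝ) ^ l) := by
          rw [Finset.mul_sum, Finset.mul_sum]
          exact Finset.sum_le_sum hterm
      _ ≤ 60 * Real.exp 11 * (n : ℝ) ^ δ * (16 * N) := by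
          refine mul_le_mul_of_nonneg_left ((sum_mul_pow_le hq2 k).trans ?_) (by positivity)
          gcongr
      _ = _ := by ring
  rw [Real.rpow_add hn0, Real.rpow_neg_one, mul_comm (n : ℝ)⁻¹, ← mul_assoc, ← div_eq_mul_inv,
    le_div_iff₀ hn0, mul_comm (M : ℝ)]
  exact hmain

end Conclusion

/-- **Counting polynomials with property `P_r`, *-symmetric case.**
Let `N` be the number of *-symmetric monic polynomials of degree `n` over a finite field with
`q` elements with constant coefficient `a = ±1`. Then the number of such polynomials having
property `P_r` (with `r ≥ 2`) is `≤ C N n^{-1+1/r}` if `r` is odd, and `≤ C N n^{-1+3/(2r)}`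
if `r` is even. -/
theorem stmt13 : ∃ C : ℝ, 0 < C ∧
    ∀ (F : Type) [Field F] [Fintype F], ∀ (q n r : ℕ) (a : F),
      Fintype.card F = q → 2 ≤ r → 1 ≤ n → (a = 1 ∨ a = -1) →
      (Odd r →
        ({f : F[X] | f.Monic ∧ IsStarSymm f ∧ f.natDegree = n ∧ f.coeff 0 = a ∧
            HasPropertyP r f}.ncard : ℝ) ≤
          C * ({f : F[X] | f.Monic ∧ IsStarSymm f ∧ f.natDegree = n ∧
                f.coeff 0 = a}.ncard : ℝ) * (n : ℝ) ^ (-1 + 1 / (r : ℝ))) ∧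
      (Even r →
        ({f : F[X] | f.Monic ∧ IsStarSymm f ∧ f.natDegree = n ∧ f.coeff 0 = a ∧
            HasPropertyP r f}.ncard : ℝ) ≤
          C * ({f : F[X] | f.Monic ∧ IsStarSymm f ∧ f.natDegree = n ∧
                f.coeff 0 = a}.ncard : ℝ) * (n : ℝ) ^ (-1 + 3 / (2 * (r : ℝ)))) := by
  refine ⟨960 * Real.exp 11, by positivity, ?_⟩
  intro F _ _ q n r a hq hr hn ha
  have hr2 : (2 : ℝ) ≤ r := by exact_mod_cast hr
  refine ⟨fun hodd => ?_, fun heven => ?_⟩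
  · refine ncard_hasPropertyP_le (δ := 1 / r) hq hr hn ha (by positivity) ?_ (fun _ => rfl)
      fun he => absurd he (Nat.not_even_iff_odd.2 hodd)
    rw [div_le_one (by linarith)]
    linarith
  · refine ncard_hasPropertyP_le (δ := 3 / (2 * r)) hq hr hn ha (by positivity) ?_
      (fun ho => absurd heven (Nat.not_even_iff_odd.2 ho)) fun _ => rfl
    rw [div_le_one (by linarith)]
    linarith
end
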